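/- For each α ∈ {2, 4, 6} there exists a function u : ℝ² → ℝ, real analytic on an open neighborhood of the closed unit disk Ω̄, such that −Δu(x,y) = (x² + y²)^{α/2} · u(x,y)³ on Ω, u = 0 on ∂Ω, u > 0 on Ω, the Morse index of u equals 1, and u is not invariant under any nontrivial rotation, i.e. for every β ∈ ℝ with e^{iβ} ≠ 1 there exists (x,y) ∈ Ω with u(R_β(x,y)) ≠ u(x,y). -/

import Mathlib

open MeasureTheory

/-- The open unit disk in `ℝ²`. -/
def unitDisk : Set (ℝ × ℝ) := {p | p.1 ^ 2 + p.2 ^ 2 < 1}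

/-- The Laplacean `Δu = ∂²u/∂x² + ∂²u/∂y²`. -/
noncomputable def lap (u : ℝ × ℝ → ℝ) (p : ℝ × ℝ) : ℝ :=
  deriv (fun x => deriv (fun x' => u (x', p.2)) x) p.1 +
  deriv (fun y => deriv (fun y' => u (p.1, y')) y) p.2

/-- Rotation of the plane by angle `α` about the origin. -/
noncomputable def rot (α : ℝ) (p : ℝ × ℝ) : ℝ × ℝ :=
  (p.1 * Real.cos α - p.2 * Real.sin α, p.1 * Real.sin α + p.2 * Real.cos α)

/-- `|∇v|²`. -/
noncomputable def gradSq (v : ℝ × ℝ → ℝ) (p : ℝ × ℝ) : ℝ :=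
  (deriv (fun x => v (x, p.2)) p.1) ^ 2 + (deriv (fun y => v (p.1, y)) p.2) ^ 2

/-- The quadratic form `v ↦ ∫_Ω (|∇v|² − 3 w u² v²)`, i.e. `D²J(u)(v,v)`. -/
noncomputable def qform (w u v : ℝ × ℝ → ℝ) : ℝ :=
  ∫ p in unitDisk, (gradSq v p - 3 * w p * (u p) ^ 2 * (v p) ^ 2)

/-- A subspace of `C_c^∞(Ω)` on which the second variation of `J` at `u` is
negative definite. -/
def NegDefSubspace (w u : ℝ × ℝ → ℝ) (V : Submodule ℝ (ℝ × ℝ → ℝ)) : Prop :=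
  (∀ v ∈ V, ContDiff ℝ (⊤ : ℕ∞) v ∧ HasCompactSupport v ∧ tsupport v ⊆ unitDisk) ∧
  (∀ v ∈ V, v ≠ 0 → qform w u v < 0)

/-- The Morse index of `u` (the supremum of the dimensions of subspaces of
`C_c^∞(Ω)` on which the second variation is negative definite) equals `k`. -/
def MorseIndexEq (w u : ℝ × ℝ → ℝ) (k : ℕ) : Prop :=
  (∃ V : Submodule ℝ (ℝ × ℝ → ℝ), NegDefSubspace w u V ∧ Module.rank ℝ V = k) ∧
  (∀ V : Submodule ℝ (ℝ × ℝ → ℝ), NegDefSubspace w u V → Module.rank ℝ V ≤ k)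

namespace Henon

open Complex Metric Set Filter Topology

/-- The closed unit disk of `ℂ` as a type. -/
abbrev D : Type := ↥(closedBall (0 : ℂ) 1)

noncomputable instance instMeasureSpaceD : MeasureSpace D := Measure.Subtype.measureSpace

theorem measurableEmbedding_val : MeasurableEmbedding (Subtype.val : D → ℂ) :=
  MeasurableEmbedding.subtype_coe measurableSet_closedBall

theorem integral_D {E : Type*} [NormedAddCommGroup E] [NormedSpace ℝ E] (f : ℂ → E) :
    ∫ z : D, f z = ∫ z in closedBall (0 : ℂ) 1, f z :=
  integral_subtype_comap measurableSet_closedBall f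

instance : IsFiniteMeasure (volume : Measure D) := by
  constructor
  have : (volume : Measure D) = Measure.comap Subtype.val volume := rfl
  rw [this, measurableEmbedding_val.comap_apply]
  refine lt_of_le_of_lt (measure_mono (image_subset_range _ _)) ?_
  simp only [Subtype.range_coe_subtype, ofPred_mem_eq]
  exact measure_closedBall_lt_top

theorem D.norm_le (z : D) : ‖(z : ℂ)‖ ≤ 1 := mem_closedBall_zero_iff.1 z.2

theorem closure_interior_D : closure {z : D | ‖(z : ℂ)‖ < 1} = univ := by
  apply eq_univ_of_forall
  intro z
  rw [mem_closure_iff_seq_limit]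
  have hz := z.norm_le
  have h2 : ∀ n : ℕ, ‖((1 - 1 / ((n : ℝ) + 1) : ℝ) : ℂ) * z‖ < 1 := by
    intro n
    have hn : (0 : ℝ) < 1 / ((n : ℝ) + 1) := by positivity
    have hn' : 1 / ((n : ℝ) + 1) ≤ 1 := by
      rw [div_le_one (by positivity)]; linarith [(Nat.cast_nonneg n : (0 : ℝ) ≤ n)]
    rw [norm_mul, Complex.norm_real, Real.norm_of_nonneg (by linarith)]
    nlinarith [norm_nonneg (z : ℂ)]
  refine ⟨fun n => ⟨((1 - 1 / ((n : ℝ) + 1) : ℝ) : ℂ) * z, by simpa using (h2 n).le⟩,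
    fun n => h2 n, ?_⟩
  rw [tendsto_subtype_rng]
  have : Tendsto (fun n : ℕ => ((1 - 1 / ((n : ℝ) + 1) : ℝ) : ℂ) * z) atTop
      (𝓝 (((1 - 0 : ℝ) : ℂ) * z)) := by
    refine Tendsto.mul_const _ ?_
    refine (Complex.continuous_ofReal.tendsto _).comp ?_
    exact tendsto_const_nhds.sub tendsto_one_div_add_atTop_nhds_zero_nat
  simpa using this

instance : (volume : Measure D).IsOpenPosMeasure := by
  constructor
  intro U hU hne h0
  have hd : Dense {z : D | ‖(z : ℂ)‖ < 1} := dense_iff_closure_eq.2 closure_interior_D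
  obtain ⟨z, hzU, hz⟩ := hd.inter_open_nonempty U hU hne
  have hval : (volume : Measure D) = Measure.comap Subtype.val volume := rfl
  rw [hval, measurableEmbedding_val.comap_apply] at h0
  obtain ⟨V, hV, rfl⟩ := isOpen_induced_iff.1 hU
  have hsub : V ∩ ball (0 : ℂ) 1 ⊆ Subtype.val '' (Subtype.val ⁻¹' V : Set D) := by
    rintro x ⟨hx, hx1⟩
    exact ⟨⟨x, ball_subset_closedBall hx1⟩, hx, rfl⟩
  have hop : IsOpen (V ∩ ball (0 : ℂ) 1) := hV.inter isOpen_ball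
  refine (hop.measure_pos volume ⟨z, hzU, ?_⟩).ne' (measure_mono_null hsub h0)
  simpa using hz

theorem integrable_cont (f : C(D, ℝ)) : Integrable (fun z => f z) :=
  f.continuous.integrable_of_hasCompactSupport (HasCompactSupport.of_compactSpace _)

/-! ### The Green kernel -/

/-- Regularised Green kernel of the unit disk; `ε = 0` gives the Green function. -/
noncomputable def ker (ε : ℝ) (z ζ : ℂ) : ℝ :=
  (1 / (4 * Real.pi)) *
    Real.log (1 + (1 - ‖z‖ ^ 2) * (1 - ‖ζ‖ ^ 2) / (‖z - ζ‖ ^ 2 + ε))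

theorem one_sub_sq_nonneg (z : D) : 0 ≤ 1 - ‖(z : ℂ)‖ ^ 2 := by
  have hz := z.norm_le
  nlinarith [norm_nonneg (z : ℂ)]

theorem one_sub_sq_le (z : D) : 1 - ‖(z : ℂ)‖ ^ 2 ≤ 1 := by
  nlinarith [norm_nonneg (z : ℂ)]

theorem ker_nonneg {ε : ℝ} (hε : 0 ≤ ε) (z ζ : D) : 0 ≤ ker ε z ζ := by
  unfold ker
  refine mul_nonneg (by positivity) (Real.log_nonneg ?_)
  have := one_sub_sq_nonneg z
  have := one_sub_sq_nonneg ζ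
  have : 0 ≤ (1 - ‖(z : ℂ)‖ ^ 2) * (1 - ‖(ζ : ℂ)‖ ^ 2) / (‖(z : ℂ) - ζ‖ ^ 2 + ε) := by positivity
  linarith

theorem ker_pos (z ζ : D) (hz : ‖(z : ℂ)‖ < 1) (hζ : ‖(ζ : ℂ)‖ < 1) (h : z ≠ ζ) :
    0 < ker 0 z ζ := by
  unfold ker
  refine mul_pos (by positivity) (Real.log_pos ?_)
  have h1 : 0 < 1 - ‖(z : ℂ)‖ ^ 2 := by nlinarith [norm_nonneg (z : ℂ)]
  have h2 : 0 < 1 - ‖(ζ : ℂ)‖ ^ 2 := by nlinarith [norm_nonneg (ζ : ℂ)]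
  have h3 : 0 < ‖(z : ℂ) - ζ‖ := norm_pos_iff.2 (sub_ne_zero.2 (fun h' => h (Subtype.ext h')))
  have : 0 < (1 - ‖(z : ℂ)‖ ^ 2) * (1 - ‖(ζ : ℂ)‖ ^ 2) / (‖(z : ℂ) - ζ‖ ^ 2 + 0) := by positivity
  linarith

theorem log_one_add_pow_le {n : ℕ} (hn : n ≠ 0) {y : ℝ} (hy : 0 ≤ y) :
    Real.log (1 + y ^ n) ≤ n * y := by
  have h1 : 1 + y ^ n ≤ (1 + y) ^ n := by
    have := pow_add_pow_le (zero_le_one' ℝ) hy hn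
    simpa using this
  calc Real.log (1 + y ^ n) ≤ Real.log ((1 + y) ^ n) := Real.log_le_log (by positivity) h1
    _ = n * Real.log (1 + y) := Real.log_pow _ _
    _ ≤ n * y := by
      refine mul_le_mul_of_nonneg_left ?_ (by positivity)
      linarith [Real.log_le_sub_one_of_pos (show 0 < 1 + y by linarith)]

theorem ker_pow_four_le (z ζ : D) : ker 0 z ζ ^ 4 ≤ 1 / ‖(z : ℂ) - ζ‖ := by
  rcases eq_or_lt_of_le (norm_nonneg ((z : ℂ) - ζ)) with h0 | h0
  · simp [ker, ← h0]
  set d := ‖(z : ℂ) - ζ‖ with hd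
  set y := Real.sqrt (Real.sqrt (1 / d)) with hy
  have hy0 : 0 ≤ y := Real.sqrt_nonneg _
  have hy4 : y ^ 4 = 1 / d := by
    have h1 : y ^ 2 = Real.sqrt (1 / d) := Real.sq_sqrt (Real.sqrt_nonneg _)
    calc y ^ 4 = (y ^ 2) ^ 2 := by ring
      _ = 1 / d := by rw [h1, Real.sq_sqrt (by positivity)]
  have hA : (1 - ‖(z : ℂ)‖ ^ 2) * (1 - ‖(ζ : ℂ)‖ ^ 2) ≤ 1 :=
    mul_le_one₀ (one_sub_sq_le z) (one_sub_sq_nonneg ζ) (one_sub_sq_le ζ)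
  have hA0 : 0 ≤ (1 - ‖(z : ℂ)‖ ^ 2) * (1 - ‖(ζ : ℂ)‖ ^ 2) :=
    mul_nonneg (one_sub_sq_nonneg z) (one_sub_sq_nonneg ζ)
  have hle : ker 0 z ζ ≤ y := by
    unfold ker
    rw [← hd, add_zero]
    have h8 : (1 - ‖(z : ℂ)‖ ^ 2) * (1 - ‖(ζ : ℂ)‖ ^ 2) / d ^ 2 ≤ y ^ 8 := by
      have : y ^ 8 = 1 / d ^ 2 := by
        calc y ^ 8 = (y ^ 4) ^ 2 := by ring
          _ = _ := by rw [hy4]; field_simp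
      rw [this]
      gcongr
    have h9 : Real.log (1 + (1 - ‖(z : ℂ)‖ ^ 2) * (1 - ‖(ζ : ℂ)‖ ^ 2) / d ^ 2) ≤ 8 * y := by
      refine le_trans (Real.log_le_log (by positivity) (add_le_add_right h8 1)) ?_
      exact_mod_cast log_one_add_pow_le (n := 8) (by norm_num) hy0
    have hpi : 1 / (4 * Real.pi) ≤ 1 / 8 := by
      apply one_div_le_one_div_of_le (by norm_num)
      linarith [Real.two_le_pi]
    calc _ ≤ 1 / (4 * Real.pi) * (8 * y) := by gcongr
      _ ≤ 1 / 8 * (8 * y) := by gcongr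
      _ = y := by ring
  rw [← hy4]
  exact pow_le_pow_left₀ (ker_nonneg le_rfl z ζ) hle 4

theorem abs_ker_sub_le {ε : ℝ} (hε : 0 < ε) (z ζ : D) (h : z ≠ ζ) :
    |ker 0 z ζ - ker ε z ζ| ≤ Real.sqrt ε / ‖(z : ℂ) - ζ‖ := by
  have h0 : 0 < ‖(z : ℂ) - ζ‖ := norm_pos_iff.2 (sub_ne_zero.2 (fun h' => h (Subtype.ext h')))
  set d := ‖(z : ℂ) - ζ‖ with hd
  have hA0 : 0 ≤ (1 - ‖(z : ℂ)‖ ^ 2) * (1 - ‖(ζ : ℂ)‖ ^ 2) :=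
    mul_nonneg (one_sub_sq_nonneg z) (one_sub_sq_nonneg ζ)
  set A := (1 - ‖(z : ℂ)‖ ^ 2) * (1 - ‖(ζ : ℂ)‖ ^ 2) with hAd
  have e1 : ker 0 z ζ - ker ε z ζ =
      1 / (4 * Real.pi) * (Real.log (1 + A / d ^ 2) - Real.log (1 + A / (d ^ 2 + ε))) := by
    unfold ker
    rw [← hd, ← hAd, add_zero]; ring
  have h1 : Real.log (1 + A / (d ^ 2 + ε)) ≤ Real.log (1 + A / d ^ 2) := by
    apply Real.log_le_log (by positivity)
    gcongr
    linarith
  have h2 : Real.log (1 + A / d ^ 2) ≤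
      Real.log (1 + A / (d ^ 2 + ε)) + 2 * (Real.sqrt ε / d) := by
    have : 1 + A / d ^ 2 ≤ (1 + (Real.sqrt ε / d) ^ 2) * (1 + A / (d ^ 2 + ε)) := by
      rw [div_pow, Real.sq_sqrt hε.le]
      have : (1 + ε / d ^ 2) * (1 + A / (d ^ 2 + ε)) = 1 + ε / d ^ 2 + A / d ^ 2 := by
        field_simp
      rw [this]
      have : 0 ≤ ε / d ^ 2 := by positivity
      linarith
    refine le_trans (Real.log_le_log (by positivity) this) ?_
    rw [Real.log_mul (by positivity) (by positivity), add_comm]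
    gcongr
    exact_mod_cast log_one_add_pow_le (n := 2) (by norm_num) (by positivity)
  have hpi : 1 / (4 * Real.pi) ≤ 1 / 2 := by
    apply one_div_le_one_div_of_le (by norm_num)
    linarith [Real.two_le_pi]
  rw [e1, abs_of_nonneg (mul_nonneg (by positivity) (by linarith))]
  calc _ ≤ 1 / (4 * Real.pi) * (2 * (Real.sqrt ε / d)) := by gcongr; linarith
    _ ≤ 1 / 2 * (2 * (Real.sqrt ε / d)) := by gcongr
    _ = _ := by ring

/-- `∫_{|ζ| < 2} dζ / |ζ|`, a uniform bound for `∫_D dζ / |z - ζ|`. -/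
noncomputable def invDistBound : ℝ := ∫ ζ in closedBall (0 : ℂ) 2, 1 / ‖ζ‖

theorem integrableOn_inv_norm (R : ℝ) :
    IntegrableOn (fun ζ : ℂ => 1 / ‖ζ‖) (closedBall 0 R) := by
  have h := integrableOn_ball_of_norm_le_rpow (E := ℂ) (μ := volume) (f := fun ζ : ℂ => 1 / ‖ζ‖)
    (C := 1) (α := 1) (r := R + 1) (by simp) (by norm_num [Complex.finrank_real_complex])
    (ae_of_all _ fun x => by simp [Real.rpow_neg_one])
    (Measurable.aestronglyMeasurable (by fun_prop))
  exact h.mono_set (closedBall_subset_ball (by linarith))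

theorem integrable_D_iff {E : Type*} [NormedAddCommGroup E] {f : ℂ → E} :
    Integrable (fun z : D => f z) ↔ IntegrableOn f (closedBall 0 1) := by
  have h : (volume : Measure ℂ).restrict (closedBall 0 1) =
      Measure.map Subtype.val (volume : Measure D) :=
    (map_comap_subtype_coe measurableSet_closedBall _).symm
  rw [IntegrableOn, h, measurableEmbedding_val.integrable_map_iff]
  rfl

theorem measurePreserving_sub_left (z : ℂ) :
    MeasurePreserving (fun ζ : ℂ => z - ζ) volume volume :=
  Measure.measurePreserving_sub_left volume z

theorem measurableEmbedding_sub_left (z : ℂ) : MeasurableEmbedding (fun ζ : ℂ => z - ζ) :=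
  (Homeomorph.subLeft z).measurableEmbedding

theorem sub_mem_closedBall_two (z : D) :
    closedBall (0 : ℂ) 1 ⊆ (fun ζ : ℂ => (z : ℂ) - ζ) ⁻¹' closedBall 0 2 := by
  intro ζ hζ
  simp only [mem_preimage, mem_closedBall_zero_iff] at hζ ⊢
  linarith [norm_sub_le (z : ℂ) ζ, z.norm_le]

theorem integrableOn_inv_dist_preimage (z : ℂ) :
    IntegrableOn (fun ζ : ℂ => 1 / ‖z - ζ‖) ((fun ζ : ℂ => z - ζ) ⁻¹' closedBall 0 2) :=
  ((measurePreserving_sub_left z).integrableOn_comp_preimage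
    (measurableEmbedding_sub_left z)).2 (integrableOn_inv_norm 2)

theorem integrable_inv_dist (z : D) : Integrable (fun ζ : D => 1 / ‖(z : ℂ) - ζ‖) :=
  (integrable_D_iff (f := fun ζ => 1 / ‖(z : ℂ) - ζ‖)).2
    ((integrableOn_inv_dist_preimage z).mono_set (sub_mem_closedBall_two z))

theorem integral_inv_dist_le (z : D) : ∫ ζ : D, 1 / ‖(z : ℂ) - ζ‖ ≤ invDistBound := by
  rw [integral_D (fun ζ => 1 / ‖(z : ℂ) - ζ‖)]
  calc _ ≤ ∫ ζ in (fun ζ : ℂ => (z : ℂ) - ζ) ⁻¹' closedBall 0 2, 1 / ‖(z : ℂ) - ζ‖ :=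
        setIntegral_mono_set (integrableOn_inv_dist_preimage z)
          (ae_of_all _ fun ζ => by positivity) (sub_mem_closedBall_two z).eventuallyLE
    _ = invDistBound := (measurePreserving_sub_left z).setIntegral_preimage_emb
          (measurableEmbedding_sub_left z) (fun ζ : ℂ => 1 / ‖ζ‖) _

theorem invDistBound_nonneg : 0 ≤ invDistBound :=
  integral_nonneg fun ζ => by positivity

/-! ### Integrability of the kernel -/

@[fun_prop]
theorem measurable_ker_right (ε : ℝ) (z : ℂ) : Measurable (fun ζ : D => ker ε z ζ) := by
  unfold ker
  fun_prop

theorem ker_le (z ζ : D) : ker 0 z ζ ≤ 1 + 1 / ‖(z : ℂ) - ζ‖ := by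
  have h := ker_pow_four_le z ζ
  nlinarith [sq_nonneg (ker 0 z ζ ^ 2 - 1), sq_nonneg (ker 0 z ζ - 1), ker_nonneg le_rfl z ζ]

theorem integrable_ker (z : D) : Integrable (fun ζ : D => ker 0 z ζ) := by
  refine Integrable.mono' ((integrable_const 1).add (integrable_inv_dist z))
    (Measurable.aestronglyMeasurable (by fun_prop)) (ae_of_all _ fun ζ => ?_)
  rw [Real.norm_of_nonneg (ker_nonneg le_rfl z ζ)]
  exact ker_le z ζ

theorem integrable_ker_mul (z : D) (f : C(D, ℝ)) : Integrable (fun ζ : D => ker 0 z ζ * f ζ) := by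
  exact (integrable_ker z).mul_bdd f.continuous.aestronglyMeasurable
    (ae_of_all _ fun ζ => f.norm_coe_le_norm ζ)

theorem integrable_ker_pow_four (z : D) : Integrable (fun ζ : D => ker 0 z ζ ^ 4) := by
  refine Integrable.mono' (integrable_inv_dist z)
    (Measurable.aestronglyMeasurable (by fun_prop)) (ae_of_all _ fun ζ => ?_)
  rw [Real.norm_of_nonneg (pow_nonneg (ker_nonneg le_rfl z ζ) 4)]
  exact ker_pow_four_le z ζ

theorem integral_ker_pow_four_le (z : D) : ∫ ζ : D, ker 0 z ζ ^ 4 ≤ invDistBound :=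
  (integral_mono (integrable_ker_pow_four z) (integrable_inv_dist z)
    (ker_pow_four_le z)).trans (integral_inv_dist_le z)

theorem ae_ne_D (z : D) : ∀ᵐ ζ : D, z ≠ ζ := by
  have : (volume : Measure D) {z} = 0 := by
    change Measure.comap Subtype.val volume {z} = 0
    rw [measurableEmbedding_val.comap_apply]
    simp
  refine (measure_eq_zero_iff_ae_notMem.1 this).mono fun ζ h => ?_
  rintro rfl
  exact h rfl

theorem continuous_ker {ε : ℝ} (hε : 0 < ε) : Continuous (fun p : D × D => ker ε p.1 p.2) := by
  unfold ker
  have h : ∀ p : D × D, ‖(p.1 : ℂ) - p.2‖ ^ 2 + ε ≠ 0 := fun p => by positivity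
  have h2 : ∀ p : D × D, 1 + (1 - ‖(p.1 : ℂ)‖ ^ 2) * (1 - ‖(p.2 : ℂ)‖ ^ 2) /
      (‖(p.1 : ℂ) - p.2‖ ^ 2 + ε) ≠ 0 := fun p => by
    have := one_sub_sq_nonneg p.1
    have := one_sub_sq_nonneg p.2
    positivity
  fun_prop (disch := assumption)

/-- The regularised kernel as a continuous function. -/
noncomputable def kerC {ε : ℝ} (hε : 0 < ε) : C(D × D, ℝ) :=
  ⟨fun p => ker ε p.1 p.2, continuous_ker hε⟩

/-! ### Integral operators -/

/-- The integral operator with a continuous kernel. -/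
noncomputable def intOp (k : C(D × D, ℝ)) : C(D, ℝ) →L[ℝ] C(D, ℝ) :=
  LinearMap.mkContinuous
    { toFun := fun f => ⟨fun z => ∫ ζ : D, k (z, ζ) * f ζ, by
        refine continuous_of_dominated (bound := fun _ => ‖k‖ * ‖f‖) (fun z => ?_) (fun z => ?_)
          (integrable_const _) ?_
        · exact Continuous.aestronglyMeasurable (by fun_prop)
        · refine ae_of_all _ fun ζ => ?_
          rw [norm_mul]
          gcongr
          · exact k.norm_coe_le_norm _
          · exact f.norm_coe_le_norm _
        · exact ae_of_all _ fun ζ => by fun_prop⟩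
      map_add' := fun f g => by
        ext z
        simp only [ContinuousMap.coe_mk, ContinuousMap.add_apply, mul_add]
        exact integral_add (integrable_cont (k.comp ⟨fun ζ => (z, ζ), by fun_prop⟩ * f))
          (integrable_cont (k.comp ⟨fun ζ => (z, ζ), by fun_prop⟩ * g))
      map_smul' := fun c f => by
        ext z
        simp only [ContinuousMap.coe_mk, ContinuousMap.smul_apply, smul_eq_mul, RingHom.id_apply]
        rw [← integral_const_mul]
        congr 1
        ext ζ
        ring }
    (‖k‖ * (volume : Measure D).real univ) (fun f => by
      rw [ContinuousMap.norm_le _ (by positivity)]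
      intro z
      refine (norm_integral_le_of_norm_le_const (C := ‖k‖ * ‖f‖) (ae_of_all _ fun ζ => ?_)).trans ?_
      · rw [norm_mul]
        gcongr
        · exact k.norm_coe_le_norm _
        · exact f.norm_coe_le_norm _
      · exact le_of_eq (by ring))

theorem intOp_apply (k : C(D × D, ℝ)) (f : C(D, ℝ)) (z : D) :
    intOp k f z = ∫ ζ : D, k (z, ζ) * f ζ := rfl

theorem integrable_kerC_mul (k : C(D × D, ℝ)) (f : C(D, ℝ)) (z : D) :
    Integrable fun ζ : D => k (z, ζ) * f ζ :=
  integrable_cont (k.comp ⟨fun ζ => (z, ζ), by fun_prop⟩ * f)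

theorem abs_green_sub_intOp_le {ε : ℝ} (hε : 0 < ε) (f : C(D, ℝ)) (z : D) :
    |(∫ ζ : D, ker 0 z ζ * f ζ) - intOp (kerC hε) f z| ≤ Real.sqrt ε * invDistBound * ‖f‖ := by
  rw [intOp_apply, ← integral_sub (integrable_ker_mul z f) (integrable_kerC_mul _ f z)]
  calc |∫ ζ : D, (ker 0 z ζ * f ζ - kerC hε (z, ζ) * f ζ)|
      ≤ ∫ ζ : D, Real.sqrt ε * ‖f‖ * (1 / ‖(z : ℂ) - ζ‖) := by
        rw [← Real.norm_eq_abs]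
        refine norm_integral_le_of_norm_le ((integrable_inv_dist z).const_mul _) ?_
        filter_upwards [ae_ne_D z] with ζ hζ
        rw [← sub_mul, norm_mul]
        have h1 : ‖ker 0 z ζ - kerC hε (z, ζ)‖ ≤ Real.sqrt ε / ‖(z : ℂ) - ζ‖ :=
          abs_ker_sub_le hε z ζ hζ
        calc _ ≤ Real.sqrt ε / ‖(z : ℂ) - ζ‖ * ‖f‖ := by
              gcongr
              exact f.norm_coe_le_norm ζ
          _ = _ := by ring
    _ = Real.sqrt ε * ‖f‖ * ∫ ζ : D, 1 / ‖(z : ℂ) - ζ‖ := integral_const_mul _ _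
    _ ≤ Real.sqrt ε * ‖f‖ * invDistBound := by
        gcongr
        exact integral_inv_dist_le z
    _ = _ := by ring

theorem continuous_green (f : C(D, ℝ)) : Continuous fun z : D => ∫ ζ : D, ker 0 z ζ * f ζ := by
  have hu : TendstoUniformly (fun (n : ℕ) (z : D) =>
      intOp (kerC (ε := 1 / ((n : ℝ) + 1)) (by positivity)) f z)
      (fun z : D => ∫ ζ : D, ker 0 z ζ * f ζ) atTop := by
    rw [Metric.tendstoUniformly_iff]
    intro δ hδ
    have ht : Tendsto (fun n : ℕ => Real.sqrt (1 / ((n : ℝ) + 1)) * invDistBound * ‖f‖) atTop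
        (𝓝 (Real.sqrt 0 * invDistBound * ‖f‖)) :=
      (((Real.continuous_sqrt.tendsto 0).comp
        tendsto_one_div_add_atTop_nhds_zero_nat).mul_const _).mul_const _
    simp only [Real.sqrt_zero, zero_mul] at ht
    filter_upwards [ht.eventually (gt_mem_nhds hδ)] with n hn z
    rw [Real.dist_eq]
    exact (abs_green_sub_intOp_le _ f z).trans_lt hn
  exact hu.continuous (Eventually.of_forall fun n => ContinuousMap.continuous _).frequently

/-- The solution operator of the Dirichlet problem, `f ↦ ∫ G(·, ζ) f(ζ) dζ`. -/
noncomputable def green : C(D, ℝ) →L[ℝ] C(D, ℝ) :=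
  LinearMap.mkContinuous
    { toFun := fun f => ⟨fun z => ∫ ζ : D, ker 0 z ζ * f ζ, continuous_green f⟩
      map_add' := fun f g => by
        ext z
        simp only [ContinuousMap.coe_mk, ContinuousMap.add_apply, mul_add]
        exact integral_add (integrable_ker_mul z f) (integrable_ker_mul z g)
      map_smul' := fun c f => by
        ext z
        simp only [ContinuousMap.coe_mk, ContinuousMap.smul_apply, smul_eq_mul, RingHom.id_apply]
        rw [← integral_const_mul]
        congr 1
        ext ζ
        ring }
    ((volume : Measure D).real univ + invDistBound) (fun f => by
      rw [ContinuousMap.norm_le _ (by have := invDistBound_nonneg; positivity)]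
      intro z
      change ‖∫ ζ : D, ker 0 z ζ * f ζ‖ ≤ _
      refine (norm_integral_le_of_norm_le (g := fun ζ : D => (1 + 1 / ‖(z : ℂ) - ζ‖) * ‖f‖)
        (((integrable_const 1).add (integrable_inv_dist z)).mul_const _)
        (ae_of_all _ fun ζ => ?_)).trans ?_
      · rw [norm_mul, Real.norm_of_nonneg (ker_nonneg le_rfl z ζ)]
        have := f.norm_coe_le_norm ζ
        gcongr
        exact ker_le z ζ
      · rw [integral_mul_const, integral_add (integrable_const 1) (integrable_inv_dist z)]
        gcongr
        · simp
        · exact integral_inv_dist_le z)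

theorem green_apply (f : C(D, ℝ)) (z : D) : green f z = ∫ ζ : D, ker 0 z ζ * f ζ := rfl

theorem norm_green_sub_intOp_le {ε : ℝ} (hε : 0 < ε) :
    ‖green - intOp (kerC hε)‖ ≤ Real.sqrt ε * invDistBound := by
  have := invDistBound_nonneg
  refine ContinuousLinearMap.opNorm_le_bound _ (by positivity) fun f => ?_
  rw [ContinuousMap.norm_le _ (by positivity)]
  exact fun z => abs_green_sub_intOp_le hε f z

theorem norm_intOp_le (k : C(D × D, ℝ)) : ‖intOp k‖ ≤ ‖k‖ * (volume : Measure D).real univ :=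
  LinearMap.mkContinuous_norm_le _ (by positivity) _

theorem intOp_add (k l : C(D × D, ℝ)) : intOp (k + l) = intOp k + intOp l := by
  ext f z
  simp only [intOp_apply, ContinuousMap.add_apply, _root_.add_apply, add_mul]
  exact integral_add (integrable_kerC_mul k f z) (integrable_kerC_mul l f z)

end Henon

namespace Henon

open Complex Metric Set Filter Topology

/-! ### Polar coordinates and circle integrals -/

theorem integral_closedBall_polar {E : Type*} [NormedAddCommGroup E] [NormedSpace ℝ E]
    {F : ℂ → E} (hF : IntegrableOn F (closedBall 0 1)) :
    ∫ z in closedBall (0 : ℂ) 1, F z =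
      ∫ r in (0 : ℝ)..1, r • ∫ θ in (-Real.pi)..Real.pi, F (r * Complex.exp (θ * I)) := by
  set g : ℝ × ℝ → E := fun p => p.1 • F (Complex.polarCoord.symm p) with hg
  have hsymm : ∀ p : ℝ × ℝ, Complex.polarCoord.symm p = p.1 * Complex.exp (p.2 * I) := fun p => by
    rw [Complex.polarCoord_symm_apply, Complex.exp_mul_I, ← Complex.ofReal_cos,
      ← Complex.ofReal_sin]
  set s : Set (ℝ × ℝ) := Ioc 0 1 ×ˢ Ioo (-Real.pi) Real.pi with hs
  have hsub : s ⊆ Ioi 0 ×ˢ Ioo (-Real.pi) Real.pi := prod_mono Ioc_subset_Ioi_self subset_rfl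
  have hind : ∀ p ∈ Ioi (0 : ℝ) ×ˢ Ioo (-Real.pi) Real.pi,
      p.1 • (closedBall (0 : ℂ) 1).indicator F (Complex.polarCoord.symm p) = s.indicator g p := by
    intro p hp
    have hp1 : 0 < p.1 := hp.1
    by_cases h : p.1 ≤ 1
    · rw [indicator_of_mem, indicator_of_mem (show p ∈ s from ⟨⟨hp1, h⟩, hp.2⟩)]
      rw [mem_closedBall_zero_iff, Complex.norm_polarCoord_symm, abs_of_pos hp1]
      exact h
    · rw [indicator_of_notMem, indicator_of_notMem (fun h' => h h'.1.2), smul_zero]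
      rw [mem_closedBall_zero_iff, Complex.norm_polarCoord_symm, abs_of_pos hp1]
      exact h
  have hmeas : MeasurableSet s := measurableSet_Ioc.prod measurableSet_Ioo
  have h_integrable : IntegrableOn g s := by
    have h1 : IntegrableOn ((closedBall (0 : ℂ) 1).indicator F) (univ : Set ℂ) := by
      rw [integrableOn_univ]
      exact (integrable_indicator_iff measurableSet_closedBall).2 hF
    have h2 : IntegrableOn (((closedBall (0 : ℂ) 1).indicator F) ∘ measurableEquivRealProd.symm)
        (univ : Set (ℝ × ℝ)) := by
      rw [integrableOn_univ] at h1 ⊢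
      exact Complex.volume_preserving_equiv_real_prod.symm.integrable_comp_of_integrable h1
    have h3 := (integrableOn_image_iff_integrableOn_abs_det_fderiv_smul volume
      (polarCoord.open_target.measurableSet)
      (fun p _ => (hasFDerivAt_polarCoord_symm p).hasFDerivWithinAt) polarCoord.symm.injOn
      (((closedBall (0 : ℂ) 1).indicator F) ∘ measurableEquivRealProd.symm)).1
      (h2.mono_set (subset_univ _))
    have h4 : IntegrableOn (s.indicator g) polarCoord.target := by
      refine h3.congr_fun (fun p hp => ?_) polarCoord.open_target.measurableSet
      rw [← hind p hp]
      simp only [det_fderivPolarCoordSymm, abs_of_pos (show 0 < p.1 from hp.1)]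
      rfl
    have h5 : IntegrableOn (s.indicator g) s := h4.mono_set hsub
    exact h5.congr_fun (fun p hp => indicator_of_mem hp g) hmeas
  calc ∫ z in closedBall (0 : ℂ) 1, F z
      = ∫ z, (closedBall (0 : ℂ) 1).indicator F z :=
        (integral_indicator measurableSet_closedBall).symm
    _ = ∫ p in Ioi (0 : ℝ) ×ˢ Ioo (-Real.pi) Real.pi, s.indicator g p := by
        rw [← Complex.integral_comp_polarCoord_symm]
        exact setIntegral_congr_fun polarCoord.open_target.measurableSet hind
    _ = ∫ p in s, g p := by
        rw [setIntegral_indicator hmeas, inter_eq_self_of_subset_right hsub]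
    _ = _ := by
        rw [hs, Measure.volume_eq_prod, setIntegral_prod _ h_integrable,
          intervalIntegral.integral_of_le zero_le_one]
        refine setIntegral_congr_fun measurableSet_Ioc fun r hr => ?_
        simp only [hg]
        rw [integral_smul, intervalIntegral.integral_of_le (by linarith [Real.pi_pos]),
          integral_Ioc_eq_integral_Ioo]
        congr 1
        refine setIntegral_congr_fun measurableSet_Ioo fun θ hθ => ?_
        simp only [hsymm]

theorem integral_exp_int_mul (n : ℤ) :
    ∫ θ in (-Real.pi)..Real.pi, Complex.exp (n * (θ * I)) = if n = 0 then (2 * Real.pi : ℂ) else 0 := by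
  split_ifs with h
  · subst h
    simp
    ring
  · have hn : (n * I : ℂ) ≠ 0 := mul_ne_zero (by exact_mod_cast h) I_ne_zero
    have : ∀ θ : ℝ, Complex.exp (n * (θ * I)) = Complex.exp ((n * I) * θ) := fun θ => by
      congr 1; ring
    simp_rw [this]
    rw [integral_exp_mul_complex hn]
    have e : Complex.exp (n * I * (Real.pi : ℝ)) = Complex.exp (n * I * ((-Real.pi : ℝ) : ℂ)) := by
      rw [Complex.exp_eq_exp_iff_exists_int]
      exact ⟨n, by push_cast; ring⟩
    rw [e, sub_self, zero_div]

theorem integral_log_norm_mul_exp {w : ℂ} (hw : ‖w‖ < 1) (m : ℕ) :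
    ∫ θ in (-Real.pi)..Real.pi,
      (Real.log ‖1 - w * Complex.exp (θ * I)‖ : ℂ) * Complex.exp (m * (θ * I)) =
      -(Real.pi * (starRingEnd ℂ w) ^ m / m) := by
  set f : ℕ → ℝ → ℂ := fun n θ => -(1 / 2) * (w ^ n / n * Complex.exp (((n + m : ℤ) : ℂ) * (θ * I)) +
    (starRingEnd ℂ w) ^ n / n * Complex.exp (((m - n : ℤ) : ℂ) * (θ * I))) with hf
  have hexp : ∀ (k : ℤ) (θ : ℝ), ‖Complex.exp ((k : ℂ) * (θ * I))‖ = 1 := fun k θ => by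
    rw [← mul_assoc]
    exact_mod_cast Complex.norm_exp_ofReal_mul_I (k * θ)
  have h1 : HasSum (fun n => ∫ θ in (-Real.pi)..Real.pi, f n θ)
      (∫ θ in (-Real.pi)..Real.pi,
      (Real.log ‖1 - w * Complex.exp (θ * I)‖ : ℂ) * Complex.exp (m * (θ * I))) := by
    refine intervalIntegral.hasSum_integral_of_dominated_convergence (fun n _ => ‖w‖ ^ n)
      (fun n => Continuous.aestronglyMeasurable (by fun_prop)) ?_ ?_ ?_ ?_
    · intro n
      refine ae_of_all _ fun θ _ => ?_
      have hd : ‖w ^ n / (n : ℂ)‖ ≤ ‖w‖ ^ n := by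
        rcases Nat.eq_zero_or_pos n with rfl | hn
        · simp
        · rw [norm_div, norm_pow, Complex.norm_natCast]
          exact div_le_self (by positivity) (by exact_mod_cast hn)
      have hd' : ‖(starRingEnd ℂ w) ^ n / (n : ℂ)‖ ≤ ‖w‖ ^ n := by
        have : ‖(starRingEnd ℂ w) ^ n / (n : ℂ)‖ = ‖w ^ n / (n : ℂ)‖ := by
          simp [norm_pow]
        rw [this]; exact hd
      calc ‖f n θ‖ ≤ 1 / 2 * (‖w ^ n / (n : ℂ)‖ + ‖(starRingEnd ℂ w) ^ n / (n : ℂ)‖) := by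
            rw [hf]
            simp only [norm_mul, norm_neg]
            refine mul_le_mul (by norm_num) ((norm_add_le _ _).trans ?_) (norm_nonneg _)
              (by norm_num)
            rw [norm_mul, norm_mul, hexp, hexp, mul_one, mul_one]
        _ ≤ 1 / 2 * (‖w‖ ^ n + ‖w‖ ^ n) := by gcongr
        _ = ‖w‖ ^ n := by ring
    · exact ae_of_all _ fun θ _ => summable_geometric_of_lt_one (norm_nonneg _) hw
    · exact intervalIntegrable_const
    · refine ae_of_all _ fun θ _ => ?_
      set e := Complex.exp (θ * I) with he
      have hz : ‖w * e‖ < 1 := by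
        rw [norm_mul, he, Complex.norm_exp_ofReal_mul_I, mul_one]; exact hw
      have hs := hasSum_taylorSeries_neg_log hz
      have hs' := Complex.hasSum_conj'.2 hs
      have hs2 := ((hs.add hs').mul_left (-(1 / 2))).mul_right (Complex.exp (m * (θ * I)))
      have hconj : starRingEnd ℂ e = Complex.exp (-(θ * I)) := by
        rw [he, ← Complex.exp_conj]; simp
      have e1 : (fun n => f n θ) = fun n : ℕ => -(1 / 2) * ((w * e) ^ n / n +
          starRingEnd ℂ ((w * e) ^ n / n)) * Complex.exp (m * (θ * I)) := by
        ext n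
        rw [hf]
        simp only [map_div₀, map_pow, map_mul, hconj, map_natCast, mul_pow]
        rw [he, ← Complex.exp_nat_mul, ← Complex.exp_nat_mul]
        have a1 : Complex.exp (((n + m : ℤ) : ℂ) * (θ * I)) =
            Complex.exp (n * (θ * I)) * Complex.exp (m * (θ * I)) := by
          rw [← Complex.exp_add]; congr 1; push_cast; ring
        have a2 : Complex.exp (((m - n : ℤ) : ℂ) * (θ * I)) =
            Complex.exp (n * -(θ * I)) * Complex.exp (m * (θ * I)) := by
          rw [← Complex.exp_add]; congr 1; push_cast; ring
        rw [a1, a2]; ring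
      have e2 : (Real.log ‖1 - w * e‖ : ℂ) * Complex.exp (m * (θ * I)) =
          -(1 / 2) * (-Complex.log (1 - w * e) + starRingEnd ℂ (-Complex.log (1 - w * e))) *
            Complex.exp (m * (θ * I)) := by
        congr 1
        rw [map_neg]
        have : -Complex.log (1 - w * e) + -(starRingEnd ℂ) (Complex.log (1 - w * e)) =
            -((2 * (Complex.log (1 - w * e)).re : ℝ) : ℂ) := by
          rw [← Complex.add_conj]; ring
        rw [this, Complex.log_re]
        push_cast; ring
      rw [e1, e2]
      exact hs2
  have h2 : ∀ n : ℕ, ∫ θ in (-Real.pi)..Real.pi, f n θ =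
      if n = m then -(Real.pi * (starRingEnd ℂ w) ^ m / m) else 0 := by
    intro n
    rw [hf]
    simp only
    rw [intervalIntegral.integral_const_mul, intervalIntegral.integral_add
      (Continuous.intervalIntegrable (by fun_prop) _ _)
      (Continuous.intervalIntegrable (by fun_prop) _ _),
      intervalIntegral.integral_const_mul, intervalIntegral.integral_const_mul,
      integral_exp_int_mul, integral_exp_int_mul]
    by_cases hnm : n = m
    · subst hnm
      simp only [sub_self, if_true]
      rcases Nat.eq_zero_or_pos n with rfl | hn
      · simp
      · rw [if_neg (by omega)]; ring
    · rw [if_neg hnm, if_neg (show ¬((m : ℤ) - n = 0) by omega)]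
      rcases Nat.eq_zero_or_pos n with rfl | hn
      · simp
      · rw [if_neg (by omega)]; ring
  simp_rw [h2] at h1
  exact h1.unique (hasSum_ite_eq m _)

end Henon

namespace Henon

open Complex Metric Set Filter Topology

theorem norm_one_sub_conj_mul_sq (z ζ : ℂ) :
    ‖1 - starRingEnd ℂ z * ζ‖ ^ 2 = ‖z - ζ‖ ^ 2 + (1 - ‖z‖ ^ 2) * (1 - ‖ζ‖ ^ 2) := by
  simp only [Complex.sq_norm, Complex.normSq_apply]
  simp
  ring

theorem ker_zero_eq_log_sub_log {z ζ : ℂ} (h : z ≠ ζ) (hz : ‖z‖ < 1) (hζ : ‖ζ‖ ≤ 1) :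
    ker 0 z ζ = 1 / (2 * Real.pi) *
      (Real.log ‖1 - starRingEnd ℂ z * ζ‖ - Real.log ‖z - ζ‖) := by
  have h1 : 0 < ‖z - ζ‖ := norm_pos_iff.2 (sub_ne_zero.2 h)
  have h2 : 0 < ‖1 - starRingEnd ℂ z * ζ‖ := by
    have : ‖starRingEnd ℂ z * ζ‖ < 1 := by
      rw [norm_mul, RCLike.norm_conj]
      nlinarith [norm_nonneg z, norm_nonneg ζ]
    have := norm_sub_norm_le (1 : ℂ) (starRingEnd ℂ z * ζ)
    rw [norm_one] at this
    linarith
  have h3 : 1 + (1 - ‖z‖ ^ 2) * (1 - ‖ζ‖ ^ 2) / (‖z - ζ‖ ^ 2 + 0) =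
      ‖1 - starRingEnd ℂ z * ζ‖ ^ 2 / ‖z - ζ‖ ^ 2 := by
    rw [norm_one_sub_conj_mul_sq, add_zero]
    field_simp
  unfold ker
  rw [h3, Real.log_div (by positivity) (by positivity), Real.log_pow, Real.log_pow]
  field_simp
  push_cast
  ring

theorem integral_eq_of_eqOn_Ioo {E : Type*} [NormedAddCommGroup E] [NormedSpace ℝ E]
    {f g : ℝ → E} {a b : ℝ} (hab : a ≤ b)
    (hg : ContinuousOn g (Icc a b)) (hfg : ∀ r ∈ Ioo a b, f r = g r) :
    IntervalIntegrable f volume a b ∧ ∫ r in a..b, f r = ∫ r in a..b, g r := by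
  have h1 : IntervalIntegrable g volume a b := hg.intervalIntegrable_of_Icc hab
  have h2 : g =ᵐ[volume.restrict (uIoc a b)] f := by
    rw [uIoc_of_le hab, ← restrict_Ioo_eq_restrict_Ioc]
    exact (ae_restrict_iff' measurableSet_Ioo).2 (ae_of_all _ fun r hr => (hfg r hr).symm)
  exact ⟨h1.congr_ae h2, (intervalIntegral.integral_congr_ae_restrict h2).symm⟩

theorem integral_pow_mul_log {s : ℝ} (hs : 0 < s) (hs1 : s ≤ 1) (n : ℕ) :
    ∫ r in s..1, r ^ (2 * n + 1) * Real.log r =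
      -(1 / (2 * n + 2) ^ 2) - (s ^ (2 * n + 2) * Real.log s / (2 * n + 2) -
        s ^ (2 * n + 2) / (2 * n + 2) ^ 2) := by
  have hpos : ∀ r ∈ uIcc s 1, r ≠ 0 := fun r hr => by
    rw [uIcc_of_le hs1] at hr; exact (hs.trans_le hr.1).ne'
  rw [intervalIntegral.integral_eq_sub_of_hasDerivAt
    (f := fun r => r ^ (2 * n + 2) * Real.log r / (2 * n + 2) - r ^ (2 * n + 2) / (2 * n + 2) ^ 2)]
  · simp
  · intro r hr
    have hr0 := hpos r hr
    have h := (((hasDerivAt_pow (2 * n + 2) r).mul (Real.hasDerivAt_log hr0)).div_const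
      (2 * n + 2 : ℝ)).sub ((hasDerivAt_pow (2 * n + 2) r).div_const ((2 * n + 2 : ℝ) ^ 2))
    refine h.congr_deriv ?_
    have : (2 * n + 2 - 1) = 2 * n + 1 := by omega
    rw [this]
    push_cast
    field_simp
    ring
  · refine ContinuousOn.intervalIntegrable ?_
    exact (by fun_prop : ContinuousOn (fun r : ℝ => r ^ (2 * n + 1)) _).mul
      (Real.continuousOn_log.mono fun r hr => hpos r hr)

theorem integral_const_add_log_mul_exp (c : ℝ) {w : ℂ} (hw : ‖w‖ < 1) (m : ℕ) :
    ∫ θ in (-Real.pi)..Real.pi,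
      ((c + Real.log ‖1 - w * Complex.exp (θ * I)‖ : ℝ) : ℂ) * Complex.exp (m * (θ * I)) =
      (if m = 0 then (2 * Real.pi * c : ℂ) else 0) - Real.pi * (starRingEnd ℂ w) ^ m / m := by
  have hne : ∀ θ : ℝ, ‖1 - w * Complex.exp (θ * I)‖ ≠ 0 := fun θ h => by
    have h1 : w * Complex.exp (θ * I) = 1 := (sub_eq_zero.1 (norm_eq_zero.1 h)).symm
    have h2 : ‖w * Complex.exp (θ * I)‖ = ‖w‖ := by
      rw [norm_mul, Complex.norm_exp_ofReal_mul_I, mul_one]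
    rw [h1, norm_one] at h2
    linarith
  have h0 := integral_exp_int_mul m
  simp only [Int.cast_natCast, Nat.cast_eq_zero] at h0
  simp only [ofReal_add, add_mul]
  rw [intervalIntegral.integral_add, intervalIntegral.integral_const_mul, h0,
    integral_log_norm_mul_exp hw]
  · split_ifs <;> ring
  · exact Continuous.intervalIntegrable (by fun_prop) _ _
  · refine Continuous.intervalIntegrable ?_ _ _
    fun_prop (disch := assumption)

theorem angular_integral (k m : ℕ) {z w : ℂ} {r c : ℝ} (hz : ‖z‖ < 1) (hr : 0 < r) (hr1 : r < 1)
    (hw : ‖w‖ < 1) (hne : ∀ θ : ℝ, z ≠ r * Complex.exp (θ * I))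
    (hlog : ∀ θ : ℝ, Real.log ‖z - r * Complex.exp (θ * I)‖ =
      c + Real.log ‖1 - w * Complex.exp (θ * I)‖) :
    ∫ θ in (-Real.pi)..Real.pi, (ker 0 z (r * Complex.exp (θ * I)) : ℂ) *
      ((r * Complex.exp (θ * I)) ^ (k + m) * starRingEnd ℂ (r * Complex.exp (θ * I)) ^ k) =
      r ^ (2 * k + m) / 2 * ((-(z * r) ^ m + (starRingEnd ℂ w) ^ m) / m -
        if m = 0 then (2 * c : ℂ) else 0) := by
  have hzr : ‖starRingEnd ℂ z * r‖ < 1 := by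
    rw [norm_mul, RCLike.norm_conj, Complex.norm_real, Real.norm_of_nonneg hr.le]
    nlinarith [norm_nonneg z]
  have hA := integral_const_add_log_mul_exp 0 hzr m
  have hB := integral_const_add_log_mul_exp c hw m
  have hpt : ∀ θ : ℝ, (ker 0 z (r * Complex.exp (θ * I)) : ℂ) *
      ((r * Complex.exp (θ * I)) ^ (k + m) * starRingEnd ℂ (r * Complex.exp (θ * I)) ^ k) =
      r ^ (2 * k + m) / (2 * Real.pi) *
      (((0 + Real.log ‖1 - starRingEnd ℂ z * r * Complex.exp (θ * I)‖ : ℝ) : ℂ) *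
        Complex.exp (m * (θ * I)) -
      ((c + Real.log ‖1 - w * Complex.exp (θ * I)‖ : ℝ) : ℂ) * Complex.exp (m * (θ * I))) := by
    intro θ
    have hn : ‖(r : ℂ) * Complex.exp (θ * I)‖ = r := by
      rw [norm_mul, Complex.norm_exp_ofReal_mul_I, mul_one, Complex.norm_real,
        Real.norm_of_nonneg hr.le]
    rw [ker_zero_eq_log_sub_log (hne θ) hz (by rw [hn]; exact hr1.le), hlog, zero_add]
    have hmono : (r * Complex.exp (θ * I)) ^ (k + m) *
        starRingEnd ℂ (r * Complex.exp (θ * I)) ^ k =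
        r ^ (2 * k + m) * Complex.exp (m * (θ * I)) := by
      have e1 : (r * Complex.exp (θ * I)) * starRingEnd ℂ (r * Complex.exp (θ * I)) =
          (r : ℂ) ^ 2 := by
        rw [Complex.mul_conj, Complex.normSq_eq_norm_sq, hn]; push_cast; ring
      calc _ = ((r * Complex.exp (θ * I)) * starRingEnd ℂ (r * Complex.exp (θ * I))) ^ k *
            (r * Complex.exp (θ * I)) ^ m := by ring
        _ = _ := by rw [e1, mul_pow, ← Complex.exp_nat_mul]; ring
    rw [hmono, mul_assoc (starRingEnd ℂ z)]
    push_cast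
    ring
  simp_rw [hpt]
  have hcont : ∀ {v : ℂ} (_ : ‖v‖ < 1) (d : ℝ), IntervalIntegrable (fun θ : ℝ =>
      ((d + Real.log ‖1 - v * Complex.exp (θ * I)‖ : ℝ) : ℂ) * Complex.exp (m * (θ * I)))
      volume (-Real.pi) Real.pi := by
    intro v hv d
    have hne : ∀ θ : ℝ, ‖1 - v * Complex.exp (θ * I)‖ ≠ 0 := fun θ h => by
      have h1 : v * Complex.exp (θ * I) = 1 := (sub_eq_zero.1 (norm_eq_zero.1 h)).symm
      have h2 : ‖v * Complex.exp (θ * I)‖ = ‖v‖ := by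
        rw [norm_mul, Complex.norm_exp_ofReal_mul_I, mul_one]
      rw [h1, norm_one] at h2
      linarith
    refine Continuous.intervalIntegrable ?_ _ _
    fun_prop (disch := assumption)
  rw [intervalIntegral.integral_const_mul, intervalIntegral.integral_sub (hcont hzr 0) (hcont hw c),
    hA, hB]
  have hpi : (Real.pi : ℂ) ≠ 0 := by exact_mod_cast Real.pi_ne_zero
  rw [map_mul, Complex.conj_conj, Complex.conj_ofReal]
  split_ifs with h
  · subst h
    simp
    field_simp
  · have hm : (m : ℂ) ≠ 0 := by exact_mod_cast h
    field_simp
    ring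

end Henon

namespace Henon

open Complex Metric Set Filter Topology

theorem integrableOn_ker_mul_pow (z : D) (k m : ℕ) :
    IntegrableOn (fun ζ : ℂ => (ker 0 z ζ : ℂ) * (ζ ^ (k + m) * starRingEnd ℂ ζ ^ k))
      (closedBall 0 1) := by
  rw [← integrable_D_iff]
  refine (integrable_ker z).ofReal.mul_bdd (c := 1) ?_ (ae_of_all _ fun ζ => ?_)
  · exact Continuous.aestronglyMeasurable (by fun_prop)
  · rw [norm_mul, norm_pow, norm_pow, RCLike.norm_conj]
    exact mul_le_one₀ (pow_le_one₀ (norm_nonneg _) ζ.norm_le) (by positivity)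
      (pow_le_one₀ (norm_nonneg _) ζ.norm_le)

theorem green_monomial_of_norm_lt (z : D) (hz0 : 0 < ‖(z : ℂ)‖) (hz1 : ‖(z : ℂ)‖ < 1) (k m : ℕ) :
    ∫ ζ : D, (ker 0 z ζ : ℂ) * ((ζ : ℂ) ^ (k + m) * starRingEnd ℂ (ζ : ℂ) ^ k) =
      ((z : ℂ) ^ m - (z : ℂ) ^ (k + m + 1) * starRingEnd ℂ (z : ℂ) ^ (k + 1)) /
        (4 * (k + m + 1) * (k + 1)) := by
  rw [integral_D (fun ζ : ℂ => (ker 0 z ζ : ℂ) * (ζ ^ (k + m) * starRingEnd ℂ ζ ^ k)),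
    integral_closedBall_polar (integrableOn_ker_mul_pow z k m)]
  obtain ⟨z, hz⟩ := z
  simp only at hz0 hz1 ⊢
  set s := ‖z‖ with hs
  have hz : z ≠ 0 := norm_pos_iff.1 hz0
  have hnorm : ∀ {r : ℝ}, 0 < r → ∀ θ : ℝ, ‖(r : ℂ) * Complex.exp (θ * I)‖ = r := fun hr θ => by
    rw [norm_mul, Complex.norm_exp_ofReal_mul_I, mul_one, Complex.norm_real,
        Real.norm_of_nonneg hr.le]
  have hne1 : ∀ {v : ℂ}, ‖v‖ < 1 → ∀ θ : ℝ, 0 < ‖1 - v * Complex.exp (θ * I)‖ := by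
    intro v hv θ
    refine norm_pos_iff.2 fun h => ?_
    have h1 : v * Complex.exp (θ * I) = 1 := (sub_eq_zero.1 h).symm
    have h2 : ‖v * Complex.exp (θ * I)‖ = ‖v‖ := by
      rw [norm_mul, Complex.norm_exp_ofReal_mul_I, mul_one]
    rw [h1, norm_one] at h2
    linarith
  have hin : ∀ r ∈ Ioo 0 s, (∫ θ in (-Real.pi)..Real.pi, (ker 0 z (r * Complex.exp (θ * I)) : ℂ) *
      ((r * Complex.exp (θ * I)) ^ (k + m) * starRingEnd ℂ (r * Complex.exp (θ * I)) ^ k)) =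
      r ^ (2 * k + m) / 2 * ((-(z * r) ^ m + (r / starRingEnd ℂ z) ^ m) / m -
        if m = 0 then (2 * Real.log s : ℂ) else 0) := by
    intro r hr
    have hw : ‖(r : ℂ) / z‖ < 1 := by
      rw [norm_div, Complex.norm_real, Real.norm_of_nonneg hr.1.le, div_lt_one hz0]
      exact hr.2
    have := angular_integral (c := Real.log s) k m hz1 hr.1 (hr.2.trans hz1) hw
      (fun θ h => by
        have := hnorm hr.1 θ
        rw [← h] at this
        exact absurd hr.2 (by rw [← this]; exact lt_irrefl _))
      (fun θ => by
        rw [hs, ← Real.log_mul hz0.ne' (hne1 hw θ).ne', ← norm_mul]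
        congr 2
        field_simp)
    rw [this]
    simp
  have hout : ∀ r ∈ Ioo s 1, (∫ θ in (-Real.pi)..Real.pi, (ker 0 z (r * Complex.exp (θ * I)) : ℂ) *
      ((r * Complex.exp (θ * I)) ^ (k + m) * starRingEnd ℂ (r * Complex.exp (θ * I)) ^ k)) =
      r ^ (2 * k + m) / 2 * ((-(z * r) ^ m + (z / r) ^ m) / m -
        if m = 0 then (2 * Real.log r : ℂ) else 0) := by
    intro r hr
    have hr0 : 0 < r := hz0.trans hr.1
    have hw : ‖starRingEnd ℂ z / (r : ℂ)‖ < 1 := by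
      rw [norm_div, Complex.norm_real, Real.norm_of_nonneg hr0.le, div_lt_one hr0, RCLike.norm_conj]
      exact hr.1
    have := angular_integral (c := Real.log r) k m hz1 hr0 hr.2 hw
      (fun θ h => by
        have := hnorm hr0 θ
        rw [← h] at this
        exact absurd hr.1 (by rw [← this]; exact lt_irrefl _))
      (fun θ => by
        rw [← Real.log_mul hr0.ne' (hne1 hw θ).ne']
        congr 1
        have e1 : z - r * Complex.exp (θ * I) = -(r * Complex.exp (θ * I)) *
            starRingEnd ℂ (1 - starRingEnd ℂ z / r * Complex.exp (θ * I)) := by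
          have hc : starRingEnd ℂ (Complex.exp (θ * I)) = (Complex.exp (θ * I))⁻¹ := by
            rw [← Complex.exp_conj, ← Complex.exp_neg]; simp
          have hE := Complex.exp_ne_zero (θ * I)
          have hr' : (r : ℂ) ≠ 0 := by exact_mod_cast hr0.ne'
          simp only [map_sub, map_one, map_mul, map_div₀, Complex.conj_conj, Complex.conj_ofReal,
            hc]
          field_simp
          ring
        rw [e1, norm_mul, norm_neg, hnorm hr0, RCLike.norm_conj])
    rw [this]
    simp
  have hconj : z * starRingEnd ℂ z = (s : ℂ) ^ 2 := by
    rw [Complex.mul_conj, Complex.normSq_eq_norm_sq]; push_cast; rfl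
  have hcz : starRingEnd ℂ z ≠ 0 := by simpa using hz
  have hsc : (s : ℂ) ≠ 0 := by exact_mod_cast hz0.ne'
  rcases Nat.eq_zero_or_pos m with rfl | hm
  · obtain ⟨i1, v1⟩ := integral_eq_of_eqOn_Ioo (a := 0) (b := s) hz0.le
      (f := fun r : ℝ => r • ∫ θ in (-Real.pi)..Real.pi, (ker 0 z (r * Complex.exp (θ * I)) : ℂ) *
      ((r * Complex.exp (θ * I)) ^ (k + 0) * starRingEnd ℂ (r * Complex.exp (θ * I)) ^ k))
      (g := fun r : ℝ => ((r ^ (2 * k + 1) * -Real.log s : ℝ) : ℂ)) (by fun_prop)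
      (fun r hr => by simp only [hin r hr]; simp; ring)
    obtain ⟨i2, v2⟩ := integral_eq_of_eqOn_Ioo (a := s) (b := 1) hz1.le
      (f := fun r : ℝ => r • ∫ θ in (-Real.pi)..Real.pi, (ker 0 z (r * Complex.exp (θ * I)) : ℂ) *
      ((r * Complex.exp (θ * I)) ^ (k + 0) * starRingEnd ℂ (r * Complex.exp (θ * I)) ^ k))
      (g := fun r : ℝ => ((-(r ^ (2 * k + 1) * Real.log r) : ℝ) : ℂ))
      (by
        refine Complex.continuous_ofReal.comp_continuousOn (ContinuousOn.neg ?_)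
        refine (by fun_prop : ContinuousOn (fun r : ℝ => r ^ (2 * k + 1)) _).mul
          (Real.continuousOn_log.mono fun r hr => ?_)
        exact (hz0.trans_le hr.1).ne')
      (fun r hr => by simp only [hout r hr]; simp; ring)
    rw [← intervalIntegral.integral_add_adjacent_intervals i1 i2, v1, v2,
      intervalIntegral.integral_ofReal, intervalIntegral.integral_ofReal,
      intervalIntegral.integral_neg, integral_pow_mul_log hz0 hz1.le,
      intervalIntegral.integral_mul_const, integral_pow]
    have e : z ^ (k + 0 + 1) * starRingEnd ℂ z ^ (k + 1) = (s : ℂ) ^ (2 * k + 2) := by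
      rw [add_zero, ← mul_pow, hconj]; ring
    rw [e, ← ofReal_add]
    have : (k : ℂ) + 1 ≠ 0 := by exact_mod_cast (Nat.succ_ne_zero k)
    push_cast
    have h2 : 2 * (k : ℂ) + 2 ≠ 0 := by
      rw [show 2 * (k : ℂ) + 2 = 2 * (k + 1) by ring]; exact mul_ne_zero two_ne_zero this
    have h3 : 2 * (k : ℂ) + 1 + 1 = 2 * (k + 1) := by ring
    have h4 : 2 * (k : ℂ) + 2 = 2 * (k + 1) := by ring
    simp only [h3, h4, zero_pow (show 2 * k + 1 + 1 ≠ 0 by omega)]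
    field_simp
    ring
  · have hm0 : (m : ℂ) ≠ 0 := by exact_mod_cast hm.ne'
    obtain ⟨i1, v1⟩ := integral_eq_of_eqOn_Ioo (a := 0) (b := s) hz0.le
      (f := fun r : ℝ => r • ∫ θ in (-Real.pi)..Real.pi, (ker 0 z (r * Complex.exp (θ * I)) : ℂ) *
      ((r * Complex.exp (θ * I)) ^ (k + m) * starRingEnd ℂ (r * Complex.exp (θ * I)) ^ k))
      (g := fun r : ℝ => ((r ^ (2 * (k + m) + 1) : ℝ) : ℂ) *
        ((-z ^ m + (1 / starRingEnd ℂ z) ^ m) / (2 * m))) (by fun_prop)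
      (fun r hr => by
        simp only [hin r hr, if_neg hm.ne', real_smul]
        push_cast
        field_simp
        ring)
    obtain ⟨i2, v2⟩ := integral_eq_of_eqOn_Ioo (a := s) (b := 1) hz1.le
      (f := fun r : ℝ => r • ∫ θ in (-Real.pi)..Real.pi, (ker 0 z (r * Complex.exp (θ * I)) : ℂ) *
      ((r * Complex.exp (θ * I)) ^ (k + m) * starRingEnd ℂ (r * Complex.exp (θ * I)) ^ k))
      (g := fun r : ℝ => (((-r ^ (2 * (k + m) + 1) + r ^ (2 * k + 1)) : ℝ) : ℂ) *
        (z ^ m / (2 * m))) (by fun_prop)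
      (fun r hr => by
        have hr0 : (r : ℂ) ≠ 0 := by exact_mod_cast (hz0.trans hr.1).ne'
        simp only [hout r hr, if_neg hm.ne', real_smul, div_pow]
        have := pow_ne_zero m hr0
        push_cast
        field_simp
        ring)
    rw [← intervalIntegral.integral_add_adjacent_intervals i1 i2, v1, v2,
      intervalIntegral.integral_mul_const, intervalIntegral.integral_mul_const,
      intervalIntegral.integral_ofReal, intervalIntegral.integral_ofReal,
      intervalIntegral.integral_add (Continuous.intervalIntegrable (by fun_prop) _ _)
        (Continuous.intervalIntegrable (by fun_prop) _ _), intervalIntegral.integral_neg,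
      integral_pow, integral_pow, integral_pow]
    have e : z ^ (k + m + 1) * starRingEnd ℂ z ^ (k + 1) = z ^ m * (s : ℂ) ^ (2 * k + 2) := by
      have : z ^ (k + m + 1) * starRingEnd ℂ z ^ (k + 1) =
        z ^ m * (z * starRingEnd ℂ z) ^ (k + 1) := by ring
      rw [this, hconj]; ring
    have e2 : (1 / starRingEnd ℂ z) ^ m = z ^ m / (s : ℂ) ^ (2 * m) := by
      have : (1 / starRingEnd ℂ z) = z / (s : ℂ) ^ 2 := by
        rw [← hconj]; field_simp
      rw [this, div_pow]; ring
    rw [e, e2]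
    have h1 : (k : ℂ) + 1 ≠ 0 := by exact_mod_cast (Nat.succ_ne_zero k)
    have h2 : (k : ℂ) + m + 1 ≠ 0 := by exact_mod_cast (Nat.succ_ne_zero (k + m))
    have h3 : 2 * (k : ℂ) + 1 + 1 = 2 * (k + 1) := by ring
    have h4 : 2 * ((k : ℂ) + m) + 1 + 1 = 2 * (k + m + 1) := by ring
    push_cast
    simp only [h3, h4, zero_pow (show 2 * (k + m) + 1 + 1 ≠ 0 by omega), one_pow]
    have e3 : (s : ℂ) ^ (2 * (k + m) + 1 + 1) = (s : ℂ) ^ (2 * m) * (s : ℂ) ^ (2 * k + 2) := by ring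
    have e4 : (s : ℂ) ^ (2 * k + 1 + 1) = (s : ℂ) ^ (2 * k + 2) := by ring
    rw [e3, e4]
    generalize (s : ℂ) ^ (2 * k + 2) = S
    have : (s : ℂ) ^ (2 * m) ≠ 0 := pow_ne_zero _ hsc
    generalize (s : ℂ) ^ (2 * m) = M at *
    field_simp
    ring

/-! ### Polynomial functions -/

/-- The function `z ↦ Re (c z^j conj z^k)` on the disk. -/
noncomputable def reMon (c : ℂ) (j k : ℕ) : C(D, ℝ) :=
  ⟨fun z => (c * ((z : ℂ) ^ j * starRingEnd ℂ (z : ℂ) ^ k)).re, by fun_prop⟩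

theorem reMon_apply (c : ℂ) (j k : ℕ) (z : D) :
    reMon c j k z = (c * ((z : ℂ) ^ j * starRingEnd ℂ (z : ℂ) ^ k)).re := rfl

theorem reMon_conj (c : ℂ) (j k : ℕ) : reMon (starRingEnd ℂ c) k j = reMon c j k := by
  ext z
  rw [reMon_apply, reMon_apply, ← Complex.conj_re]
  simp [mul_comm]

theorem dense_punctured : Dense {z : D | 0 < ‖(z : ℂ)‖ ∧ ‖(z : ℂ)‖ < 1} := by
  have h1 : Dense {z : D | ‖(z : ℂ)‖ < 1} := dense_iff_closure_eq.2 closure_interior_D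
  have h2 : Dense {z : D | (⟨0, by simp⟩ : D) ≠ z} := Measure.dense_of_ae (ae_ne_D _)
  have h3 := h2.inter_of_isOpen_right h1 (isOpen_lt (by fun_prop) (by fun_prop))
  refine h3.mono fun z hz => ⟨norm_pos_iff.2 fun h => hz.1 (Subtype.ext h.symm), hz.2⟩

theorem green_reMon_add (c : ℂ) (k m : ℕ) :
    green (reMon c (k + m) k) = (1 / (4 * (k + m + 1) * (k + 1)) : ℝ) •
      (reMon c m 0 - reMon c (k + m + 1) (k + 1)) := by
  refine DFunLike.coe_injective (Continuous.ext_on dense_punctured (map_continuous _)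
    (map_continuous _) ?_)
  rintro z ⟨hz0, hz1⟩
  have h := green_monomial_of_norm_lt z hz0 hz1 k m
  have h_integrable : Integrable (fun ζ : D => c * ((ker 0 z ζ : ℂ) *
      ((ζ : ℂ) ^ (k + m) * starRingEnd ℂ (ζ : ℂ) ^ k))) :=
    (integrable_D_iff.2 (integrableOn_ker_mul_pow z k m)).const_mul c
  have h2 : green (reMon c (k + m) k) z = (∫ ζ : D, c * ((ker 0 z ζ : ℂ) *
      ((ζ : ℂ) ^ (k + m) * starRingEnd ℂ (ζ : ℂ) ^ k))).re := by
    rw [green_apply, ← Complex.reCLM_apply, ← Complex.reCLM.integral_comp_comm h_integrable]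
    congr 1
    ext ζ
    rw [reMon_apply, Complex.reCLM_apply, mul_left_comm c (ker 0 z ζ : ℂ), Complex.re_ofReal_mul]
  rw [h2, integral_const_mul, h]
  simp only [ContinuousMap.smul_apply, ContinuousMap.sub_apply, reMon_apply, smul_eq_mul, pow_zero,
    mul_one]
  rw [← Complex.sub_re, ← Complex.re_ofReal_mul]
  congr 1
  push_cast
  ring

theorem green_reMon (c : ℂ) (j k : ℕ) :
    green (reMon c j k) = (1 / (4 * (j + 1) * (k + 1)) : ℝ) •
      (reMon c (j - k) (k - j) - reMon c (j + 1) (k + 1)) := by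
  rcases le_total k j with h | h
  · obtain ⟨m, rfl⟩ := Nat.exists_eq_add_of_le h
    rw [green_reMon_add]
    simp
  · obtain ⟨m, rfl⟩ := Nat.exists_eq_add_of_le h
    rw [← reMon_conj, green_reMon_add, ← reMon_conj c (j - _), ← reMon_conj c (j + 1)]
    simp
    congr 1
    ring

/-- Real polynomial functions of degree at most `n` on the disk. -/
noncomputable def pol (n : ℕ) : Submodule ℝ C(D, ℝ) :=
  Submodule.span ℝ {f | ∃ (c : ℂ) (j k : ℕ), j + k ≤ n ∧ f = reMon c j k}

theorem reMon_mem_pol (c : ℂ) {j k n : ℕ} (h : j + k ≤ n) : reMon c j k ∈ pol n :=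
  Submodule.subset_span ⟨c, j, k, h, rfl⟩

theorem pol_mono {m n : ℕ} (h : m ≤ n) : pol m ≤ pol n :=
  Submodule.span_mono fun _ ⟨c, j, k, h', e⟩ => ⟨c, j, k, h'.trans h, e⟩

theorem reMon_mul (c c' : ℂ) (j k j' k' : ℕ) : reMon c j k * reMon c' j' k' =
    reMon (c * c' / 2) (j + j') (k + k') +
      reMon (c * starRingEnd ℂ c' / 2) (j + k') (k + j') := by
  ext z
  simp only [ContinuousMap.mul_apply, ContinuousMap.add_apply, reMon_apply]
  set X := c * ((z : ℂ) ^ j * starRingEnd ℂ (z : ℂ) ^ k)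
  set Y := c' * ((z : ℂ) ^ j' * starRingEnd ℂ (z : ℂ) ^ k')
  have h1 : c * c' / 2 * ((z : ℂ) ^ (j + j') * starRingEnd ℂ (z : ℂ) ^ (k + k')) =
      ((1 / 2 : ℝ) : ℂ) * (X * Y) := by push_cast; ring
  have h2 : c * starRingEnd ℂ c' / 2 * ((z : ℂ) ^ (j + k') * starRingEnd ℂ (z : ℂ) ^ (k + j')) =
      ((1 / 2 : ℝ) : ℂ) * (X * starRingEnd ℂ Y) := by
    simp only [X, Y, map_mul, map_pow, Complex.conj_conj]
    push_cast; ring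
  rw [h1, h2, Complex.re_ofReal_mul, Complex.re_ofReal_mul]
  simp
  ring

theorem mul_mem_pol {m n : ℕ} {f g : C(D, ℝ)} (hf : f ∈ pol m) (hg : g ∈ pol n) :
    f * g ∈ pol (m + n) := by
  have h := Submodule.mul_mem_mul hf hg
  rw [pol, pol, Submodule.span_mul_span] at h
  refine Submodule.span_le.2 ?_ h
  rintro _ ⟨_, ⟨c, j, k, h1, rfl⟩, _, ⟨c', j', k', h2, rfl⟩, rfl⟩
  change reMon c j k * reMon c' j' k' ∈ _
  rw [reMon_mul]
  exact add_mem (reMon_mem_pol _ (by omega)) (reMon_mem_pol _ (by omega))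

theorem green_mem_pol {n : ℕ} {f : C(D, ℝ)} (hf : f ∈ pol n) : green f ∈ pol (n + 2) := by
  have : pol n ≤ (pol (n + 2)).comap (green : C(D, ℝ) →ₗ[ℝ] C(D, ℝ)) := by
    refine Submodule.span_le.2 ?_
    rintro _ ⟨c, j, k, h, rfl⟩
    change green (reMon c j k) ∈ pol (n + 2)
    rw [green_reMon]
    exact Submodule.smul_mem _ _ (sub_mem (reMon_mem_pol _ (by omega)) (reMon_mem_pol _ (by omega)))
  exact this hf

/-- The algebra of all real polynomial functions on the disk. -/
noncomputable def polAlg : Subalgebra ℝ C(D, ℝ) where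
  carrier := {f | ∃ n, f ∈ pol n}
  mul_mem' := fun ⟨_, hm⟩ ⟨_, hn⟩ => ⟨_, mul_mem_pol hm hn⟩
  add_mem' := fun ⟨m, hm⟩ ⟨n, hn⟩ => ⟨max m n, add_mem (pol_mono (le_max_left _ _) hm)
    (pol_mono (le_max_right _ _) hn)⟩
  algebraMap_mem' := fun r => ⟨0, by
    have : algebraMap ℝ C(D, ℝ) r = reMon r 0 0 := by ext z; simp [reMon_apply]
    rw [this]
    exact reMon_mem_pol _ le_rfl⟩

theorem polAlg_separatesPoints : polAlg.SeparatesPoints := by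
  intro x y hxy
  by_cases h : (x : ℂ).re = (y : ℂ).re
  · refine ⟨_, ⟨reMon (-I) 1 0, ⟨1, reMon_mem_pol _ le_rfl⟩, rfl⟩, ?_⟩
    simp only [reMon_apply]
    intro h2
    simp at h2
    exact hxy (Subtype.ext (Complex.ext h h2))
  · refine ⟨_, ⟨reMon 1 1 0, ⟨1, reMon_mem_pol _ le_rfl⟩, rfl⟩, ?_⟩
    simpa [reMon_apply] using h

theorem exists_pol_near (f : C(D, ℝ)) {ε : ℝ} (hε : 0 < ε) : ∃ g ∈ polAlg, ‖g - f‖ < ε := by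
  obtain ⟨g, hg⟩ := ContinuousMap.exists_mem_subalgebra_near_continuousMap_of_separatesPoints
    polAlg polAlg_separatesPoints f ε hε
  exact ⟨g, g.2, hg⟩

end Henon

namespace Henon

open Complex Metric Set Filter Topology

/-- Integration over the disk. -/
noncomputable def integ : C(D, ℝ) →L[ℝ] ℝ :=
  LinearMap.mkContinuous
    { toFun := fun f => ∫ z : D, f z
      map_add' := fun f g => integral_add (integrable_cont f) (integrable_cont g)
      map_smul' := fun c f => integral_const_mul c _ }
    ((volume : Measure D).real univ) fun f => by
      rw [mul_comm]
      exact norm_integral_le_of_norm_le_const (ae_of_all _ fun z => f.norm_coe_le_norm z)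

theorem integ_apply (f : C(D, ℝ)) : integ f = ∫ z : D, f z := rfl

theorem integ_nonneg {f : C(D, ℝ)} (h : 0 ≤ f) : 0 ≤ integ f := integral_nonneg h

theorem integ_mono {f g : C(D, ℝ)} (h : f ≤ g) : integ f ≤ integ g :=
  integral_mono (integrable_cont f) (integrable_cont g) h

theorem eq_zero_of_integ_eq_zero {f : C(D, ℝ)} (h : 0 ≤ f) (h0 : integ f = 0) : f = 0 := by
  have := (integral_eq_zero_iff_of_nonneg h (integrable_cont f)).1 h0
  exact DFunLike.coe_injective ((map_continuous f).ae_eq_iff_eq volume continuous_const |>.1 this)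

theorem integral_pow_mul_conj_pow (j k : ℕ) :
    ∫ z : D, ((z : ℂ) ^ j * starRingEnd ℂ (z : ℂ) ^ k) =
      if j = k then (Real.pi / (j + 1) : ℂ) else 0 := by
  rw [integral_D (fun z : ℂ => z ^ j * starRingEnd ℂ z ^ k), integral_closedBall_polar
    (Continuous.continuousOn (by fun_prop) |>.integrableOn_compact (isCompact_closedBall _ _))]
  have h : ∀ r : ℝ, (∫ θ in (-Real.pi)..Real.pi, ((r : ℂ) * Complex.exp (θ * I)) ^ j *
      starRingEnd ℂ ((r : ℂ) * Complex.exp (θ * I)) ^ k) =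
      (r : ℂ) ^ (j + k) * if ((j : ℤ) - k) = 0 then (2 * Real.pi : ℂ) else 0 := fun r => by
    rw [← integral_exp_int_mul, ← intervalIntegral.integral_const_mul]
    congr 1
    ext θ
    rw [map_mul, ← Complex.exp_conj]
    simp only [map_mul, Complex.conj_ofReal, Complex.conj_I, mul_pow, ← Complex.exp_nat_mul]
    rw [mul_mul_mul_comm, ← pow_add, ← Complex.exp_add]
    congr 2
    push_cast
    ring
  simp only [h, sub_eq_zero, Nat.cast_inj]
  split_ifs with hjk
  · subst hjk
    have : ∀ r : ℝ, r • ((r : ℂ) ^ (j + j) * (2 * Real.pi : ℂ)) =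
        ((r ^ (2 * j + 1) * (2 * Real.pi) : ℝ) : ℂ) := fun r => by
      rw [Complex.real_smul]; push_cast; ring
    simp only [this, intervalIntegral.integral_ofReal, intervalIntegral.integral_mul_const,
      integral_pow]
    have h1 : (j : ℂ) + 1 ≠ 0 := by exact_mod_cast (Nat.succ_ne_zero j)
    have h2 : (2 * (j : ℂ) + 1 + 1) ≠ 0 := by
      rw [show 2 * (j : ℂ) + 1 + 1 = 2 * (j + 1) by ring]; simp [h1]
    push_cast
    simp
    field_simp
    ring
  · simp

theorem integ_reMon (c : ℂ) (j k : ℕ) :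
    integ (reMon c j k) = if j = k then c.re * (Real.pi / (j + 1)) else 0 := by
  have h_integrable : Integrable (fun z : D => c * ((z : ℂ) ^ j * starRingEnd ℂ (z : ℂ) ^ k)) :=
    (integrable_const (2 * ‖c‖)).mono' (Continuous.aestronglyMeasurable (by fun_prop))
      (ae_of_all _ fun z => by
        rw [norm_mul, norm_mul, norm_pow, norm_pow, RCLike.norm_conj]
        have := mul_le_one₀ (pow_le_one₀ (norm_nonneg _) z.norm_le (n := j)) (by positivity)
          (pow_le_one₀ (norm_nonneg _) z.norm_le (n := k))
        nlinarith [norm_nonneg c])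
  have : integ (reMon c j k) = (∫ z : D, c * ((z : ℂ) ^ j * starRingEnd ℂ (z : ℂ) ^ k)).re := by
    rw [← Complex.reCLM_apply, ← Complex.reCLM.integral_comp_comm h_integrable]
    rfl
  rw [this, integral_const_mul, integral_pow_mul_conj_pow]
  split_ifs
  · rw [show (Real.pi / (j + 1) : ℂ) = ((Real.pi / (j + 1) : ℝ) : ℂ) by push_cast; rfl,
      Complex.re_mul_ofReal]
  · simp

/-- The energy form `∫ f (-Δ)⁻¹ g`. -/
noncomputable def energy (f g : C(D, ℝ)) : ℝ := integ (f * green g)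

theorem energy_add_left (f g h : C(D, ℝ)) : energy (f + g) h = energy f h + energy g h := by
  simp [energy, add_mul]

theorem energy_add_right (f g h : C(D, ℝ)) : energy f (g + h) = energy f g + energy f h := by
  simp [energy, mul_add]

theorem energy_smul_left (c : ℝ) (f g : C(D, ℝ)) : energy (c • f) g = c * energy f g := by
  simp [energy]

theorem energy_smul_right (c : ℝ) (f g : C(D, ℝ)) : energy f (c • g) = c * energy f g := by
  simp [energy]

theorem energy_sub_left (f g h : C(D, ℝ)) : energy (f - g) h = energy f h - energy g h := by
  simp [energy, sub_mul]

theorem energy_sub_right (f g h : C(D, ℝ)) : energy f (g - h) = energy f g - energy f h := by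
  simp [energy, mul_sub]

theorem continuous_energy : Continuous fun p : C(D, ℝ) × C(D, ℝ) => energy p.1 p.2 := by
  unfold energy
  fun_prop

theorem energy_sum_left {ι : Type*} (s : Finset ι) (f : ι → C(D, ℝ)) (g : C(D, ℝ)) :
    energy (∑ i ∈ s, f i) g = ∑ i ∈ s, energy (f i) g := by
  simp [energy, Finset.sum_mul]

theorem energy_sum_right {ι : Type*} (s : Finset ι) (f : ι → C(D, ℝ)) (g : C(D, ℝ)) :
    energy g (∑ i ∈ s, f i) = ∑ i ∈ s, energy g (f i) := by
  simp [energy, Finset.mul_sum]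

/-- A square root of the energy form on monomials. -/
noncomputable def halfMon (p : ℂ × ℕ × ℕ) : C(D, ℝ) :=
  (1 / (max p.2.1 p.2.2 + 1) : ℝ) • reMon p.1 p.2.1 p.2.2

theorem energy_reMon (p q : ℂ × ℕ × ℕ) :
    energy (reMon p.1 p.2.1 p.2.2) (reMon q.1 q.2.1 q.2.2) =
      1 / 4 * integ (reMon 1 1 1 * (halfMon p * halfMon q)) := by
  obtain ⟨c, j, k⟩ := p
  obtain ⟨c', j', k'⟩ := q
  have e1 : ∀ (d : ℂ) (a b : ℕ), reMon 1 1 1 * reMon d a b = reMon d (a + 1) (b + 1) := by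
    intro d a b
    ext z
    simp only [ContinuousMap.mul_apply, reMon_apply]
    have : (1 * ((z : ℂ) ^ 1 * starRingEnd ℂ (z : ℂ) ^ 1)) = ((‖(z : ℂ)‖ ^ 2 : ℝ) : ℂ) := by
      rw [one_mul, pow_one, pow_one, Complex.mul_conj, Complex.normSq_eq_norm_sq]
    have h2 : d * ((z : ℂ) ^ (a + 1) * starRingEnd ℂ (z : ℂ) ^ (b + 1)) =
      (1 * ((z : ℂ) ^ 1 * starRingEnd ℂ (z : ℂ) ^ 1)) *
      (d * ((z : ℂ) ^ a * starRingEnd ℂ (z : ℂ) ^ b)) := by ring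
    rw [h2, this, Complex.re_ofReal_mul, Complex.ofReal_re]
  have e2 : reMon 1 1 1 * (halfMon (c, j, k) * halfMon (c', j', k')) =
      ((1 / (max j k + 1)) * (1 / (max j' k' + 1)) : ℝ) •
        (reMon (c * c' / 2) (j + j' + 1) (k + k' + 1) +
          reMon (c * starRingEnd ℂ c' / 2) (j + k' + 1) (k + j' + 1)) := by
    rw [← e1 _ (j + j'), ← e1 _ (j + k'), ← mul_add, ← reMon_mul, halfMon, halfMon, smul_mul_smul_comm, mul_smul_comm]
  rw [e2, energy, green_reMon, mul_smul_comm, mul_sub, reMon_mul, reMon_mul]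
  simp only [map_smul, map_add, map_sub, integ_reMon, smul_eq_mul]
  generalize (c * c' / 2).re = X
  generalize (c * starRingEnd ℂ c' / 2).re = Y
  have key : ∀ {j k j' k' : ℕ}, j + j' = k + k' →
      (1 / (4 * (j' + 1) * (k' + 1)) : ℝ) * (1 / (j + (j' - k' : ℕ) + 1) - 1 / (j + (j' + 1) + 1))
        = 1 / 4 * (1 / (max j k + 1) * (1 / (max j' k' + 1)) * (1 / (j + j' + 1 + 1))) := by
    intro j k j' k' h
    rcases le_total k j with h1 | h1
    · obtain ⟨m, rfl⟩ := Nat.exists_eq_add_of_le h1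
      have : k' = j' + m := by omega
      subst this
      rw [max_eq_left (by simp), max_eq_right (by simp),
        Nat.sub_eq_zero_of_le (by omega)]
      push_cast
      have h1 : (k : ℝ) + m + 1 ≠ 0 := by positivity
      have h2 : (j' : ℝ) + m + 1 ≠ 0 := by positivity
      have h3 : (j' : ℝ) + 1 ≠ 0 := by positivity
      have h4 : (k : ℝ) + m + j' + 1 + 1 ≠ 0 := by positivity
      have h5 : (k : ℝ) + m + (j' + 1) + 1 ≠ 0 := by positivity
      have h6 : (k : ℝ) + m + 0 + 1 ≠ 0 := by positivity
      field_simp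
      ring
    · obtain ⟨m, rfl⟩ := Nat.exists_eq_add_of_le h1
      have : j' = k' + m := by omega
      subst this
      rw [max_eq_right (by simp), max_eq_left (by simp), Nat.add_sub_cancel_left]
      push_cast
      have h1 : (j : ℝ) + m + 1 ≠ 0 := by positivity
      have h2 : (k' : ℝ) + m + 1 ≠ 0 := by positivity
      have h3 : (k' : ℝ) + 1 ≠ 0 := by positivity
      have h4 : (j : ℝ) + (k' + m) + 1 + 1 ≠ 0 := by positivity
      have h5 : (j : ℝ) + (k' + m + 1) + 1 ≠ 0 := by positivity
      field_simp
      ring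
  have hX : (1 / (4 * (j' + 1) * (k' + 1)) : ℝ) *
      ((if j + (j' - k') = k + (k' - j') then X * (Real.pi / ((j + (j' - k') : ℕ) + 1)) else 0) -
        if j + (j' + 1) = k + (k' + 1) then X * (Real.pi / ((j + (j' + 1) : ℕ) + 1)) else 0) =
      1 / 4 * (1 / (max j k + 1) * (1 / (max j' k' + 1)) *
        if j + j' + 1 = k + k' + 1 then X * (Real.pi / ((j + j' + 1 : ℕ) + 1)) else 0) := by
    by_cases h : j + j' = k + k'
    · rw [if_pos (by omega), if_pos (by omega), if_pos (by omega)]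
      have := key h
      push_cast at this ⊢
      linear_combination (X * Real.pi) * this
    · rw [if_neg (by omega), if_neg (by omega), if_neg (by omega)]
      simp
  have hY : (1 / (4 * (j' + 1) * (k' + 1)) : ℝ) *
      ((if j + (k' - j') = k + (j' - k') then Y * (Real.pi / ((j + (k' - j') : ℕ) + 1)) else 0) -
        if j + (k' + 1) = k + (j' + 1) then Y * (Real.pi / ((j + (k' + 1) : ℕ) + 1)) else 0) =
      1 / 4 * (1 / (max j k + 1) * (1 / (max j' k' + 1)) *
        if j + k' + 1 = k + j' + 1 then Y * (Real.pi / ((j + k' + 1 : ℕ) + 1)) else 0) := by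
    by_cases h : j + k' = k + j'
    · rw [if_pos (by omega), if_pos (by omega), if_pos (by omega)]
      have := key h
      rw [max_comm k' j'] at this
      push_cast at this ⊢
      linear_combination (Y * Real.pi) * this
    · rw [if_neg (by omega), if_neg (by omega), if_neg (by omega)]
      simp
  push_cast at hX hY ⊢
  linear_combination hX + hY

theorem exists_finsupp_of_mem_polAlg {f : C(D, ℝ)} (hf : f ∈ polAlg) :
    ∃ a : (ℂ × ℕ × ℕ) →₀ ℝ, f = ∑ p ∈ a.support, a p • reMon p.1 p.2.1 p.2.2 := by
  obtain ⟨n, hn⟩ := hf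
  have h : f ∈ Submodule.span ℝ (range fun p : ℂ × ℕ × ℕ => reMon p.1 p.2.1 p.2.2) := by
    refine Submodule.span_mono ?_ hn
    rintro _ ⟨c, j, k, -, rfl⟩
    exact ⟨(c, j, k), rfl⟩
  obtain ⟨a, ha⟩ := Finsupp.mem_span_range_iff_exists_finsupp.1 h
  exact ⟨a, ha.symm⟩

theorem dense_polAlg : Dense (polAlg : Set C(D, ℝ)) := fun f => by
  rw [Metric.mem_closure_iff]
  intro ε hε
  obtain ⟨g, hg, h⟩ := exists_pol_near f hε
  exact ⟨g, hg, by rwa [dist_comm, dist_eq_norm]⟩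

theorem energy_self_nonneg (f : C(D, ℝ)) : 0 ≤ energy f f := by
  have hc : IsClosed {f : C(D, ℝ) | 0 ≤ energy f f} :=
    isClosed_le continuous_const (continuous_energy.comp (continuous_id.prodMk continuous_id))
  refine hc.closure_subset_iff.2 (fun g hg => ?_) (dense_polAlg f)
  obtain ⟨a, rfl⟩ := exists_finsupp_of_mem_polAlg hg
  have h1 : (0 : ℝ) ≤ 1 / 4 * integ (reMon 1 1 1 * ((∑ p ∈ a.support, a p • halfMon p) *
      ∑ p ∈ a.support, a p • halfMon p)) := by
    refine mul_nonneg (by norm_num) (integ_nonneg fun z => ?_)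
    refine mul_nonneg ?_ (mul_self_nonneg _)
    change 0 ≤ reMon 1 1 1 z
    rw [reMon_apply, one_mul, pow_one, pow_one, Complex.mul_conj, Complex.ofReal_re]
    exact Complex.normSq_nonneg _
  refine h1.trans_eq ?_
  simp only [energy_sum_left, energy_sum_right, energy_smul_left, energy_smul_right, energy_reMon,
    Finset.sum_mul, Finset.mul_sum, map_sum, smul_mul_assoc, mul_smul_comm, map_smul, smul_eq_mul]
  refine Finset.sum_congr rfl fun p _ => Finset.sum_congr rfl fun q _ => ?_
  ring

theorem energy_comm (f g : C(D, ℝ)) : energy f g = energy g f := by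
  have hc : IsClosed {p : C(D, ℝ) × C(D, ℝ) | energy p.1 p.2 = energy p.2 p.1} :=
    isClosed_eq continuous_energy (continuous_energy.comp continuous_swap)
  refine hc.closure_subset_iff.2 ?_ ((dense_polAlg.prod dense_polAlg) (f, g))
  rintro ⟨f, g⟩ ⟨hf, hg⟩
  obtain ⟨a, rfl⟩ := exists_finsupp_of_mem_polAlg hf
  obtain ⟨b, rfl⟩ := exists_finsupp_of_mem_polAlg hg
  simp only [mem_ofPred_eq, energy_sum_left, energy_sum_right, energy_smul_left, energy_smul_right,
    energy_reMon, Finset.mul_sum]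
  rw [Finset.sum_comm]
  refine Finset.sum_congr rfl fun p _ => Finset.sum_congr rfl fun q _ => ?_
  rw [mul_comm (halfMon p)]
  ring

theorem energy_sq_le (f g : C(D, ℝ)) : energy f g ^ 2 ≤ energy f f * energy g g := by
  have h : ∀ t : ℝ, 0 ≤ energy f f * (t * t) + 2 * energy f g * t + energy g g := fun t => by
    have := energy_self_nonneg (t • f + g)
    rw [energy_add_left, energy_add_right, energy_add_right, energy_smul_left, energy_smul_right,
      energy_smul_left, energy_smul_right, energy_comm g f] at this
    linarith
  have := discrim_le_zero h
  rw [discrim] at this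
  nlinarith

end Henon

namespace Henon

open Complex Metric Set Filter Topology

theorem intOp_comp_mul_comp (p q : C(D, ℝ)) (f : C(D, ℝ)) :
    intOp (p.comp ContinuousMap.fst * q.comp ContinuousMap.snd) f = integ (q * f) • p := by
  ext z
  rw [intOp_apply, ContinuousMap.smul_apply, integ_apply, smul_eq_mul,
    ← integral_mul_const]
  congr 1
  ext ζ
  simp only [ContinuousMap.mul_apply, ContinuousMap.comp_apply, ContinuousMap.fst_apply,
    ContinuousMap.snd_apply]
  ring

/-- Kernels whose operator is compact with polynomial values of bounded degree. -/
def IsPolKernel (k : C(D × D, ℝ)) : Prop :=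
  IsCompactOperator (intOp k) ∧ ∃ N, ∀ f, intOp k f ∈ pol N

theorem IsPolKernel.add {k l : C(D × D, ℝ)} (hk : IsPolKernel k) (hl : IsPolKernel l) :
    IsPolKernel (k + l) := by
  obtain ⟨hk, M, hM⟩ := hk
  obtain ⟨hl, N, hN⟩ := hl
  rw [IsPolKernel, intOp_add]
  exact ⟨hk.add hl, max M N, fun f => add_mem (pol_mono (le_max_left _ _) (hM f))
    (pol_mono (le_max_right _ _) (hN f))⟩

theorem isPolKernel_mul {p q : C(D, ℝ)} (hp : p ∈ polAlg) :
    IsPolKernel (p.comp ContinuousMap.fst * q.comp ContinuousMap.snd) := by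
  obtain ⟨N, hN⟩ := hp
  refine ⟨?_, N, fun f => ?_⟩
  · have h2 : IsCompactOperator (((ContinuousLinearMap.id ℝ ℝ).smulRight p) ∘
        (integ ∘L ContinuousLinearMap.mul ℝ C(D, ℝ) q)) :=
      (isCompactOperator_of_locallyCompactSpace_rng _).comp_clm _
    refine (congrArg IsCompactOperator ?_).mp h2
    ext f : 1
    rw [intOp_comp_mul_comp]
    rfl
  · rw [intOp_comp_mul_comp]
    exact Submodule.smul_mem _ _ hN

theorem exists_polKernel_near (k : C(D × D, ℝ)) {δ : ℝ} (hδ : 0 < δ) :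
    ∃ l, IsPolKernel l ∧ ‖l - k‖ < δ := by
  set S := polAlg.map (ContinuousMap.compRightAlgHom ℝ ℝ (ContinuousMap.fst : C(D × D, D)))
  set T := polAlg.map (ContinuousMap.compRightAlgHom ℝ ℝ (ContinuousMap.snd : C(D × D, D)))
  have hsep : (S ⊔ T).SeparatesPoints := by
    rintro ⟨x, y⟩ ⟨x', y'⟩ hne
    by_cases h : x = x'
    · have hy : y ≠ y' := fun h' => hne (by rw [h, h'])
      obtain ⟨_, ⟨f, hf, rfl⟩, hfy⟩ := polAlg_separatesPoints hy
      exact ⟨_, ⟨_, (le_sup_right : T ≤ S ⊔ T) ⟨f, hf, rfl⟩, rfl⟩, hfy⟩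
    · obtain ⟨_, ⟨f, hf, rfl⟩, hfx⟩ := polAlg_separatesPoints h
      exact ⟨_, ⟨_, (le_sup_left : S ≤ S ⊔ T) ⟨f, hf, rfl⟩, rfl⟩, hfx⟩
  obtain ⟨⟨l, hl⟩, hlk⟩ :=
    ContinuousMap.exists_mem_subalgebra_near_continuousMap_of_separatesPoints _ hsep k δ hδ
  refine ⟨l, ?_, hlk⟩
  rw [← Subalgebra.mem_toSubmodule, ← Subalgebra.mul_toSubmodule] at hl
  refine Submodule.mul_induction_on hl ?_ fun x y hx hy => hx.add hy
  rintro _ ⟨p, hp, rfl⟩ _ ⟨q, hq, rfl⟩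
  exact isPolKernel_mul hp

theorem exists_polOp_near_green {δ : ℝ} (hδ : 0 < δ) :
    ∃ Q : C(D, ℝ) →L[ℝ] C(D, ℝ), IsCompactOperator Q ∧ (∃ N, ∀ f, Q f ∈ pol N) ∧
      ‖green - Q‖ ≤ δ := by
  have h1 := invDistBound_nonneg
  have h2 : 0 ≤ (volume : Measure D).real univ := measureReal_nonneg
  set ε : ℝ := (δ / (2 * (invDistBound + 1))) ^ 2 with hε
  have hε0 : 0 < ε := by positivity
  obtain ⟨l, ⟨hl, hN⟩, hlk⟩ := exists_polKernel_near (kerC hε0)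
    (δ := δ / (2 * ((volume : Measure D).real univ + 1))) (by positivity)
  refine ⟨intOp l, hl, hN, ?_⟩
  have e : green - intOp l = (green - intOp (kerC hε0)) - intOp (l - kerC hε0) := by
    have := intOp_add (l - kerC hε0) (kerC hε0)
    rw [sub_add_cancel] at this
    rw [this]; abel
  rw [e]
  refine (norm_sub_le (green - intOp (kerC hε0)) (intOp (l - kerC hε0))).trans ?_
  have h3 := norm_green_sub_intOp_le hε0
  have h4 := norm_intOp_le (l - kerC hε0)
  have hs : Real.sqrt ε = δ / (2 * (invDistBound + 1)) := Real.sqrt_sq (by positivity)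
  rw [hs] at h3
  have h5 : δ / (2 * (invDistBound + 1)) * invDistBound ≤ δ / 2 := by
    rw [div_mul_eq_mul_div, div_le_div_iff₀ (by positivity) (by positivity)]
    nlinarith
  have h6 : ‖l - kerC hε0‖ * (volume : Measure D).real univ ≤ δ / 2 := by
    refine (mul_le_mul_of_nonneg_right hlk.le h2).trans ?_
    rw [div_mul_eq_mul_div, div_le_div_iff₀ (by positivity) (by positivity)]
    nlinarith
  linarith

theorem isCompactOperator_green : IsCompactOperator green := by
  have h : ∀ n : ℕ, ∃ Q : C(D, ℝ) →L[ℝ] C(D, ℝ), IsCompactOperator Q ∧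
      ‖green - Q‖ ≤ 1 / ((n : ℝ) + 1) := fun n => by
    obtain ⟨Q, h1, -, h2⟩ := exists_polOp_near_green (δ := 1 / ((n : ℝ) + 1)) (by positivity)
    exact ⟨Q, h1, h2⟩
  choose Q h1 h2 using h
  refine isCompactOperator_of_tendsto (F := Q) (l := atTop) ?_ (Eventually.of_forall h1)
  rw [tendsto_iff_norm_sub_tendsto_zero]
  refine squeeze_zero (fun _ => norm_nonneg _) (fun n => ?_)
    tendsto_one_div_add_atTop_nhds_zero_nat
  rw [norm_sub_rev]
  exact h2 n

end Henon

namespace Henon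

open Complex Metric Set Filter Topology

theorem green_nonneg {f : C(D, ℝ)} (hf : 0 ≤ f) : 0 ≤ green f := fun z =>
  integral_nonneg fun ζ => mul_nonneg (ker_nonneg le_rfl z ζ) (hf ζ)

theorem green_mono {f g : C(D, ℝ)} (h : f ≤ g) : green f ≤ green g := by
  have := green_nonneg (sub_nonneg.2 h)
  rwa [map_sub, sub_nonneg] at this

theorem abs_green_le (f : C(D, ℝ)) (z : D) : |green f z| ≤ green |f| z := by
  rw [abs_le]
  constructor
  · have := green_mono (f := -|f|) (g := f) (fun z => neg_abs_le (f z)) z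
    rwa [map_neg] at this
  · exact green_mono (fun z => le_abs_self (f z)) z

theorem green_pos {f : C(D, ℝ)} (hf : 0 ≤ f) (h0 : f ≠ 0) {z : D} (hz : ‖(z : ℂ)‖ < 1) :
    0 < green f z := by
  refine lt_of_le_of_ne (green_nonneg hf z) fun h => h0 ?_
  have h1 := (integral_eq_zero_iff_of_nonneg (fun ζ => mul_nonneg (ker_nonneg le_rfl z ζ) (hf ζ))
    (integrable_ker_mul z f)).1 h.symm
  have h2 : Dense {ζ : D | ker 0 z ζ * f ζ = 0 ∧ z ≠ ζ} :=
    Measure.dense_of_ae ((show ∀ᵐ ζ : D, ker 0 z ζ * f ζ = 0 from h1).and (ae_ne_D z))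
  by_contra hne
  obtain ⟨x, hx⟩ : ∃ x, f x ≠ 0 := by
    by_contra! h
    exact hne (ContinuousMap.ext h)
  have ho1 : IsOpen {x : D | f x ≠ 0} := isOpen_ne_fun (map_continuous _) continuous_const
  have ho2 : IsOpen {x : D | ‖(x : ℂ)‖ < 1} := isOpen_lt (by fun_prop) continuous_const
  obtain ⟨y, hy1, hy2⟩ := dense_punctured.inter_open_nonempty _ ho1 ⟨x, hx⟩
  obtain ⟨ζ, ⟨hζ1, hζ2⟩, hζ3, hζ4⟩ := h2.inter_open_nonempty _ (ho1.inter ho2) ⟨y, hy1, hy2.2⟩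
  exact hζ1 ((mul_eq_zero.1 hζ3).resolve_left (ker_pos z ζ hz hζ2 hζ4).ne')

theorem green_boundary (f : C(D, ℝ)) {z : D} (hz : ‖(z : ℂ)‖ = 1) : green f z = 0 := by
  rw [green_apply]
  simp [ker, hz]

theorem young_four (x y : ℝ) : x ^ 3 * y ≤ 3 / 4 * x ^ 4 + 1 / 4 * y ^ 4 := by
  nlinarith [sq_nonneg ((x - y) * x), sq_nonneg ((x - y) * (x + y))]

theorem eq_of_young_four {x y : ℝ} (h : x ^ 3 * y = 3 / 4 * x ^ 4 + 1 / 4 * y ^ 4) : x = y := by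
  have h1 : ((x - y) * x) ^ 2 = 0 := by
    nlinarith [sq_nonneg ((x - y) * x), sq_nonneg ((x - y) * (x + y))]
  have h2 : ((x - y) * (x + y)) ^ 2 = 0 := by
    nlinarith [sq_nonneg ((x - y) * x), sq_nonneg ((x - y) * (x + y))]
  have h1 := pow_eq_zero_iff (two_ne_zero) |>.1 h1
  have h2 := pow_eq_zero_iff (two_ne_zero) |>.1 h2
  have : (x - y) ^ 2 = 0 := by linear_combination 2 * h1 - h2
  exact sub_eq_zero.1 (pow_eq_zero_iff two_ne_zero |>.1 this)

/-- The weight `|z|^(2 b)`. -/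
noncomputable def wt (b : ℕ) : C(D, ℝ) := ⟨fun z => (‖(z : ℂ)‖ ^ 2) ^ b, by fun_prop⟩

theorem wt_apply (b : ℕ) (z : D) : wt b z = (‖(z : ℂ)‖ ^ 2) ^ b := rfl

theorem wt_nonneg (b : ℕ) : 0 ≤ wt b := fun z => by
  change 0 ≤ (‖(z : ℂ)‖ ^ 2) ^ b
  positivity

theorem wt_le_one (b : ℕ) (z : D) : wt b z ≤ 1 :=
  pow_le_one₀ (by positivity) (pow_le_one₀ (norm_nonneg _) z.norm_le)

theorem wt_pos (b : ℕ) {z : D} (hz : (z : ℂ) ≠ 0) : 0 < wt b z := by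
  rw [wt_apply]; positivity

theorem wt_eq_reMon (b : ℕ) : wt b = reMon 1 b b := by
  ext z
  rw [reMon_apply, ← mul_pow, Complex.mul_conj, Complex.normSq_eq_norm_sq, one_mul,
    ← Complex.ofReal_pow, Complex.ofReal_re, wt_apply]

theorem eq_zero_of_wt_mul {b : ℕ} {f : C(D, ℝ)} (h : wt b * f = 0) : f = 0 := by
  refine DFunLike.coe_injective (Continuous.ext_on dense_punctured (map_continuous _)
    continuous_const ?_)
  rintro z ⟨hz, -⟩
  have := DFunLike.congr_fun h z
  exact (mul_eq_zero.1 this).resolve_left (wt_pos b (norm_pos_iff.1 hz)).ne'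

variable (b : ℕ)

/-- `∫ w h⁴`. -/
noncomputable def quart (h : C(D, ℝ)) : ℝ := integ (wt b * h ^ 4)

/-- The energy of `w h³`. -/
noncomputable def dual (h : C(D, ℝ)) : ℝ := energy (wt b * h ^ 3) (wt b * h ^ 3)

theorem quart_nonneg (h : C(D, ℝ)) : 0 ≤ quart b h :=
  integ_nonneg (mul_nonneg (wt_nonneg b) fun z => by
    change 0 ≤ h z ^ 4
    positivity)

theorem dual_nonneg (h : C(D, ℝ)) : 0 ≤ dual b h := energy_self_nonneg _

theorem quart_smul (c : ℝ) (h : C(D, ℝ)) : quart b (c • h) = c ^ 4 * quart b h := by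
  rw [quart, smul_pow, mul_smul_comm, map_smul, smul_eq_mul, quart]

theorem dual_smul (c : ℝ) (h : C(D, ℝ)) : dual b (c • h) = c ^ 6 * dual b h := by
  rw [dual, smul_pow, mul_smul_comm, energy_smul_left, energy_smul_right, dual]
  ring

theorem continuous_quart : Continuous (quart b) := by unfold quart; fun_prop

theorem continuous_dual : Continuous (dual b) := by
  unfold dual
  exact continuous_energy.comp (f := fun h : C(D, ℝ) => (wt b * h ^ 3, wt b * h ^ 3)) (by fun_prop)

variable {b}

theorem eq_zero_of_quart_eq_zero {h : C(D, ℝ)} (h0 : quart b h = 0) : h = 0 := by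
  have h1 := eq_zero_of_integ_eq_zero (f := wt b * h ^ 4)
    (mul_nonneg (wt_nonneg b) fun z => by
      change 0 ≤ h z ^ 4
      positivity) h0
  ext z
  exact pow_eq_zero_iff (four_ne_zero) |>.1 (DFunLike.congr_fun (eq_zero_of_wt_mul h1) z)

theorem dual_eq_integ (h : C(D, ℝ)) :
    dual b h = integ (wt b * (h ^ 3 * green (wt b * h ^ 3))) := by
  rw [dual, energy, mul_assoc]

theorem quart_green (f g : C(D, ℝ)) (h : f = green g) :
    quart b f = energy g (wt b * f ^ 3) := by
  rw [energy_comm, energy, ← h, quart]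
  ring_nf

theorem integ_mul_pow_three_le {f h : C(D, ℝ)} :
    integ (wt b * (f ^ 3 * h)) ≤ 3 / 4 * quart b f + 1 / 4 * quart b h := by
  rw [quart, quart, ← smul_eq_mul (3 / 4 : ℝ), ← smul_eq_mul (1 / 4 : ℝ), ← map_smul, ← map_smul, ← map_add]
  refine integ_mono fun z => ?_
  change wt b z * (f z ^ 3 * h z) ≤ 3 / 4 * (wt b z * f z ^ 4) + 1 / 4 * (wt b z * h z ^ 4)
  have hw : 0 ≤ wt b z := wt_nonneg b z
  have := mul_le_mul_of_nonneg_left (young_four (f z) (h z)) hw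
  linarith

/-- Uniform bound for `green (w h³)` when `∫ w h⁴ = 1`. -/
noncomputable def supBound : ℝ := 1 / 4 * invDistBound + 3 / 4

theorem norm_green_le {h : C(D, ℝ)} (h1 : quart b h = 1) : ‖green (wt b * h ^ 3)‖ ≤ supBound := by
  have := invDistBound_nonneg
  rw [ContinuousMap.norm_le _ (by unfold supBound; positivity)]
  intro z
  rw [Real.norm_eq_abs]
  refine (abs_green_le _ z).trans ?_
  have h2 := integrable_ker_pow_four z
  have h3 := integrable_cont (wt b * h ^ 4)
  calc green |wt b * h ^ 3| z
      ≤ ∫ ζ : D, (1 / 4 * ker 0 z ζ ^ 4 + 3 / 4 * (wt b * h ^ 4) ζ) := by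
        refine integral_mono (integrable_ker_mul z _) ((h2.const_mul _).add (h3.const_mul _)) ?_
        intro ζ
        have hw := wt_nonneg b ζ
        have hw1 := wt_le_one b ζ
        change 0 ≤ wt b ζ at hw
        change ker 0 z ζ * |wt b ζ * h ζ ^ 3| ≤ 1 / 4 * ker 0 z ζ ^ 4 + 3 / 4 * (wt b ζ * h ζ ^ 4)
        rw [abs_mul, abs_of_nonneg hw, abs_pow]
        have hy := young_four |h ζ| (ker 0 z ζ)
        have h4 : |h ζ| ^ 4 = h ζ ^ 4 := by
          rw [← abs_pow, abs_of_nonneg (by positivity)]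
        rw [h4] at hy
        have h5 : 0 ≤ ker 0 z ζ ^ 4 := by positivity
        nlinarith [mul_le_mul_of_nonneg_left hy hw]
    _ = 1 / 4 * (∫ ζ : D, ker 0 z ζ ^ 4) + 3 / 4 * quart b h := by
        rw [integral_add (h2.const_mul _) (h3.const_mul _), integral_const_mul, integral_const_mul]
        rfl
    _ ≤ supBound := by
        rw [h1, supBound]
        linarith [integral_ker_pow_four_le z]

/-- The result of one step of the (normalised) iteration `h ↦ green (w h³)`. -/
theorem exists_improved {h : C(D, ℝ)} (h1 : quart b h = 1) (hJ : 0 < dual b h) :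
    ∃ α : ℝ, dual b h ≤ α ∧ quart b (α⁻¹ • green (wt b * h ^ 3)) = 1 ∧
      α ^ 2 ≤ dual b (α⁻¹ • green (wt b * h ^ 3)) * dual b h ∧
      integ (wt b * (h ^ 3 * (α⁻¹ • green (wt b * h ^ 3)))) = dual b h / α := by
  set u := green (wt b * h ^ 3) with hu
  have hA : 0 < quart b u := by
    refine lt_of_le_of_ne (quart_nonneg b u) fun h0 => hJ.ne' ?_
    rw [dual_eq_integ, ← hu, eq_zero_of_quart_eq_zero h0.symm]
    simp
  set α := Real.sqrt (Real.sqrt (quart b u)) with hα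
  have hα0 : 0 < α := Real.sqrt_pos.2 (Real.sqrt_pos.2 hA)
  have hα4 : α ^ 4 = quart b u := by
    rw [show α ^ 4 = (α ^ 2) ^ 2 by ring, hα, Real.sq_sqrt (Real.sqrt_nonneg _),
      Real.sq_sqrt hA.le]
  have hq : quart b (α⁻¹ • u) = 1 := by
    rw [quart_smul, ← hα4, ← mul_pow, inv_mul_cancel₀ hα0.ne', one_pow]
  have hi : integ (wt b * (h ^ 3 * (α⁻¹ • u))) = dual b h / α := by
    rw [mul_smul_comm, mul_smul_comm, map_smul, smul_eq_mul, dual_eq_integ, ← hu]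
    ring
  refine ⟨α, ?_, hq, ?_, hi⟩
  · have := integ_mul_pow_three_le (b := b) (f := h) (h := α⁻¹ • u)
    rw [hi, h1, hq, div_le_iff₀ hα0] at this
    linarith
  · rw [dual_smul]
    have h2 : quart b u ^ 2 ≤ dual b u * dual b h := by
      rw [quart_green u _ hu]
      refine (energy_sq_le _ _).trans_eq ?_
      rw [mul_comm]; rfl
    rw [← hα4] at h2
    have h3 : α⁻¹ ^ 6 * α ^ 6 = 1 := by rw [← mul_pow, inv_mul_cancel₀ hα0.ne', one_pow]
    have h4 : 0 ≤ α⁻¹ ^ 6 := by positivity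
    have := mul_le_mul_of_nonneg_left h2 h4
    have e : α⁻¹ ^ 6 * (α ^ 4) ^ 2 = α ^ 2 := by
      linear_combination α ^ 2 * h3
    rw [e] at this
    linarith

theorem exists_improved_le {h : C(D, ℝ)} (h1 : quart b h = 1) (hJ : 0 < dual b h) :
    ∃ α : ℝ, dual b h ≤ α ∧ quart b (α⁻¹ • green (wt b * h ^ 3)) = 1 ∧
      dual b h ≤ dual b (α⁻¹ • green (wt b * h ^ 3)) := by
  obtain ⟨α, h2, h3, h4, -⟩ := exists_improved h1 hJ
  refine ⟨α, h2, h3, le_of_mul_le_mul_right ?_ hJ⟩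
  nlinarith

end Henon

namespace Henon

open Complex Metric Set Filter Topology

variable {b : ℕ}

theorem norm_wt_le : ‖wt b‖ ≤ 1 := by
  rw [ContinuousMap.norm_le _ zero_le_one]
  intro z
  rw [Real.norm_of_nonneg (show 0 ≤ wt b z from wt_nonneg b z)]
  exact wt_le_one b z

theorem wt_ne_zero : wt b ≠ 0 := fun h => by
  have := DFunLike.congr_fun h ⟨1, by simp⟩
  simp [wt_apply] at this

theorem integ_pos {f : C(D, ℝ)} (hf : 0 ≤ f) (h0 : f ≠ 0) : 0 < integ f :=
  lt_of_le_of_ne (integ_nonneg hf) fun h => h0 (eq_zero_of_integ_eq_zero hf h.symm)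

theorem mul_nonneg_cont {f g : C(D, ℝ)} (hf : 0 ≤ f) (hg : 0 ≤ g) : 0 ≤ f * g := fun z =>
  mul_nonneg (hf z) (hg z)

theorem energy_pos {f : C(D, ℝ)} (hf : 0 ≤ f) (h0 : f ≠ 0) : 0 < energy f f := by
  refine integ_pos (mul_nonneg_cont hf (green_nonneg hf)) fun h => h0 ?_
  refine DFunLike.coe_injective (Continuous.ext_on dense_punctured (map_continuous _)
    continuous_const ?_)
  rintro z ⟨-, hz⟩
  exact (mul_eq_zero.1 (DFunLike.congr_fun h z)).resolve_right (green_pos hf h0 hz).ne'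

theorem exists_quart_eq_one_dual_pos (b : ℕ) : ∃ h : C(D, ℝ), quart b h = 1 ∧ 0 < dual b h := by
  have h1 : 0 < quart b 1 := by
    rw [quart, one_pow, mul_one]
    exact integ_pos (wt_nonneg b) wt_ne_zero
  have h2 : 0 < dual b 1 := by
    rw [dual, one_pow, mul_one]
    exact energy_pos (wt_nonneg b) wt_ne_zero
  set α := Real.sqrt (Real.sqrt (quart b 1)) with hα
  have hα0 : 0 < α := Real.sqrt_pos.2 (Real.sqrt_pos.2 h1)
  have hα4 : α ^ 4 = quart b 1 := by
    rw [show α ^ 4 = (α ^ 2) ^ 2 by ring, hα, Real.sq_sqrt (Real.sqrt_nonneg _),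
      Real.sq_sqrt h1.le]
  refine ⟨α⁻¹ • 1, ?_, ?_⟩
  · rw [quart_smul, ← hα4, ← mul_pow, inv_mul_cancel₀ hα0.ne', one_pow]
  · rw [dual_smul]
    positivity

theorem exists_maximizer (b : ℕ) : ∃ h : C(D, ℝ), quart b h = 1 ∧ 0 < dual b h ∧
    ∀ g, quart b g = 1 → dual b g ≤ dual b h := by
  obtain ⟨h₀, h01, h0J⟩ := exists_quart_eq_one_dual_pos b
  set j := dual b h₀ with hj
  have hB : 0 ≤ supBound := by
    have := invDistBound_nonneg
    unfold supBound; positivity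
  set ρ := j⁻¹ * supBound with hρ
  set K : Set C(D, ℝ) := (fun p : ℝ × C(D, ℝ) => p.1 • p.2) ''
    (Icc 0 j⁻¹ ×ˢ closure (green '' closedBall 0 (ρ ^ 3))) with hK
  have hKc : IsCompact K := by
    refine (isCompact_Icc.prod ?_).image (by fun_prop)
    exact isCompactOperator_green.isCompact_closure_image_closedBall (f := (green : C(D, ℝ) →ₗ[ℝ] C(D, ℝ))) _
  have hstep : ∀ g, quart b g = 1 → j ≤ dual b g →
      ∃ g' ∈ K ∩ {h | quart b h = 1}, dual b g ≤ dual b g' := by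
    intro g hg hgj
    obtain ⟨α, hα, hq, hd⟩ := exists_improved_le hg (h0J.trans_le hgj)
    set g' := α⁻¹ • green (wt b * g ^ 3) with hg'
    obtain ⟨α', hα', hq', hd'⟩ := exists_improved_le hq ((h0J.trans_le hgj).trans_le hd)
    have hinv : ∀ {α : ℝ}, j ≤ α → α⁻¹ ∈ Icc 0 j⁻¹ := fun h =>
      ⟨inv_nonneg.2 (h0J.le.trans h), inv_anti₀ h0J h⟩
    refine ⟨_, ⟨⟨(α'⁻¹, green (wt b * g' ^ 3)), ⟨hinv ((hgj.trans hd).trans hα'),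
      subset_closure ⟨_, ?_, rfl⟩⟩, rfl⟩, hq'⟩, hd.trans hd'⟩
    have hn : ‖g'‖ ≤ ρ := by
      have h3 := hinv (hgj.trans hα)
      rw [hg', norm_smul, Real.norm_of_nonneg h3.1]
      exact mul_le_mul h3.2 (norm_green_le hg) (norm_nonneg _) (h3.1.trans h3.2)
    rw [mem_closedBall_zero_iff]
    calc ‖wt b * g' ^ 3‖ ≤ ‖wt b‖ * ‖g'‖ ^ 3 :=
          (norm_mul_le _ _).trans (mul_le_mul_of_nonneg_left (norm_pow_le _ _) (norm_nonneg _))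
      _ ≤ 1 * ρ ^ 3 := by
          gcongr
          exact norm_wt_le
      _ = ρ ^ 3 := one_mul _
  obtain ⟨g₀, hg₀, hjg₀⟩ := hstep h₀ h01 le_rfl
  obtain ⟨h, hh, hmax⟩ := (hKc.inter_right (isClosed_eq (continuous_quart b)
    continuous_const)).exists_isMaxOn ⟨g₀, hg₀⟩ (continuous_dual b).continuousOn
  have hjh : j ≤ dual b h := hjg₀.trans (hmax hg₀)
  refine ⟨h, hh.2, h0J.trans_le hjh, fun g hg => ?_⟩
  rcases le_total j (dual b g) with h1 | h1
  · obtain ⟨g', hg', hgg'⟩ := hstep g hg h1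
    exact hgg'.trans (hmax hg')
  · exact h1.trans hjh

theorem quart_abs (h : C(D, ℝ)) : quart b |h| = quart b h := by
  have : |h| ^ 4 = h ^ 4 := by
    ext z
    change |h z| ^ 4 = h z ^ 4
    rw [← abs_pow, abs_of_nonneg (by positivity)]
  rw [quart, this, quart]

theorem dual_le_dual_abs (h : C(D, ℝ)) : dual b h ≤ dual b |h| := by
  refine integ_mono fun z => ?_
  have e : |wt b * h ^ 3| = wt b * |h| ^ 3 := by
    ext z
    change |wt b z * h z ^ 3| = wt b z * |h z| ^ 3
    rw [abs_mul, abs_pow, abs_of_nonneg (show 0 ≤ wt b z from wt_nonneg b z)]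
  change (wt b * h ^ 3) z * green (wt b * h ^ 3) z ≤
    (wt b * |h| ^ 3) z * green (wt b * |h| ^ 3) z
  rw [← e]
  refine (le_abs_self _).trans ?_
  rw [abs_mul]
  exact mul_le_mul_of_nonneg_left (abs_green_le _ _) (abs_nonneg _)

/-- `u` is a nonnegative solution of `u = (-Δ)⁻¹ (w u³)` that maximises the dual functional. -/
structure IsGroundState (b : ℕ) (u : C(D, ℝ)) : Prop where
  eq_green : u = green (wt b * u ^ 3)
  nonneg : 0 ≤ u
  quart_pos : 0 < quart b u
  dual_le : ∀ h, quart b h = quart b u → dual b h ≤ dual b u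

theorem exists_isGroundState (b : ℕ) : ∃ u, IsGroundState b u := by
  obtain ⟨h₁, h₁1, h₁J, h₁max⟩ := exists_maximizer b
  obtain ⟨h, hh, h1, hJ, hmax⟩ : ∃ h : C(D, ℝ), 0 ≤ h ∧ quart b h = 1 ∧ 0 < dual b h ∧
      ∀ g, quart b g = 1 → dual b g ≤ dual b h :=
    ⟨|h₁|, fun z => abs_nonneg (h₁ z), by rw [quart_abs, h₁1], h₁J.trans_le (dual_le_dual_abs _),
      fun g hg => (h₁max g hg).trans (dual_le_dual_abs _)⟩
  obtain ⟨α, hα, hq, hd, hi⟩ := exists_improved h1 hJ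
  have hα0 : 0 < α := hJ.trans_le hα
  set U := α⁻¹ • green (wt b * h ^ 3) with hU
  have hαJ : α = dual b h := by
    refine le_antisymm ?_ hα
    have := hmax U hq
    nlinarith
  rw [hαJ.symm, div_self hα0.ne'] at hi
  have hhU : h = U := by
    have h2 : integ (wt b * ((3 / 4 : ℝ) • h ^ 4 + (1 / 4 : ℝ) • U ^ 4 - h ^ 3 * U)) = 0 := by
      rw [mul_sub, mul_add, mul_smul_comm, mul_smul_comm, map_sub, map_add, map_smul, map_smul, hi]
      change (3 / 4 : ℝ) • quart b h + (1 / 4 : ℝ) • quart b U - 1 = 0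
      rw [h1, hq]
      norm_num
    have h3 := eq_zero_of_wt_mul (eq_zero_of_integ_eq_zero (mul_nonneg_cont (wt_nonneg b)
      fun z => by
        change 0 ≤ 3 / 4 * h z ^ 4 + 1 / 4 * U z ^ 4 - h z ^ 3 * U z
        linarith [young_four (h z) (U z)]) h2)
    ext z
    refine eq_of_young_four ?_
    have h4 : 3 / 4 * h z ^ 4 + 1 / 4 * U z ^ 4 - h z ^ 3 * U z = 0 := DFunLike.congr_fun h3 z
    linarith
  set c := Real.sqrt α⁻¹ with hc
  have hc2 : c ^ 2 = α⁻¹ := Real.sq_sqrt (inv_nonneg.2 hα0.le)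
  have hc0 : 0 < c := Real.sqrt_pos.2 (inv_pos.2 hα0)
  have hqc : quart b (c • h) = c ^ 4 := by rw [quart_smul, h1, mul_one]
  refine ⟨c • h, ?_, fun z => mul_nonneg hc0.le (hh z), by rw [hqc]; positivity, fun g hg => ?_⟩
  · rw [smul_pow, mul_smul_comm, map_smul, pow_succ', mul_smul, hc2, ← hU, ← hhU]
  · rw [dual_smul]
    have h5 : quart b (c⁻¹ • g) = 1 := by
      rw [quart_smul, hg, hqc, ← mul_pow, inv_mul_cancel₀ hc0.ne', one_pow]
    have h6 := hmax _ h5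
    rw [dual_smul] at h6
    have h7 := mul_le_mul_of_nonneg_left h6 (show 0 ≤ c ^ 6 by positivity)
    rwa [← mul_assoc, ← mul_pow, mul_inv_cancel₀ hc0.ne', one_pow, one_mul] at h7

namespace IsGroundState

variable {u : C(D, ℝ)}

theorem dual_eq (hu : IsGroundState b u) : dual b u = quart b u := by
  rw [dual_eq_integ, ← hu.eq_green, quart]
  ring_nf

theorem mul_ne_zero (hu : IsGroundState b u) : wt b * u ^ 3 ≠ 0 := fun h => by
  have h1 := hu.quart_pos
  rw [quart, pow_succ, ← mul_assoc, h, zero_mul, map_zero] at h1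
  exact lt_irrefl _ h1

theorem mul_nonneg (hu : IsGroundState b u) : 0 ≤ wt b * u ^ 3 :=
  mul_nonneg_cont (wt_nonneg b) fun z => pow_nonneg (hu.nonneg z) 3

theorem pos (hu : IsGroundState b u) {z : D} (hz : ‖(z : ℂ)‖ < 1) : 0 < u z := by
  rw [hu.eq_green]
  exact green_pos hu.mul_nonneg hu.mul_ne_zero hz

theorem boundary (hu : IsGroundState b u) {z : D} (hz : ‖(z : ℂ)‖ = 1) : u z = 0 := by
  rw [hu.eq_green]
  exact green_boundary _ hz

theorem quart_green_mul_le (hu : IsGroundState b u) (g : C(D, ℝ)) :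
    quart b (green g) * quart b u ≤ energy g g ^ 2 := by
  set v := green g with hv
  set S := quart b u with hS
  have hS0 : 0 < S := hu.quart_pos
  rcases (quart_nonneg b v).eq_or_lt with hA | hA
  · rw [← hA, zero_mul]; positivity
  set t := Real.sqrt (Real.sqrt (S / quart b v)) with ht
  have hSA : 0 < S / quart b v := div_pos hS0 hA
  have ht4 : t ^ 4 = S / quart b v := by
    rw [show t ^ 4 = (t ^ 2) ^ 2 by ring, ht, Real.sq_sqrt (Real.sqrt_nonneg _),
      Real.sq_sqrt hSA.le]
  have h1 := hu.dual_le (t • v) (by rw [quart_smul, ht4, div_mul_cancel₀ _ hA.ne'])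
  rw [dual_smul, hu.dual_eq, ← hS] at h1
  have h2 : quart b v ^ 2 ≤ energy g g * dual b v := by
    rw [quart_green v g hv]
    exact energy_sq_le _ _
  have hd := dual_nonneg b v
  have he := energy_self_nonneg g
  generalize dual b v = J at *
  generalize energy g g = E at *
  generalize quart b v = A at *
  have h3 : t ^ 4 * A = S := by rw [ht4, div_mul_cancel₀ _ hA.ne']
  have h4 : (t ^ 6 * J) ^ 2 ≤ S ^ 2 := pow_le_pow_left₀ (by positivity) h1 2
  have h5 : S ^ 3 * J ^ 2 ≤ S ^ 2 * A ^ 3 := by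
    have : S ^ 3 * J ^ 2 = (t ^ 6 * J) ^ 2 * A ^ 3 := by rw [← h3]; ring
    rw [this]
    exact mul_le_mul_of_nonneg_right h4 (by positivity)
  have h6 : S * J ^ 2 ≤ A ^ 3 := by
    have : S ^ 2 * (S * J ^ 2) ≤ S ^ 2 * A ^ 3 := by linarith
    exact le_of_mul_le_mul_left this (by positivity)
  have h7 : A ^ 4 ≤ E ^ 2 * J ^ 2 := by
    have := pow_le_pow_left₀ (by positivity) h2 2
    linarith
  have h8 : A ^ 3 * (A * S) ≤ A ^ 3 * E ^ 2 := by
    have h9 := mul_le_mul_of_nonneg_right h7 hS0.le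
    have h10 := mul_le_mul_of_nonneg_left h6 (sq_nonneg E)
    linarith
  exact le_of_mul_le_mul_left h8 (by positivity)

end IsGroundState

end Henon

namespace Henon

open Complex Metric Set Filter Topology

/-- `Dec ν L B f`: `f` is a sum of terms `fᵢ`, each a polynomial of degree `kᵢ < L` or arbitrary
with `kᵢ = L`, such that `∑ ν ^ kᵢ ‖fᵢ‖ ≤ B`. -/
inductive Dec (ν : ℝ) (L : ℕ) : ℝ → C(D, ℝ) → Prop
  | atom (k : ℕ) (f : C(D, ℝ)) (hk : k ≤ L) (hf : k < L → f ∈ pol k) : Dec ν L (ν ^ k * ‖f‖) f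
  | add (B B' : ℝ) (f g : C(D, ℝ)) : Dec ν L B f → Dec ν L B' g → Dec ν L (B + B') (f + g)
  | mono (B B' : ℝ) (f : C(D, ℝ)) : B ≤ B' → Dec ν L B f → Dec ν L B' f

variable {ν : ℝ} {L : ℕ}

theorem Dec.nonneg (hν : 1 ≤ ν) {B : ℝ} {f : C(D, ℝ)} (h : Dec ν L B f) : 0 ≤ B := by
  induction h with
  | atom k f hk hf => positivity
  | add B B' f g _ _ h1 h2 => exact add_nonneg h1 h2
  | mono B B' f h _ h1 => exact h1.trans h

theorem Dec.atom_of_mem (hν : 1 ≤ ν) {k : ℕ} {f : C(D, ℝ)} (hf : k < L → f ∈ pol k) :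
    Dec ν L (ν ^ k * ‖f‖) f := by
  rcases lt_or_ge k L with h | h
  · exact .atom k f h.le hf
  · exact .mono _ _ _ (mul_le_mul_of_nonneg_right (pow_le_pow_right₀ hν h) (norm_nonneg _))
      (.atom L f le_rfl fun h => absurd h (lt_irrefl _))

theorem Dec.mul (hν : 1 ≤ ν) {B B' : ℝ} {f g : C(D, ℝ)} (hf : Dec ν L B f) (hg : Dec ν L B' g) :
    Dec ν L (B * B') (f * g) := by
  induction hf with
  | atom k f hk hf =>
    induction hg with
    | atom k' g hk' hg =>
      refine .mono _ _ _ ?_ (Dec.atom_of_mem hν (k := k + k') fun h =>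
        mul_mem_pol (hf (by omega)) (hg (by omega)))
      calc ν ^ (k + k') * ‖f * g‖ ≤ ν ^ (k + k') * (‖f‖ * ‖g‖) := by
            gcongr
            exact norm_mul_le _ _
        _ = ν ^ k * ‖f‖ * (ν ^ k' * ‖g‖) := by ring
    | add B B' g g' _ _ h1 h2 =>
      rw [mul_add, mul_add]
      exact .add _ _ _ _ h1 h2
    | mono B B' g h _ h1 => exact .mono _ _ _ (by gcongr) h1
  | add B B' f f' _ _ h1 h2 =>
    rw [add_mul, add_mul]
    exact .add _ _ _ _ h1 h2
  | mono B B' f h _ h1 =>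
    exact .mono _ _ _ (mul_le_mul_of_nonneg_right h (hg.nonneg hν)) h1

theorem Dec.map (hν : 1 ≤ ν) {B δ : ℝ} {s : ℕ} (hs : 1 ≤ s) {f : C(D, ℝ)}
    (R : C(D, ℝ) →L[ℝ] C(D, ℝ)) (hR : ‖R‖ ≤ δ) (hRs : ∀ n, ∀ f ∈ pol n, R f ∈ pol (n + s))
    (hf : Dec ν L B f) : Dec ν (L + 1) (ν ^ s * δ * B) (R f) := by
  have hδ : 0 ≤ δ := (norm_nonneg R).trans hR
  induction hf with
  | atom k f hk hf =>
    refine .mono _ _ _ ?_ (Dec.atom_of_mem hν (k := k + s) fun h => hRs _ _ (hf (by omega)))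
    calc ν ^ (k + s) * ‖R f‖ ≤ ν ^ (k + s) * (δ * ‖f‖) := by
          gcongr
          exact R.le_of_opNorm_le hR f
      _ = ν ^ s * δ * (ν ^ k * ‖f‖) := by ring
  | add B B' f g _ _ h1 h2 =>
    rw [mul_add, map_add]
    exact .add _ _ _ _ h1 h2
  | mono B B' f h _ h1 => exact .mono _ _ _ (by gcongr) h1

theorem Dec.exists_approx (hν : 1 ≤ ν) {B : ℝ} {f : C(D, ℝ)} (hf : Dec ν L B f) :
    ∃ p ∈ pol L, ‖f - p‖ * ν ^ L ≤ B := by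
  induction hf with
  | atom k f hk hf =>
    rcases hk.lt_or_eq with h | rfl
    · exact ⟨f, pol_mono hk (hf h), by simp; positivity⟩
    · exact ⟨0, zero_mem _, by rw [sub_zero, mul_comm]⟩
  | add B B' f g _ _ h1 h2 =>
    obtain ⟨p, hp, h1⟩ := h1
    obtain ⟨q, hq, h2⟩ := h2
    refine ⟨p + q, add_mem hp hq, ?_⟩
    rw [add_sub_add_comm]
    calc _ ≤ (‖f - p‖ + ‖g - q‖) * ν ^ L := by
          gcongr
          exact norm_add_le _ _
      _ ≤ B + B' := by linarith
  | mono B B' f h _ h1 =>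
    obtain ⟨p, hp, h1⟩ := h1
    exact ⟨p, hp, h1.trans h⟩

theorem exists_one_lt_pow_le_two (s : ℕ) : ∃ ν : ℝ, 1 < ν ∧ ν ^ s ≤ 2 := by
  have h : Tendsto (fun ν : ℝ => ν ^ s) (𝓝[>] 1) (𝓝 (1 ^ s)) :=
    ((continuous_pow s).tendsto 1).mono_left nhdsWithin_le_nhds
  rw [one_pow] at h
  obtain ⟨ν, h1, h2⟩ := ((h.eventually (ge_mem_nhds one_lt_two)).and
    self_mem_nhdsWithin).exists
  exact ⟨ν, h2, h1⟩

/-- Solutions of `u = (-Δ)⁻¹ (w u³)` are approximated by polynomials at a geometric rate. -/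
theorem exists_geometric_approx {b : ℕ} {u : C(D, ℝ)} (hu : u = green (wt b * u ^ 3)) :
    ∃ ν > 1, ∃ B : ℝ, ∀ n, ∃ p ∈ pol n, ‖u - p‖ * ν ^ n ≤ B := by
  set B : ℝ := 8 * (‖u‖ + 1) with hB
  have hB0 : 0 < B := by positivity
  set δ : ℝ := 1 / (8 * B ^ 2) with hδ
  have hδ0 : 0 < δ := by positivity
  obtain ⟨Q, -, ⟨N, hN⟩, hQ⟩ := exists_polOp_near_green hδ0
  set M : C(D, ℝ) →L[ℝ] C(D, ℝ) := ContinuousLinearMap.mul ℝ C(D, ℝ) (wt b)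
  set R := (green - Q) ∘L M with hR
  set s := 2 * b + N + 2 with hs
  have hM : ‖M‖ ≤ 1 := (ContinuousLinearMap.opNorm_mul_apply_le ℝ _ _).trans norm_wt_le
  have hRδ : ‖R‖ ≤ δ := by
    refine (ContinuousLinearMap.opNorm_comp_le _ _).trans ?_
    calc ‖green - Q‖ * ‖M‖ ≤ δ * 1 := by gcongr
      _ = δ := mul_one _
  have hRs : ∀ n, ∀ f ∈ pol n, R f ∈ pol (n + s) := by
    intro n f hf
    have h1 : wt b * f ∈ pol (2 * b + n) := mul_mem_pol (by
      rw [wt_eq_reMon]; exact reMon_mem_pol _ (by omega)) hf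
    change green (wt b * f) - Q (wt b * f) ∈ _
    exact sub_mem (pol_mono (by omega) (green_mem_pol h1)) (pol_mono (by omega) (hN _))
  obtain ⟨ν, hν, hνs⟩ := exists_one_lt_pow_le_two s
  have hδB : δ * B ^ 2 = 1 / 8 := by rw [hδ]; field_simp
  have hdecomp : u = Q (wt b * u ^ 3) + R (u ^ 3) := by
    change u = Q (wt b * u ^ 3) + (green (wt b * u ^ 3) - Q (wt b * u ^ 3))
    rw [← hu]; abel
  have hu3 : ‖u ^ 3‖ ≤ ‖u‖ ^ 3 := norm_pow_le _ _
  have hQu : ‖Q (wt b * u ^ 3)‖ ≤ ‖u‖ + δ * ‖u‖ ^ 3 := by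
    have : Q (wt b * u ^ 3) = u - R (u ^ 3) := eq_sub_of_add_eq hdecomp.symm
    rw [this]
    refine (norm_sub_le _ _).trans ?_
    have := R.le_of_opNorm_le hRδ (u ^ 3)
    have := mul_le_mul_of_nonneg_left hu3 hδ0.le
    linarith
  have hQu2 : ‖Q (wt b * u ^ 3)‖ ≤ 2 * ‖u‖ := by
    have h1 : ‖u‖ ^ 2 ≤ B ^ 2 := pow_le_pow_left₀ (norm_nonneg _) (by
      rw [hB]; linarith [norm_nonneg u]) 2
    have h2 : δ * ‖u‖ ^ 2 ≤ 1 / 8 := by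
      rw [← hδB]; gcongr
    have h3 := mul_le_mul_of_nonneg_right h2 (norm_nonneg u)
    have h4 := norm_nonneg u
    nlinarith
  have key : ∀ L, Dec ν L B u := by
    intro L
    induction L with
    | zero =>
      refine .mono _ _ _ ?_ (.atom 0 u le_rfl fun h => absurd h (lt_irrefl _))
      rw [pow_zero, one_mul, hB]
      linarith [norm_nonneg u]
    | succ L ih =>
      have h3 : Dec ν L (B ^ 3) (u ^ 3) := by
        rw [pow_succ, pow_two, pow_succ, pow_two]
        exact (ih.mul hν.le ih).mul hν.le ih
      have h4 := h3.map hν.le (by omega) R hRδ hRs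
      have h5 : Dec ν (L + 1) (ν ^ N * ‖Q (wt b * u ^ 3)‖) (Q (wt b * u ^ 3)) :=
        Dec.atom_of_mem hν.le fun _ => hN _
      have h6 := Dec.add _ _ _ _ h5 h4
      rw [← hdecomp] at h6
      refine .mono _ _ _ ?_ h6
      have h7 : ν ^ N ≤ 2 := (pow_le_pow_right₀ hν.le (by omega)).trans hνs
      have h8 : ν ^ N * ‖Q (wt b * u ^ 3)‖ ≤ 2 * (2 * ‖u‖) :=
        mul_le_mul h7 hQu2 (norm_nonneg _) (by norm_num)
      have h9 : ν ^ s * δ * B ^ 3 ≤ B / 4 := by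
        calc ν ^ s * δ * B ^ 3 = ν ^ s * (δ * B ^ 2 * B) := by ring
          _ ≤ 2 * (δ * B ^ 2 * B) := by gcongr
          _ = B / 4 := by rw [hδB]; ring
      have h10 := norm_nonneg u
      linarith
  exact ⟨ν, hν, B, fun n => (key n).exists_approx hν.le⟩

end Henon

namespace Henon

open Complex Metric Set Filter Topology

/-- Complex polynomials of total degree at most `n` in two variables, as functions. -/
def cpol (n : ℕ) : Submodule ℂ (ℂ × ℂ → ℂ) :=
  Submodule.span ℂ {F | ∃ j k : ℕ, j + k ≤ n ∧ F = fun p => p.1 ^ j * p.2 ^ k}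

theorem exists_cpol_of_mem_pol {n : ℕ} {p : C(D, ℝ)} (hp : p ∈ pol n) :
    ∃ F ∈ cpol n, ∀ z : D, F (z, starRingEnd ℂ z) = p z := by
  induction hp using Submodule.span_induction with
  | mem p hp =>
    obtain ⟨c, j, k, h, rfl⟩ := hp
    refine ⟨(c / 2) • (fun p => p.1 ^ j * p.2 ^ k) +
      (starRingEnd ℂ c / 2) • (fun p => p.1 ^ k * p.2 ^ j),
      add_mem (Submodule.smul_mem _ _ (Submodule.subset_span ⟨j, k, h, rfl⟩))
        (Submodule.smul_mem _ _ (Submodule.subset_span ⟨k, j, by omega, rfl⟩)), fun z => ?_⟩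
    rw [reMon_apply, Complex.re_eq_add_conj]
    simp only [Pi.add_apply, Pi.smul_apply, smul_eq_mul, map_mul, map_pow, Complex.conj_conj]
    ring
  | zero => exact ⟨0, zero_mem _, fun z => by simp⟩
  | add p q _ _ hp hq =>
    obtain ⟨F, hF, h⟩ := hp
    obtain ⟨G, hG, h'⟩ := hq
    exact ⟨F + G, add_mem hF hG, fun z => by simp [h, h']⟩
  | smul a p _ hp =>
    obtain ⟨F, hF, h⟩ := hp
    exact ⟨(a : ℂ) • F, Submodule.smul_mem _ _ hF, fun z => by simp [h]⟩

theorem cpol_homogenize (A B A' B' : ℂ) {n : ℕ} {F : ℂ × ℂ → ℂ} (hF : F ∈ cpol n) :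
    ∃ h : ℂ → ℂ, Differentiable ℂ h ∧
      ∀ ζ ≠ 0, h ζ = ζ ^ n * F (A * ζ + B / ζ, A' / ζ + B' * ζ) := by
  induction hF using Submodule.span_induction with
  | mem F hF =>
    obtain ⟨j, k, hjk, rfl⟩ := hF
    refine ⟨fun ζ => ζ ^ (n - j - k) * (A * ζ ^ 2 + B) ^ j * (A' + B' * ζ ^ 2) ^ k,
      by fun_prop, fun ζ hζ => ?_⟩
    obtain ⟨m, rfl⟩ := Nat.exists_eq_add_of_le hjk
    have h1 : j + k + m - j - k = m := by omega
    have h2 : A * ζ ^ 2 + B = ζ * (A * ζ + B / ζ) := by field_simp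
    have h3 : A' + B' * ζ ^ 2 = ζ * (A' / ζ + B' * ζ) := by field_simp
    simp only [h1, h2, h3]
    rw [mul_pow, mul_pow]
    ring
  | zero => exact ⟨0, differentiable_const _, fun ζ _ => by simp⟩
  | add F G _ _ hF hG =>
    obtain ⟨h, hd, hF⟩ := hF
    obtain ⟨h', hd', hG⟩ := hG
    refine ⟨h + h', hd.add hd', fun ζ hζ => ?_⟩
    rw [Pi.add_apply, hF ζ hζ, hG ζ hζ, Pi.add_apply, mul_add]
  | smul a F _ hF =>
    obtain ⟨h, hd, hF⟩ := hF
    refine ⟨a • h, hd.const_smul a, fun ζ hζ => ?_⟩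
    rw [Pi.smul_apply, hF ζ hζ, Pi.smul_apply, smul_eq_mul, smul_eq_mul]
    ring

/-- A complex neighbourhood of the closed disk `{(z, conj z) : ‖z‖ ≤ 1}`. -/
def nbhd (ρ : ℝ) : Set (ℂ × ℂ) :=
  {p | ‖(p.1 * ρ - starRingEnd ℂ p.2 / ρ) / (ρ ^ 2 - 1 / ρ ^ 2)‖ +
    ‖(starRingEnd ℂ p.2 * ρ - p.1 / ρ) / (ρ ^ 2 - 1 / ρ ^ 2)‖ < 1}

theorem isOpen_nbhd (ρ : ℝ) : IsOpen (nbhd ρ) := by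
  refine isOpen_lt ?_ continuous_const
  have := Complex.continuous_conj
  fun_prop

theorem ofReal_sq_sub_ne_zero {ρ : ℝ} (h0 : 0 < ρ) (h1 : ρ < 1) :
    (ρ : ℂ) ^ 2 - 1 / (ρ : ℂ) ^ 2 ≠ 0 := by
  have h2 : ρ ^ 2 < 1 := by nlinarith
  have h3 : 1 < 1 / ρ ^ 2 := by rw [lt_div_iff₀ (by positivity)]; linarith
  have h4 : ρ ^ 2 - 1 / ρ ^ 2 ≠ 0 := by linarith
  exact_mod_cast h4

theorem mem_nbhd {ρ : ℝ} (h0 : 0 < ρ) (h1 : ρ < 1) {z : ℂ} (hz : ‖z‖ ≤ 1) :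
    (z, starRingEnd ℂ z) ∈ nbhd ρ := by
  have h := ofReal_sq_sub_ne_zero h0 h1
  have h' : (ρ : ℂ) ≠ 0 := by exact_mod_cast h0.ne'
  have hs : 0 < ρ + 1 / ρ := by positivity
  have hs' : (ρ : ℂ) + 1 / ρ ≠ 0 := by exact_mod_cast hs.ne'
  have e0 : (ρ : ℂ) ^ 2 - 1 / (ρ : ℂ) ^ 2 = (ρ - 1 / ρ) * (ρ + 1 / ρ) := by
    field_simp; ring
  have hd : (ρ : ℂ) - 1 / ρ ≠ 0 := fun h2 => h (by rw [e0, h2, zero_mul])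
  have e1 : (z * ρ - z / ρ) / ((ρ : ℂ) ^ 2 - 1 / (ρ : ℂ) ^ 2) = z / (ρ + 1 / ρ) := by
    rw [e0, div_eq_div_iff (mul_ne_zero hd hs') hs']
    ring
  change ‖_‖ + ‖_‖ < 1
  simp only [Complex.conj_conj]
  rw [e1]
  have e2 : ‖z / ((ρ : ℂ) + 1 / ρ)‖ = ‖z‖ / (ρ + 1 / ρ) := by
    rw [norm_div]
    congr 1
    rw [show (ρ : ℂ) + 1 / ρ = ((ρ + 1 / ρ : ℝ) : ℂ) by push_cast; rfl, Complex.norm_real,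
      Real.norm_of_nonneg hs.le]
  rw [e2]
  have h3 : 2 < ρ + 1 / ρ := by
    have : ρ + 1 / ρ - 2 = (1 - ρ) ^ 2 / ρ := by field_simp; ring
    have : 0 < (1 - ρ) ^ 2 / ρ := div_pos (by nlinarith) h0
    linarith
  rw [← add_div, div_lt_one hs]
  linarith

/-- A Bernstein–Walsh inequality for the disk. -/
theorem norm_le_of_mem_nbhd {ρ : ℝ} (h0 : 0 < ρ) (h1 : ρ < 1) {n : ℕ} {F : ℂ × ℂ → ℂ}
    (hF : F ∈ cpol n) {M : ℝ} (hM : ∀ z : D, ‖F (z, starRingEnd ℂ z)‖ ≤ M) {p : ℂ × ℂ}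
    (hp : p ∈ nbhd ρ) : ‖F p‖ ≤ M * (ρ⁻¹) ^ n := by
  have hne := ofReal_sq_sub_ne_zero h0 h1
  have hρ : (ρ : ℂ) ≠ 0 := by exact_mod_cast h0.ne'
  obtain ⟨Z, W⟩ := p
  set A : ℂ := (Z * ρ - starRingEnd ℂ W / ρ) / (ρ ^ 2 - 1 / ρ ^ 2) with hA
  set B : ℂ := (starRingEnd ℂ W * ρ - Z / ρ) / (ρ ^ 2 - 1 / ρ ^ 2) with hB
  have hAB : ‖A‖ + ‖B‖ < 1 := hp
  obtain ⟨h, hd, hh⟩ := cpol_homogenize A B (starRingEnd ℂ A) (starRingEnd ℂ B) hF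
  have eA : A * (ρ ^ 2 - 1 / ρ ^ 2) = Z * ρ - starRingEnd ℂ W / ρ := div_mul_cancel₀ _ hne
  have eB : B * (ρ ^ 2 - 1 / ρ ^ 2) = starRingEnd ℂ W * ρ - Z / ρ := div_mul_cancel₀ _ hne
  clear_value A B
  have hZ : A * ρ + B / ρ = Z := by
    apply mul_right_cancel₀ hne
    calc _ = A * (ρ ^ 2 - 1 / ρ ^ 2) * ρ + B * (ρ ^ 2 - 1 / ρ ^ 2) / ρ := by ring
      _ = _ := by rw [eA, eB]; field_simp; ring
  have hW' : A / ρ + B * ρ = starRingEnd ℂ W := by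
    apply mul_right_cancel₀ hne
    calc _ = A * (ρ ^ 2 - 1 / ρ ^ 2) / ρ + B * (ρ ^ 2 - 1 / ρ ^ 2) * ρ := by ring
      _ = _ := by rw [eA, eB]; field_simp; ring
  have hW : starRingEnd ℂ A / ρ + starRingEnd ℂ B * ρ = W := by
    have := congrArg (starRingEnd ℂ) hW'
    simpa using this
  have hbd : ∀ ζ ∈ frontier (ball (0 : ℂ) 1), ‖h ζ‖ ≤ M := by
    intro ζ hζ
    rw [frontier_ball _ one_ne_zero, mem_sphere_zero_iff_norm] at hζ
    have hζ0 : ζ ≠ 0 := norm_pos_iff.1 (by rw [hζ]; exact one_pos)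
    rw [hh ζ hζ0, norm_mul, norm_pow, hζ, one_pow, one_mul]
    have hz : ‖A * ζ + B / ζ‖ ≤ 1 := by
      refine (norm_add_le _ _).trans ?_
      rw [norm_mul, norm_div, hζ, mul_one, div_one]
      exact hAB.le
    have hconj : starRingEnd ℂ ζ = ζ⁻¹ := by
      rw [Complex.inv_def, Complex.normSq_eq_norm_sq, hζ]; simp
    have := hM ⟨A * ζ + B / ζ, mem_closedBall_zero_iff.2 hz⟩
    simp only [map_add, map_mul, map_div₀, hconj] at this
    rwa [div_inv_eq_mul, ← div_eq_mul_inv] at this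
  have hmax := Complex.norm_le_of_forall_mem_frontier_norm_le isBounded_ball
    hd.diffContOnCl hbd (z := (ρ : ℂ)) (subset_closure (by
      rw [mem_ball_zero_iff, Complex.norm_real, Real.norm_of_nonneg h0.le]; exact h1))
  rw [hh _ hρ, hZ, hW, norm_mul, norm_pow, Complex.norm_real, Real.norm_of_nonneg h0.le] at hmax
  rw [inv_pow, ← div_eq_mul_inv, le_div_iff₀ (by positivity)]
  linarith

theorem exists_curry_of_mem_cpol {n : ℕ} {F : ℂ × ℂ → ℂ} (hF : F ∈ cpol n) (S : Set ℂ)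
    [CompactSpace S] :
    ∃ Φ : ℂ → C(S, ℂ), Differentiable ℂ Φ ∧ ∀ s, ∀ t : S, Φ s t = F (s, t) := by
  induction hF using Submodule.span_induction with
  | mem F hF =>
    obtain ⟨j, k, -, rfl⟩ := hF
    refine ⟨fun s => s ^ j • (⟨fun t => (t : ℂ) ^ k, by fun_prop⟩ : C(S, ℂ)), ?_, fun s t => rfl⟩
    exact Differentiable.smul_const (differentiable_pow j) _
  | zero => exact ⟨0, differentiable_const _, fun s t => rfl⟩
  | add F G _ _ hF hG =>
    obtain ⟨Φ, hd, hF⟩ := hF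
    obtain ⟨Ψ, hd', hG⟩ := hG
    exact ⟨Φ + Ψ, hd.add hd', fun s t => by simp [hF, hG]⟩
  | smul a F _ hF =>
    obtain ⟨Φ, hd, hF⟩ := hF
    exact ⟨a • Φ, hd.const_smul a, fun s t => by simp [hF]⟩

theorem differentiable_of_mem_cpol {n : ℕ} {F : ℂ × ℂ → ℂ} (hF : F ∈ cpol n) :
    Differentiable ℂ F := by
  induction hF using Submodule.span_induction with
  | mem F hF =>
    obtain ⟨j, k, -, rfl⟩ := hF
    fun_prop
  | zero => exact differentiable_const _
  | add F G _ _ hF hG => exact hF.add hG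
  | smul a F _ hF => exact hF.const_smul a

/-- Integration over a circle, as a continuous linear functional. -/
theorem exists_circleIntegral_clm (c : ℂ) {R : ℝ} (hR : 0 < R) :
    ∃ L : C(sphere c R, ℂ) →L[ℂ] ℂ, ∀ (f : C(sphere c R, ℂ)) (g : ℂ → ℂ),
      (∀ t : sphere c R, f t = g t) → L f = (2 * Real.pi * I)⁻¹ • ∮ z in C(c, R), g z := by
  set γ : ℝ → sphere c R := fun θ => ⟨circleMap c R θ, circleMap_mem_sphere c hR.le θ⟩
  have hγ : Continuous γ := (continuous_circleMap c R).subtype_mk _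
  have h_integrable : ∀ f : C(sphere c R, ℂ), IntervalIntegrable
      (fun θ => deriv (circleMap c R) θ • f (γ θ)) volume 0 (2 * Real.pi) := fun f => by
    refine Continuous.intervalIntegrable ?_ _ _
    simp only [deriv_circleMap]
    have := continuous_circleMap 0 R
    fun_prop
  let L₀ : C(sphere c R, ℂ) →ₗ[ℂ] ℂ :=
    { toFun := fun f => ∫ θ in (0)..(2 * Real.pi), deriv (circleMap c R) θ • f (γ θ)
      map_add' := fun f g => by
        rw [← intervalIntegral.integral_add (h_integrable f) (h_integrable g)]
        simp only [ContinuousMap.add_apply, smul_add]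
      map_smul' := fun a f => by
        rw [RingHom.id_apply, ← intervalIntegral.integral_smul]
        refine intervalIntegral.integral_congr fun θ _ => ?_
        simp only [ContinuousMap.smul_apply, smul_eq_mul]
        ring }
  have hL₀ : ∀ f, ‖L₀ f‖ ≤ (R * |2 * Real.pi - 0|) * ‖f‖ := fun f => by
    have := intervalIntegral.norm_integral_le_of_norm_le_const (a := 0) (b := 2 * Real.pi)
      (C := R * ‖f‖) (f := fun θ => deriv (circleMap c R) θ • f (γ θ)) (fun θ _ => by
        rw [norm_smul]
        refine mul_le_mul ?_ (f.norm_coe_le_norm _) (norm_nonneg _) hR.le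
        simp [deriv_circleMap, circleMap, abs_of_pos hR])
    refine this.trans_eq (by ring)
  refine ⟨(2 * Real.pi * I : ℂ)⁻¹ • L₀.mkContinuous _ hL₀, fun f g h => ?_⟩
  change (2 * Real.pi * I : ℂ)⁻¹ • L₀ f = _
  congr 1
  change ∫ θ in (0)..(2 * Real.pi), deriv (circleMap c R) θ • f (γ θ) = _
  rw [circleIntegral]
  exact intervalIntegral.integral_congr fun θ _ => by simp only [h]; rfl

/-- A uniformly convergent series of polynomials in two complex variables is analytic. -/
theorem analyticAt_tsum_cpol {U : Set (ℂ × ℂ)} (hU : IsOpen U) {d : ℕ → ℂ × ℂ → ℂ} {n : ℕ → ℕ}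
    (hd : ∀ i, d i ∈ cpol (n i)) {c : ℕ → ℝ} (hc : Summable c)
    (hdc : ∀ i, ∀ p ∈ U, ‖d i p‖ ≤ c i) {p : ℂ × ℂ} (hp : p ∈ U) :
    AnalyticAt ℂ (fun q => ∑' i, d i q) p := by
  obtain ⟨a, b⟩ := p
  obtain ⟨r, hr, hrU⟩ : ∃ r > 0, closedBall a r ×ˢ closedBall b r ⊆ U := by
    obtain ⟨ε, hε, h⟩ := Metric.nhds_basis_closedBall.mem_iff.1 (hU.mem_nhds hp)
    exact ⟨ε, hε, by rwa [closedBall_prod_same]⟩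
  have hcs : CompactSpace (sphere b r) := isCompact_iff_compactSpace.1 (isCompact_sphere b r)
  choose Φ hΦd hΦ using fun i => exists_curry_of_mem_cpol (hd i) (sphere b r)
  obtain ⟨L, hL⟩ := exists_circleIntegral_clm b hr
  have hΦc : ∀ i, ∀ s ∈ ball a r, ‖Φ i s‖ ≤ c i := fun i s hs => by
    rw [ContinuousMap.norm_le _ ((norm_nonneg _).trans (hdc i _ hp))]
    intro t
    rw [hΦ]
    exact hdc i _ (hrU ⟨ball_subset_closedBall hs, sphere_subset_closedBall t.2⟩)
  have hΦa : AnalyticAt ℂ (fun s => ∑' i, Φ i s) a :=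
    (differentiableOn_tsum_of_summable_norm hc (fun i => (hΦd i).differentiableOn) isOpen_ball
      hΦc).analyticAt (ball_mem_nhds a hr)
  set ι : C(sphere b r, ℂ) := ⟨fun t => t, continuous_subtype_val⟩
  set κ : ℂ → C(sphere b r, ℂ) := fun t => Ring.inverse (ι - algebraMap ℂ _ t)
  have hunit : ∀ t ∈ ball b r, IsUnit (ι - algebraMap ℂ C(sphere b r, ℂ) t) := fun t ht => by
    rw [ContinuousMap.isUnit_iff_forall_ne_zero]
    intro τ h
    have h1 : (τ : ℂ) - t = 0 := h
    have h2 : ((τ : ℂ)) = t := sub_eq_zero.1 h1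
    have h3 := τ.2
    rw [h2, mem_sphere] at h3
    rw [mem_ball, h3] at ht
    exact lt_irrefl _ ht
  have hκ : ∀ t ∈ ball b r, ∀ τ : sphere b r, κ t τ = ((τ : ℂ) - t)⁻¹ := fun t ht τ => by
    have h1 := congrArg (fun f : C(sphere b r, ℂ) => f τ) (Ring.inverse_mul_cancel _ (hunit t ht))
    exact eq_inv_of_mul_eq_one_left h1
  have hκa : AnalyticAt ℂ κ b := by
    have hb := hunit b (mem_ball_self hr)
    refine AnalyticAt.fun_comp (g := Ring.inverse) (f := fun t => ι - algebraMap ℂ _ t) ?_ ?_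
    · have := analyticAt_inverse (𝕜 := ℂ) hb.unit
      rwa [IsUnit.unit_spec] at this
    · exact analyticAt_const.sub ((Algebra.linearMap ℂ C(sphere b r, ℂ)).toContinuousLinearMap.analyticAt b)
  have hmain : AnalyticAt ℂ (fun q : ℂ × ℂ => L ((∑' i, Φ i q.1) * κ q.2)) (a, b) := by
    refine (L.analyticAt _).fun_comp (AnalyticAt.mul ?_ ?_)
    · exact AnalyticAt.fun_comp (g := fun s => ∑' i, Φ i s) hΦa analyticAt_fst
    · exact AnalyticAt.fun_comp (g := κ) hκa analyticAt_snd
  refine hmain.congr ?_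
  have hnhds : ball a r ×ˢ ball b r ∈ 𝓝 (a, b) :=
    prod_mem_nhds (ball_mem_nhds a hr) (ball_mem_nhds b hr)
  filter_upwards [hnhds] with q hq
  obtain ⟨s, t⟩ := q
  obtain ⟨hs, ht⟩ := hq
  simp only at hs ht ⊢
  have hsum : Summable fun i => Φ i s :=
    Summable.of_norm_bounded hc fun i => hΦc i s hs
  rw [← hsum.tsum_mul_right, L.map_tsum (hsum.mul_right _)]
  refine tsum_congr fun i => ?_
  rw [hL _ (fun τ => (τ - t)⁻¹ • d i (s, τ)) fun τ => by
    rw [ContinuousMap.mul_apply, hκ t ht, hΦ, smul_eq_mul, mul_comm]]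
  refine DiffContOnCl.two_pi_i_inv_smul_circleIntegral_sub_inv_smul
    (f := fun τ => d i (s, τ)) ?_ ht
  have := differentiable_of_mem_cpol (hd i)
  exact Differentiable.diffContOnCl (by fun_prop)

theorem exists_analytic_extension {b : ℕ} {u : C(D, ℝ)} (hu : u = green (wt b * u ^ 3)) :
    ∃ v : ℝ × ℝ → ℝ, (∃ U, IsOpen U ∧ (∀ z : D, ((z : ℂ).re, (z : ℂ).im) ∈ U) ∧
      AnalyticOnNhd ℝ v U) ∧ ∀ z : D, v ((z : ℂ).re, (z : ℂ).im) = u z := by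
  obtain ⟨ν, hν, B, h⟩ := exists_geometric_approx hu
  choose p hp hpB using h
  have hν0 : 0 < ν := one_pos.trans hν
  set d : ℕ → C(D, ℝ) := fun i => p (i + 1) - p i
  have hd : ∀ i, d i ∈ pol (i + 1) := fun i => sub_mem (hp _) (pol_mono (by omega) (hp _))
  have hpB' : ∀ n, ‖u - p n‖ ≤ B * (ν⁻¹) ^ n := fun n => by
    rw [inv_pow, ← div_eq_mul_inv, le_div_iff₀ (by positivity)]
    exact hpB n
  have hB0 : 0 ≤ B := (by positivity : (0 : ℝ) ≤ ‖u - p 0‖ * ν ^ 0).trans (hpB 0)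
  have hdB : ∀ i, ‖d i‖ ≤ 2 * B * (ν⁻¹) ^ i := fun i => by
    have h1 : d i = (u - p i) - (u - p (i + 1)) := by simp only [d]; abel
    rw [h1]
    refine (norm_sub_le _ _).trans ?_
    have h2 : (ν⁻¹) ^ (i + 1) ≤ (ν⁻¹) ^ i :=
      pow_le_pow_of_le_one (by positivity) (inv_le_one_of_one_le₀ hν.le) (by omega)
    have h3 := mul_le_mul_of_nonneg_left h2 hB0
    have h4 := hpB' i
    have h5 := hpB' (i + 1)
    linarith
  choose F hF hFd using fun i => exists_cpol_of_mem_pol (hd i)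
  obtain ⟨F₀, hF₀, hFp⟩ := exists_cpol_of_mem_pol (hp 0)
  obtain ⟨ρ, hρν, hρ1⟩ := exists_between (inv_lt_one_of_one_lt₀ hν)
  have hρ0 : 0 < ρ := (by positivity : 0 < ν⁻¹).trans hρν
  have hFU : ∀ i, ∀ q ∈ nbhd ρ, ‖F i q‖ ≤ 2 * B * ρ⁻¹ * (ν⁻¹ * ρ⁻¹) ^ i := fun i q hq => by
    refine (norm_le_of_mem_nbhd hρ0 hρ1 (hF i) (M := 2 * B * (ν⁻¹) ^ i) (fun z => ?_) hq).trans_eq ?_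
    · rw [hFd, Complex.norm_real]
      exact ((d i).norm_coe_le_norm z).trans (hdB i)
    · rw [pow_succ, mul_pow]; ring
  have hlt : ν⁻¹ * ρ⁻¹ < 1 := by
    rw [← div_eq_mul_inv, div_lt_one hρ0]; exact hρν
  have hsum : Summable fun i : ℕ => 2 * B * ρ⁻¹ * (ν⁻¹ * ρ⁻¹) ^ i :=
    (summable_geometric_of_lt_one (by positivity) hlt).mul_left _
  have hGa : ∀ q ∈ nbhd ρ, AnalyticAt ℂ (fun q => F₀ q + ∑' i, F i q) q := fun q hq => by
    refine AnalyticAt.add ?_ (analyticAt_tsum_cpol (isOpen_nbhd ρ) hF hsum hFU hq)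
    clear hFp
    induction hF₀ using Submodule.span_induction with
    | mem F hF =>
      obtain ⟨j, k, -, rfl⟩ := hF
      exact (analyticAt_fst.pow j).mul (analyticAt_snd.pow k)
    | zero => exact analyticAt_const
    | add F G _ _ hF hG => exact hF.add hG
    | smul a F _ hF => exact analyticAt_const.smul hF
  set G : ℂ × ℂ → ℂ := fun q => F₀ q + ∑' i, F i q
  set T : ℝ × ℝ →L[ℝ] ℂ × ℂ :=
    (Complex.equivRealProdCLM.symm : ℝ × ℝ →L[ℝ] ℂ).prod
      ((Complex.conjCLE : ℂ →L[ℝ] ℂ) ∘L (Complex.equivRealProdCLM.symm : ℝ × ℝ →L[ℝ] ℂ)) with hT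
  have hTz : ∀ z : ℂ, T (z.re, z.im) = (z, starRingEnd ℂ z) := fun z => by
    have h1 : Complex.equivRealProdCLM.symm (z.re, z.im) = z :=
      Complex.equivRealProdCLM.symm_apply_apply z
    simp [hT, h1]
  refine ⟨fun q => (G (T q)).re, ⟨T ⁻¹' nbhd ρ, (isOpen_nbhd ρ).preimage T.continuous,
    fun z => ?_, fun q hq => ?_⟩, fun z => ?_⟩
  · rw [mem_preimage, hTz]
    exact mem_nbhd hρ0 hρ1 z.norm_le
  · exact (Complex.reCLM.analyticAt _).fun_comp
      (((hGa _ hq).restrictScalars (𝕜 := ℝ)).fun_comp (T.analyticAt q))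
  · have h1 : HasSum (fun i => F i (z, starRingEnd ℂ z)) ((u z - p 0 z : ℝ) : ℂ) := by
      have hs : Summable fun i => F i ((z : ℂ), starRingEnd ℂ (z : ℂ)) :=
        Summable.of_norm_bounded hsum fun i => hFU i _ (mem_nbhd hρ0 hρ1 z.norm_le)
      rw [hs.hasSum_iff_tendsto_nat]
      simp only [hFd]
      have h2 : ∀ n, ∑ i ∈ Finset.range n, ((d i z : ℝ) : ℂ) = ((p n z - p 0 z : ℝ) : ℂ) := by
        intro n
        rw [← Complex.ofReal_sum]
        congr 1
        exact Finset.sum_range_sub (fun i => p i z) n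
      simp only [h2]
      refine (Complex.continuous_ofReal.tendsto _).comp (Tendsto.sub_const ?_ _)
      rw [tendsto_iff_norm_sub_tendsto_zero]
      refine squeeze_zero (fun _ => norm_nonneg _) (fun n => ?_)
        (g := fun n => B * (ν⁻¹) ^ n) ?_
      · rw [norm_sub_rev]
        exact ((u - p n).norm_coe_le_norm z).trans (hpB' n)
      · have := (tendsto_pow_atTop_nhds_zero_of_lt_one (by positivity)
          (inv_lt_one_of_one_lt₀ hν)).const_mul B
        rwa [mul_zero] at this
    simp only [hTz, G, h1.tsum_eq, hFp]
    rw [← Complex.ofReal_add, Complex.ofReal_re]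
    ring

end Henon

namespace Henon

open Complex Metric Set Filter Topology

open scoped ContDiff

section dir

variable {E : Type*} [NormedAddCommGroup E] [NormedSpace ℝ E]

/-- The directional derivative. -/
noncomputable def dir (e : ℝ × ℝ) (f : ℝ × ℝ → E) (p : ℝ × ℝ) : E := fderiv ℝ f p e

/-- The Laplacian as a sum of iterated directional derivatives. -/
noncomputable def lapl (f : ℝ × ℝ → E) (p : ℝ × ℝ) : E :=
  dir (1, 0) (dir (1, 0) f) p + dir (0, 1) (dir (0, 1) f) p

theorem contDiff_dir {f : ℝ × ℝ → E} (hf : ContDiff ℝ ∞ f) (e : ℝ × ℝ) : ContDiff ℝ ∞ (dir e f) :=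
  (hf.fderiv_right (m := ∞) (by simp)).clm_apply contDiff_const

theorem contDiff_lapl {f : ℝ × ℝ → E} (hf : ContDiff ℝ ∞ f) : ContDiff ℝ ∞ (lapl f) :=
  (contDiff_dir (contDiff_dir hf _) _).add (contDiff_dir (contDiff_dir hf _) _)

theorem hasCompactSupport_dir {f : ℝ × ℝ → E} (hf : HasCompactSupport f) (e : ℝ × ℝ) :
    HasCompactSupport (dir e f) :=
  hf.fderiv_apply ℝ e

theorem dir_add {f g : ℝ × ℝ → E} (hf : ContDiff ℝ ∞ f) (hg : ContDiff ℝ ∞ g) (e : ℝ × ℝ) :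
    dir e (f + g) = dir e f + dir e g := by
  ext p
  simp only [dir, Pi.add_apply]
  rw [fderiv_add (hf.differentiable (by simp) p) (hg.differentiable (by simp) p)]
  rfl

theorem dir_const_smul {f : ℝ × ℝ → E} (a : ℝ) (e : ℝ × ℝ) :
    dir e (a • f) = a • dir e f := by
  ext p
  simp only [dir, Pi.smul_apply]
  rw [fderiv_const_smul_field]
  rfl

theorem lapl_add {f g : ℝ × ℝ → E} (hf : ContDiff ℝ ∞ f) (hg : ContDiff ℝ ∞ g) :
    lapl (f + g) = lapl f + lapl g := by
  ext p
  simp only [lapl, dir_add hf hg, dir_add (contDiff_dir hf _) (contDiff_dir hg _), Pi.add_apply]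
  abel

theorem lapl_const_smul {f : ℝ × ℝ → E} (a : ℝ) :
    lapl (a • f) = a • lapl f := by
  ext p
  simp only [lapl, dir_const_smul, Pi.smul_apply, smul_add]

theorem dir_mul {f g : ℝ × ℝ → ℝ} (hf : ContDiff ℝ ∞ f) (hg : ContDiff ℝ ∞ g) (e : ℝ × ℝ) :
    dir e (f * g) = f * dir e g + dir e f * g := by
  ext p
  simp only [dir, Pi.add_apply, Pi.mul_apply]
  rw [fderiv_mul (hf.differentiable (by simp) p) (hg.differentiable (by simp) p)]
  simp only [_root_.add_apply, _root_.smul_apply, smul_eq_mul]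
  ring

theorem tsupport_dir_subset (f : ℝ × ℝ → E) (e : ℝ × ℝ) : tsupport (dir e f) ⊆ tsupport f :=
  closure_minimal (fun p hp => by
    refine support_fderiv_subset ℝ (f := f) ?_
    rw [Function.mem_support] at hp ⊢
    intro h
    exact hp (by rw [dir, h]; rfl)) isClosed_closure

theorem dir_congr_of_eqOn {f g : ℝ × ℝ → E} {U : Set (ℝ × ℝ)} (hU : IsOpen U) (h : EqOn f g U)
    (e : ℝ × ℝ) : EqOn (dir e f) (dir e g) U := fun p hp => by
  rw [dir, dir, Filter.EventuallyEq.fderiv_eq (h.eventuallyEq_of_mem (hU.mem_nhds hp))]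

theorem dir_clm_comp {F : Type*} [NormedAddCommGroup F] [NormedSpace ℝ F] (L : E →L[ℝ] F)
    {f : ℝ × ℝ → E} (hf : ContDiff ℝ ∞ f) (e : ℝ × ℝ) :
    dir e (fun p => L (f p)) = fun p => L (dir e f p) := by
  ext p
  exact congrArg (fun T : ℝ × ℝ →L[ℝ] F => T e)
    ((L.hasFDerivAt.comp p (hf.differentiable (by simp) p).hasFDerivAt).fderiv)

end dir

theorem deriv_fst {f : ℝ × ℝ → ℝ} (hf : ContDiff ℝ ∞ f) (x y : ℝ) :
    deriv (fun x => f (x, y)) x = dir (1, 0) f (x, y) := by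
  have h1 := (hf.differentiable (by simp) (x, y)).hasFDerivAt
  have h2 : HasDerivAt (fun x : ℝ => (x, y)) ((1 : ℝ), (0 : ℝ)) x :=
    (hasDerivAt_id x).prodMk (hasDerivAt_const x y)
  exact (h1.comp_hasDerivAt x h2).deriv

theorem deriv_snd {f : ℝ × ℝ → ℝ} (hf : ContDiff ℝ ∞ f) (x y : ℝ) :
    deriv (fun y => f (x, y)) y = dir (0, 1) f (x, y) := by
  have h1 := (hf.differentiable (by simp) (x, y)).hasFDerivAt
  have h2 : HasDerivAt (fun y : ℝ => (x, y)) ((0 : ℝ), (1 : ℝ)) y :=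
    (hasDerivAt_const y x).prodMk (hasDerivAt_id y)
  exact (h1.comp_hasDerivAt y h2).deriv

theorem lap_eq_lapl {f : ℝ × ℝ → ℝ} (hf : ContDiff ℝ ∞ f) (p : ℝ × ℝ) : lap f p = lapl f p := by
  simp only [lap, lapl, deriv_fst hf, deriv_snd hf, deriv_fst (contDiff_dir hf _),
    deriv_snd (contDiff_dir hf _)]

theorem gradSq_eq {f : ℝ × ℝ → ℝ} (hf : ContDiff ℝ ∞ f) (p : ℝ × ℝ) :
    gradSq f p = dir (1, 0) f p ^ 2 + dir (0, 1) f p ^ 2 := by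
  simp only [gradSq, deriv_fst hf, deriv_snd hf]

theorem integral_mul_dir {f g : ℝ × ℝ → ℝ} (hf : ContDiff ℝ ∞ f) (hg : ContDiff ℝ ∞ g)
    (hc : HasCompactSupport g) (e : ℝ × ℝ) :
    ∫ p, f p * dir e g p = -∫ p, dir e f p * g p := by
  refine integral_mul_fderiv_eq_neg_fderiv_mul_of_integrable ?_ ?_ ?_
    (fun p _ => hf.differentiable (by simp) p) (fun p _ => hg.differentiable (by simp) p)
  · exact ((contDiff_dir hf e).continuous.mul hg.continuous).integrable_of_hasCompactSupport
      hc.mul_left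
  · exact (hf.continuous.mul (contDiff_dir hg e).continuous).integrable_of_hasCompactSupport
      (hasCompactSupport_dir hc e).mul_left
  · exact (hf.continuous.mul hg.continuous).integrable_of_hasCompactSupport hc.mul_left

/-- Green's first identity. -/
theorem integral_grad_mul_grad {f g : ℝ × ℝ → ℝ} (hf : ContDiff ℝ ∞ f) (hg : ContDiff ℝ ∞ g)
    (hc : HasCompactSupport g) :
    ∫ p, (dir (1, 0) f p * dir (1, 0) g p + dir (0, 1) f p * dir (0, 1) g p) =
      -∫ p, lapl f p * g p := by
  have hi : ∀ e, Integrable fun p => dir e f p * dir e g p := fun e =>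
    ((contDiff_dir hf e).continuous.mul (contDiff_dir hg e).continuous).integrable_of_hasCompactSupport
      (hasCompactSupport_dir hc e).mul_left
  have hi' : ∀ e, Integrable fun p => dir e (dir e f) p * g p := fun e =>
    ((contDiff_dir (contDiff_dir hf e) e).continuous.mul
      hg.continuous).integrable_of_hasCompactSupport hc.mul_left
  rw [integral_add (hi _) (hi _), integral_mul_dir (contDiff_dir hf _) hg hc,
    integral_mul_dir (contDiff_dir hf _) hg hc, ← neg_add, ← integral_add (hi' _) (hi' _)]
  simp only [lapl, add_mul]

theorem integral_grad_mul_grad' {f g : ℝ × ℝ → ℝ} (hf : ContDiff ℝ ∞ f) (hg : ContDiff ℝ ∞ g)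
    (hc : HasCompactSupport g) :
    ∫ p, (dir (1, 0) f p * dir (1, 0) g p + dir (0, 1) f p * dir (0, 1) g p) =
      -∫ p, f p * lapl g p := by
  have hi : ∀ e, Integrable fun p => dir e f p * dir e g p := fun e =>
    ((contDiff_dir hf e).continuous.mul (contDiff_dir hg e).continuous).integrable_of_hasCompactSupport
      (hasCompactSupport_dir hc e).mul_left
  have hi' : ∀ e, Integrable fun p => f p * dir e (dir e g) p := fun e =>
    (hf.continuous.mul (contDiff_dir (contDiff_dir hg e) e).continuous).integrable_of_hasCompactSupport
      (hasCompactSupport_dir (hasCompactSupport_dir hc e) e).mul_left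
  have h : ∀ e, ∫ p, dir e f p * dir e g p = -∫ p, f p * dir e (dir e g) p := fun e => by
    rw [integral_mul_dir hf (contDiff_dir hg e) (hasCompactSupport_dir hc e), neg_neg]
  rw [integral_add (hi _) (hi _), h, h, ← neg_add, ← integral_add (hi' _) (hi' _)]
  simp only [lapl, mul_add]

theorem integral_lapl_mul {f g : ℝ × ℝ → ℝ} (hf : ContDiff ℝ ∞ f) (hg : ContDiff ℝ ∞ g)
    (hc : HasCompactSupport g) : ∫ p, lapl f p * g p = ∫ p, f p * lapl g p := by
  rw [← neg_inj, ← integral_grad_mul_grad hf hg hc, integral_grad_mul_grad' hf hg hc]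

/-! ### Transfer between the plane and the closed disk -/

theorem isOpen_unitDisk : IsOpen unitDisk :=
  isOpen_lt (by fun_prop) continuous_const

theorem mem_unitDisk_iff (z : ℂ) : (z.re, z.im) ∈ unitDisk ↔ ‖z‖ < 1 := by
  change z.re ^ 2 + z.im ^ 2 < 1 ↔ _
  rw [← sq_lt_one_iff₀ (norm_nonneg z), ← Complex.normSq_eq_norm_sq, Complex.normSq_apply]
  ring_nf

theorem setIntegral_unitDisk (F : ℝ × ℝ → ℝ) :
    ∫ p in unitDisk, F p = ∫ z : D, F ((z : ℂ).re, (z : ℂ).im) := by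
  rw [integral_D fun z : ℂ => F (z.re, z.im)]
  have h1 := Complex.volume_preserving_equiv_real_prod.setIntegral_preimage_emb
    Complex.measurableEquivRealProd.measurableEmbedding F unitDisk
  have h2 : Complex.measurableEquivRealProd ⁻¹' unitDisk = ball 0 1 := by
    ext z
    rw [mem_ball_zero_iff, ← mem_unitDisk_iff]
    rfl
  rw [← h1, h2]
  refine setIntegral_congr_set ?_
  rw [← sphere_union_ball]
  exact (union_ae_eq_right_of_ae_eq_empty
    (ae_eq_empty.2 (Measure.addHaar_sphere volume (0 : ℂ) 1))).symm

theorem setIntegral_unitDisk_of_tsupport {F : ℝ × ℝ → ℝ} (hF : tsupport F ⊆ unitDisk) :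
    ∫ p in unitDisk, F p = ∫ p, F p :=
  setIntegral_eq_integral_of_forall_compl_eq_zero fun _ hp =>
    image_eq_zero_of_notMem_tsupport fun h => hp (hF h)

/-- The restriction to the closed disk of a function on the plane. -/
noncomputable def toD (F : ℝ × ℝ → ℝ) (hF : Continuous F) : C(D, ℝ) :=
  ⟨fun z => F ((z : ℂ).re, (z : ℂ).im), by fun_prop⟩

theorem integ_toD {F : ℝ × ℝ → ℝ} (hF : Continuous F) :
    integ (toD F hF) = ∫ p in unitDisk, F p := by
  rw [setIntegral_unitDisk]; rfl

/-! ### Polynomial right-hand sides -/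

theorem dir_monomial (Z W : ℝ × ℝ →L[ℝ] ℂ) (j k : ℕ) (e : ℝ × ℝ) (p : ℝ × ℝ) :
    dir e (fun p => Z p ^ j * W p ^ k) p =
      j * Z e * (Z p ^ (j - 1) * W p ^ k) + k * W e * (Z p ^ j * W p ^ (k - 1)) := by
  have h := (Z.hasFDerivAt (x := p).pow j).mul (W.hasFDerivAt (x := p).pow k)
  have h' : HasFDerivAt (fun p => Z p ^ j * W p ^ k) _ p := h
  rw [dir, h'.fderiv]
  simp only [_root_.add_apply, _root_.smul_apply, smul_eq_mul, nsmul_eq_mul]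
  ring

/-- The coordinate `x + i y`. -/
noncomputable def zCLM : ℝ × ℝ →L[ℝ] ℂ := Complex.equivRealProdCLM.symm

/-- The coordinate `x - i y`. -/
noncomputable def wCLM : ℝ × ℝ →L[ℝ] ℂ := (Complex.conjCLE : ℂ →L[ℝ] ℂ) ∘L zCLM

theorem zCLM_apply (z : ℂ) : zCLM (z.re, z.im) = z :=
  Complex.equivRealProdCLM.symm_apply_apply z

theorem wCLM_apply (z : ℂ) : wCLM (z.re, z.im) = starRingEnd ℂ z := by
  simp [wCLM, zCLM_apply]

theorem lapl_monomial (j k : ℕ) (p : ℝ × ℝ) :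
    lapl (fun p => zCLM p ^ j * wCLM p ^ k) p =
      (4 * j * k : ℝ) • (zCLM p ^ (j - 1) * wCLM p ^ (k - 1)) := by
  have hc : ∀ j k : ℕ, ContDiff ℝ ∞ fun p => zCLM p ^ j * wCLM p ^ k := fun j k => by fun_prop
  have h : ∀ e, dir e (fun p => zCLM p ^ j * wCLM p ^ k) = fun p =>
      j * zCLM e * (zCLM p ^ (j - 1) * wCLM p ^ k) +
      k * wCLM e * (zCLM p ^ j * wCLM p ^ (k - 1)) := fun e => by
    ext p
    exact dir_monomial zCLM wCLM j k e p
  have h2 : ∀ e, dir e (dir e (fun p => zCLM p ^ j * wCLM p ^ k)) p =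
      j * zCLM e * dir e (fun p => zCLM p ^ (j - 1) * wCLM p ^ k) p +
      k * wCLM e * dir e (fun p => zCLM p ^ j * wCLM p ^ (k - 1)) p := fun e => by
    rw [h]
    have h3 := dir_clm_comp (ContinuousLinearMap.mul ℝ ℂ (j * zCLM e)) (hc (j - 1) k) e
    have h4 := dir_clm_comp (ContinuousLinearMap.mul ℝ ℂ (k * wCLM e)) (hc j (k - 1)) e
    have h5 := dir_add (f := fun p => ContinuousLinearMap.mul ℝ ℂ (j * zCLM e)
      (zCLM p ^ (j - 1) * wCLM p ^ k)) (g := fun p => ContinuousLinearMap.mul ℝ ℂ (k * wCLM e)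
      (zCLM p ^ j * wCLM p ^ (k - 1))) (by fun_prop) (by fun_prop) e
    rw [h3, h4] at h5
    exact congrFun h5 p
  have e1 : zCLM (1, 0) = 1 := by simpa using zCLM_apply 1
  have e2 : zCLM (0, 1) = I := by simpa using zCLM_apply I
  have e3 : wCLM (1, 0) = 1 := by simpa using wCLM_apply 1
  have e4 : wCLM (0, 1) = -I := by simpa using wCLM_apply I
  rw [lapl, h2, h2]
  simp only [dir_monomial, e1, e2, e3, e4, Complex.real_smul]
  push_cast
  linear_combination (j * ((j - 1 : ℕ) : ℂ) * (zCLM p ^ (j - 1 - 1) * wCLM p ^ k) -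
    2 * j * k * (zCLM p ^ (j - 1) * wCLM p ^ (k - 1)) +
    k * ((k - 1 : ℕ) : ℂ) * (zCLM p ^ j * wCLM p ^ (k - 1 - 1))) * Complex.I_sq

/-- The Poisson equation for polynomial right-hand sides. -/
theorem exists_contDiff_of_mem_pol {n : ℕ} {f : C(D, ℝ)} (hf : f ∈ pol n) :
    ∃ P : ℝ × ℝ → ℝ, ContDiff ℝ ∞ P ∧ (∀ z : D, P ((z : ℂ).re, (z : ℂ).im) = green f z) ∧
      ∀ z : D, -lapl P ((z : ℂ).re, (z : ℂ).im) = f z := by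
  induction hf using Submodule.span_induction with
  | mem f hf =>
    obtain ⟨c, j, k, -, rfl⟩ := hf
    set L : ℂ →L[ℝ] ℝ := Complex.reCLM ∘L ContinuousLinearMap.mul ℝ ℂ c
    have hc : ∀ j k : ℕ, ContDiff ℝ ∞ fun p => zCLM p ^ j * wCLM p ^ k :=
      fun j k => by fun_prop
    have hlap : ∀ j k : ℕ, lapl (fun p => L (zCLM p ^ j * wCLM p ^ k)) =
        fun p => (4 * j * k : ℝ) * L (zCLM p ^ (j - 1) * wCLM p ^ (k - 1)) := fun j k => by
      ext p
      have h1 := lapl_monomial j k p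
      rw [← smul_eq_mul, ← L.map_smul, ← h1, lapl, lapl, map_add]
      simp only [dir_clm_comp L (hc j k), dir_clm_comp L (contDiff_dir (hc j k) _)]
    have hcL : ∀ j k : ℕ, ContDiff ℝ ∞ fun p => L (zCLM p ^ j * wCLM p ^ k) :=
      fun j k => by fun_prop
    have hcs : ContDiff ℝ ∞ ((-1 : ℝ) • fun p => L (zCLM p ^ (j + 1) * wCLM p ^ (k + 1))) :=
      (hcL _ _).const_smul (-1 : ℝ)
    refine ⟨(1 / (4 * (j + 1) * (k + 1)) : ℝ) •
      ((fun p => L (zCLM p ^ (j - k) * wCLM p ^ (k - j))) +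
        (-1 : ℝ) • fun p => L (zCLM p ^ (j + 1) * wCLM p ^ (k + 1))), ?_, fun z => ?_, fun z => ?_⟩
    · exact ((hcL (j - k) (k - j)).add hcs).const_smul (1 / (4 * (j + 1) * (k + 1)) : ℝ)
    · rw [green_reMon]
      simp only [Pi.smul_apply, Pi.add_apply, zCLM_apply, wCLM_apply, smul_eq_mul,
        ContinuousMap.smul_apply, ContinuousMap.sub_apply, reMon_apply]
      change _ * ((c * _).re + -1 * (c * _).re) = _
      ring
    · rw [lapl_const_smul, lapl_add (hcL _ _) hcs, lapl_const_smul, hlap, hlap]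
      simp only [Pi.smul_apply, Pi.add_apply, zCLM_apply, wCLM_apply, smul_eq_mul, reMon_apply]
      have h0 : (4 * ((j - k : ℕ) : ℝ) * ((k - j : ℕ) : ℝ)) = 0 := by
        rcases le_total j k with h | h
        · rw [Nat.sub_eq_zero_of_le h]; simp
        · rw [Nat.sub_eq_zero_of_le h]; simp
      rw [h0]
      simp only [Nat.add_sub_cancel]
      change _ = (c * _).re
      change -(_ * (0 * _ + -1 * (_ * (c * _).re))) = _
      push_cast
      field_simp
      ring
  | zero =>
    refine ⟨0, contDiff_const, fun z => by simp, fun z => ?_⟩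
    have := lapl_const_smul (f := (0 : ℝ × ℝ → ℝ)) 0
    rw [zero_smul, zero_smul] at this
    simp [this]
  | add f g _ _ hf hg =>
    obtain ⟨P, hP, h1, h2⟩ := hf
    obtain ⟨Q, hQ, h3, h4⟩ := hg
    refine ⟨P + Q, hP.add hQ, fun z => ?_, fun z => ?_⟩
    · rw [map_add, Pi.add_apply, h1, h3]; rfl
    · rw [lapl_add hP hQ, Pi.add_apply, neg_add, h2, h4]; rfl
  | smul a f _ hf =>
    obtain ⟨P, hP, h1, h2⟩ := hf
    refine ⟨a • P, hP.const_smul a, fun z => ?_, fun z => ?_⟩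
    · rw [map_smul, Pi.smul_apply, h1]; rfl
    · rw [lapl_const_smul, Pi.smul_apply, ← smul_neg, h2]; rfl

theorem tsupport_lapl_subset (f : ℝ × ℝ → ℝ) : tsupport (lapl f) ⊆ tsupport f := by
  have h : ∀ e, tsupport (dir e (dir e f)) ⊆ tsupport f := fun e =>
    (tsupport_dir_subset _ e).trans (tsupport_dir_subset f e)
  exact (tsupport_add _ _).trans (union_subset (h _) (h _))

theorem integ_toD_of_tsupport {F : ℝ × ℝ → ℝ} (hF : Continuous F) (hs : tsupport F ⊆ unitDisk) :
    integ (toD F hF) = ∫ p, F p := by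
  rw [integ_toD, setIntegral_unitDisk_of_tsupport hs]

/-- Test functions are potentials of their negative Laplacian. -/
theorem green_neg_lapl {v : ℝ × ℝ → ℝ} (hv : ContDiff ℝ ∞ v) (hc : HasCompactSupport v)
    (hs : tsupport v ⊆ unitDisk) :
    green (-toD (lapl v) (contDiff_lapl hv).continuous) = toD v hv.continuous := by
  set g := -toD (lapl v) (contDiff_lapl hv).continuous
  set h := green g - toD v hv.continuous with hh
  have hpol : ∀ r ∈ polAlg, integ (r * h) = 0 := by
    rintro r ⟨n, hr⟩
    obtain ⟨P, hP, h1, h2⟩ := exists_contDiff_of_mem_pol hr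
    have e1 : integ (r * green g) = integ (g * green r) := energy_comm r g
    have e2 : g * green r = -toD (fun p => P p * lapl v p)
        (hP.continuous.mul (contDiff_lapl hv).continuous) := by
      ext z
      change -lapl v _ * green r z = -(P _ * lapl v _)
      rw [← h1]; ring
    have e3 : r * toD v hv.continuous = -toD (fun p => lapl P p * v p)
        ((contDiff_lapl hP).continuous.mul hv.continuous) := by
      ext z
      change r z * v _ = -(lapl P _ * v _)
      rw [← h2]; ring
    rw [hh, mul_sub, map_sub, e1, e2, e3, map_neg, map_neg,
      integ_toD_of_tsupport _ ((tsupport_mul_subset_right).trans ((tsupport_lapl_subset v).trans hs)),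
      integ_toD_of_tsupport _ ((tsupport_mul_subset_right).trans hs), integral_lapl_mul hP hv hc,
      sub_self]
  have hall : ∀ f : C(D, ℝ), integ (f * h) = 0 := by
    have : (fun f : C(D, ℝ) => integ (f * h)) = fun _ => 0 :=
      Continuous.ext_on dense_polAlg (by fun_prop) continuous_const hpol
    exact congrFun this
  have h0 : h * h = 0 := eq_zero_of_integ_eq_zero (fun z => mul_self_nonneg (h z)) (hall h)
  have : h = 0 := by
    ext z
    exact mul_self_eq_zero.1 (congrArg (fun f : C(D, ℝ) => f z) h0)
  exact sub_eq_zero.1 this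

end Henon

namespace Henon

open Complex Metric Set Filter Topology

open scoped ContDiff Manifold

/-- The Hénon weight on the plane. -/
def weight (b : ℕ) (p : ℝ × ℝ) : ℝ := (p.1 ^ 2 + p.2 ^ 2) ^ b

theorem contDiff_weight (b : ℕ) : ContDiff ℝ ∞ (weight b) := by
  unfold weight; fun_prop

theorem weight_nonneg (b : ℕ) (p : ℝ × ℝ) : 0 ≤ weight b p := by
  unfold weight; positivity

theorem weight_eq_wt (b : ℕ) (z : D) : weight b ((z : ℂ).re, (z : ℂ).im) = wt b z := by
  rw [weight, wt_apply, ← Complex.normSq_eq_norm_sq, Complex.normSq_apply]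
  ring_nf

/-- A smooth function on the plane which restricts to the ground state `U` and is real analytic
near the closed disk. -/
structure IsHenonSolution (b : ℕ) (U : C(D, ℝ)) (u : ℝ × ℝ → ℝ) : Prop where
  ground : IsGroundState b U
  smooth : ContDiff ℝ ∞ u
  eq : ∀ z : D, u ((z : ℂ).re, (z : ℂ).im) = U z
  analytic : ∃ O, IsOpen O ∧ closure unitDisk ⊆ O ∧ AnalyticOnNhd ℝ u O

theorem closure_unitDisk_subset : closure unitDisk ⊆ {p : ℝ × ℝ | p.1 ^ 2 + p.2 ^ 2 ≤ 1} :=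
  closure_minimal (fun p (hp : p.1 ^ 2 + p.2 ^ 2 < 1) => hp.le)
    (isClosed_le (by fun_prop) continuous_const)

theorem exists_mem_D {p : ℝ × ℝ} (hp : p.1 ^ 2 + p.2 ^ 2 ≤ 1) :
    ∃ z : D, ((z : ℂ).re, (z : ℂ).im) = p := by
  refine ⟨⟨⟨p.1, p.2⟩, ?_⟩, rfl⟩
  rw [mem_closedBall_zero_iff, ← sq_le_one_iff₀ (norm_nonneg _), ← Complex.normSq_eq_norm_sq,
    Complex.normSq_apply]
  simpa [sq] using hp

theorem exists_isHenonSolution (b : ℕ) : ∃ U u, IsHenonSolution b U u := by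
  obtain ⟨U, hU⟩ := exists_isGroundState b
  obtain ⟨v, ⟨O, hO, hDO, hv⟩, hvU⟩ := exists_analytic_extension hU.eq_green
  set K : Set (ℝ × ℝ) := {p | p.1 ^ 2 + p.2 ^ 2 ≤ 1} with hK
  have hKc : IsClosed K := isClosed_le (by fun_prop) continuous_const
  have hKO : K ⊆ O := fun p hp => by
    obtain ⟨z, rfl⟩ := exists_mem_D hp
    exact hDO z
  obtain ⟨χ, h0, h1, -⟩ := exists_contMDiffMap_zero_one_nhds_of_isClosed (n := (⊤ : ℕ∞)) (I := 𝓘(ℝ, ℝ × ℝ))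
    hO.isClosed_compl hKc (disjoint_compl_left_iff_subset.2 hKO)
  obtain ⟨O₁, hO₁, hKO₁, hχ1⟩ := mem_nhdsSet_iff_exists.1 h1
  have hχ : ContDiff ℝ ∞ χ := χ.contMDiff.contDiff
  refine ⟨U, fun p => χ p * v p, hU, ?_, fun z => ?_, O ∩ O₁, hO.inter hO₁,
    closure_unitDisk_subset.trans (subset_inter hKO hKO₁), fun p hp => ?_⟩
  · rw [contDiff_iff_contDiffAt]
    intro p
    by_cases hp : p ∈ O
    · exact hχ.contDiffAt.mul (hv p hp).contDiffAt
    · have h2 : ∀ᶠ q in 𝓝 p, χ q = 0 := h0.filter_mono (nhds_le_nhdsSet hp)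
      refine (contDiffAt_const (c := (0 : ℝ))).congr_of_eventuallyEq ?_
      filter_upwards [h2] with q hq
      rw [hq, zero_mul]
  · have hz : χ ((z : ℂ).re, (z : ℂ).im) = 1 := by
      refine hχ1 (hKO₁ ?_)
      have := z.norm_le
      rw [← sq_le_one_iff₀ (norm_nonneg _), ← Complex.normSq_eq_norm_sq,
        Complex.normSq_apply] at this
      simpa [hK, sq] using this
    simp only [hz, one_mul, hvU]
  · refine (hv p hp.1).congr ?_
    filter_upwards [hO₁.mem_nhds hp.2] with q hq
    have : χ q = 1 := hχ1 hq
    rw [this, one_mul]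

namespace IsHenonSolution

variable {b : ℕ} {U : C(D, ℝ)} {u : ℝ × ℝ → ℝ}

theorem integ_cube_mul (hu : IsHenonSolution b U u) {v : ℝ × ℝ → ℝ} (hv : Continuous v) :
    integ (wt b * U ^ 3 * toD v hv) = ∫ p in unitDisk, weight b p * u p ^ 3 * v p := by
  have : wt b * U ^ 3 * toD v hv = toD (fun p => weight b p * u p ^ 3 * v p)
      (((contDiff_weight b).continuous.mul (hu.smooth.continuous.pow 3)).mul hv) := by
    ext z
    change wt b z * U z ^ 3 * v _ = weight b _ * u _ ^ 3 * v _
    rw [weight_eq_wt, hu.eq]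
  rw [this, integ_toD]

theorem integral_eq_zero (hu : IsHenonSolution b U u)
    {v : ℝ × ℝ → ℝ} (hv : ContDiff ℝ ∞ v) (hc : HasCompactSupport v)
    (hs : tsupport v ⊆ unitDisk) : ∫ p, v p * (lapl u p + weight b p * u p ^ 3) = 0 := by
  have h1 := energy_comm (-toD (lapl v) (contDiff_lapl hv).continuous) (wt b * U ^ 3)
  rw [energy, energy, green_neg_lapl hv hc hs, ← hu.ground.eq_green, hu.integ_cube_mul,
    setIntegral_unitDisk_of_tsupport (tsupport_mul_subset_right.trans hs)] at h1
  have h2 : -toD (lapl v) (contDiff_lapl hv).continuous * U =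
      -toD (fun p => u p * lapl v p) (hu.smooth.continuous.mul (contDiff_lapl hv).continuous) := by
    ext z
    change -lapl v _ * U z = -(u _ * lapl v _)
    rw [hu.eq]; ring
  rw [h2, map_neg, integ_toD_of_tsupport _
    ((tsupport_mul_subset_right).trans ((tsupport_lapl_subset v).trans hs)),
    ← integral_lapl_mul hu.smooth hv hc] at h1
  have i1 : Integrable fun p => lapl u p * v p :=
    ((contDiff_lapl hu.smooth).continuous.mul hv.continuous).integrable_of_hasCompactSupport
      hc.mul_left
  have i2 : Integrable fun p => weight b p * u p ^ 3 * v p :=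
    (((contDiff_weight b).continuous.mul (hu.smooth.continuous.pow 3)).mul
      hv.continuous).integrable_of_hasCompactSupport hc.mul_left
  have h3 : ∀ p, v p * (lapl u p + weight b p * u p ^ 3) =
      lapl u p * v p + weight b p * u p ^ 3 * v p := fun p => by ring
  simp only [h3]
  rw [integral_add i1 i2, ← h1]
  ring

theorem lapl_eq (hu : IsHenonSolution b U u)
    {p : ℝ × ℝ} (hp : p ∈ unitDisk) : lapl u p = -(weight b p * u p ^ 3) := by
  have hcont : Continuous fun p => lapl u p + weight b p * u p ^ 3 :=
    (contDiff_lapl hu.smooth).continuous.add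
      ((contDiff_weight b).continuous.mul (hu.smooth.continuous.pow 3))
  have h := isOpen_unitDisk.ae_eq_zero_of_integral_contDiff_smul_eq_zero
    (hcont.locallyIntegrable.locallyIntegrableOn _) (fun v hv hc hs => hu.integral_eq_zero hv hc hs)
  have h2 := Measure.eqOn_open_of_ae_eq (f := fun p => lapl u p + weight b p * u p ^ 3)
    (g := fun _ => 0) ((ae_restrict_iff' isOpen_unitDisk.measurableSet).2 h) isOpen_unitDisk
    hcont.continuousOn continuousOn_const hp
  have h3 : lapl u p + weight b p * u p ^ 3 = 0 := h2
  linarith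

theorem pos (hu : IsHenonSolution b U u) {p : ℝ × ℝ} (hp : p ∈ unitDisk) : 0 < u p := by
  obtain ⟨z, rfl⟩ := exists_mem_D (le_of_lt hp)
  rw [hu.eq]
  exact hu.ground.pos ((mem_unitDisk_iff _).1 hp)

theorem boundary (hu : IsHenonSolution b U u)
    {p : ℝ × ℝ} (hp : p.1 ^ 2 + p.2 ^ 2 = 1) : u p = 0 := by
  obtain ⟨z, rfl⟩ := exists_mem_D hp.le
  rw [hu.eq]
  refine hu.ground.boundary ?_
  rw [← sq_eq_sq₀ (norm_nonneg _) zero_le_one, ← Complex.normSq_eq_norm_sq,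
        Complex.normSq_apply, one_pow]
  simpa [sq] using hp

theorem qform_eq (hu : IsHenonSolution b U u)
    {v : ℝ × ℝ → ℝ} (hv : ContDiff ℝ ∞ v) (hc : HasCompactSupport v)
    (hs : tsupport v ⊆ unitDisk) :
    qform (weight b) u v = -(∫ p, lapl v p * v p) -
      3 * ∫ p in unitDisk, weight b p * u p ^ 2 * v p ^ 2 := by
  have i1 : Integrable (gradSq v) := by
    have : gradSq v = fun p => dir (1, 0) v p * dir (1, 0) v p + dir (0, 1) v p * dir (0, 1) v p := by
      ext p; rw [gradSq_eq hv]; ring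
    rw [this]
    exact (((contDiff_dir hv _).continuous.mul (contDiff_dir hv _).continuous).integrable_of_hasCompactSupport
      (hasCompactSupport_dir hc _).mul_left).add (((contDiff_dir hv _).continuous.mul
      (contDiff_dir hv _).continuous).integrable_of_hasCompactSupport
      (hasCompactSupport_dir hc _).mul_left)
  have i2 : Integrable fun p => weight b p * u p ^ 2 * v p ^ 2 := by
    have : (fun p => weight b p * u p ^ 2 * v p ^ 2) =
        fun p => (weight b p * u p ^ 2 * v p) * v p := by ext p; ring
    rw [this]
    exact (((contDiff_weight b).continuous.mul (hu.smooth.continuous.pow 2)).mul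
      hv.continuous).mul hv.continuous |>.integrable_of_hasCompactSupport hc.mul_left
  have h1 : ∀ p, gradSq v p - 3 * weight b p * u p ^ 2 * v p ^ 2 =
      gradSq v p - 3 * (weight b p * u p ^ 2 * v p ^ 2) := fun p => by ring
  rw [qform]
  simp only [h1]
  rw [integral_sub i1.restrict (i2.restrict.const_mul 3), integral_const_mul,
    ← integral_grad_mul_grad hv hv hc]
  congr 1
  have h2 : ∀ p, gradSq v p = dir (1, 0) v p * dir (1, 0) v p + dir (0, 1) v p * dir (0, 1) v p :=
    fun p => by rw [gradSq_eq hv]; ring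
  simp only [h2]
  refine setIntegral_unitDisk_of_tsupport ((tsupport_add _ _).trans (union_subset ?_ ?_))
  · exact tsupport_mul_subset_right.trans ((tsupport_dir_subset _ _).trans hs)
  · exact tsupport_mul_subset_right.trans ((tsupport_dir_subset _ _).trans hs)

/-- The second variation is nonnegative on the kernel of the first variation of the constraint. -/
theorem qform_nonneg (hu : IsHenonSolution b U u)
    {v : ℝ × ℝ → ℝ} (hv : ContDiff ℝ ∞ v) (hc : HasCompactSupport v)
    (hs : tsupport v ⊆ unitDisk) (h0 : ∫ p in unitDisk, weight b p * u p ^ 3 * v p = 0) :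
    0 ≤ qform (weight b) u v := by
  set g := -toD (lapl v) (contDiff_lapl hv).continuous with hg
  set V := toD v hv.continuous with hV
  have hgV : green g = V := green_neg_lapl hv hc hs
  set G := wt b * U ^ 3 with hG
  have hGU : green G = U := hu.ground.eq_green.symm
  set S := quart b U with hS
  have hS0 : 0 < S := hu.ground.quart_pos
  have hE : energy g g = -∫ p, lapl v p * v p := by
    have : g * V = -toD (fun p => lapl v p * v p)
        ((contDiff_lapl hv).continuous.mul hv.continuous) := by
      ext z
      change -lapl v _ * v _ = -(lapl v _ * v _)
      ring
    rw [energy, hgV, this, map_neg, integ_toD_of_tsupport _ (tsupport_mul_subset_right.trans hs)]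
  have hq : integ (wt b * U ^ 2 * V ^ 2) = ∫ p in unitDisk, weight b p * u p ^ 2 * v p ^ 2 := by
    have : wt b * U ^ 2 * V ^ 2 = toD (fun p => weight b p * u p ^ 2 * v p ^ 2)
        (((contDiff_weight b).continuous.mul (hu.smooth.continuous.pow 2)).mul
          (hv.continuous.pow 2)) := by
      ext z
      change wt b z * U z ^ 2 * v _ ^ 2 = weight b _ * u _ ^ 2 * v _ ^ 2
      rw [weight_eq_wt, hu.eq]
    rw [this, integ_toD]
  rw [hu.qform_eq hv hc hs, ← hE, ← hq]
  have hl : integ (G * V) = 0 := by rw [hG, hu.integ_cube_mul, h0]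
  set E := energy g g
  set q := integ (wt b * U ^ 2 * V ^ 2)
  set c := integ (wt b * U * V ^ 3)
  set d := quart b V with hd
  have hexp : ∀ t : ℝ, quart b (green (G + t • g)) = S + t ^ 2 * (6 * q + 4 * t * c + t ^ 2 * d) := by
    intro t
    have e1 : wt b * (U + t • V) ^ 4 = wt b * U ^ 4 + (4 * t) • (G * V) +
        (6 * t ^ 2) • (wt b * U ^ 2 * V ^ 2) + (4 * t ^ 3) • (wt b * U * V ^ 3) +
        t ^ 4 • (wt b * V ^ 4) := by
      ext z
      change wt b z * (U z + t * V z) ^ 4 = wt b z * U z ^ 4 + (4 * t) * (wt b z * U z ^ 3 * V z) +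
        (6 * t ^ 2) * (wt b z * U z ^ 2 * V z ^ 2) + (4 * t ^ 3) * (wt b z * U z * V z ^ 3) +
        t ^ 4 * (wt b z * V z ^ 4)
      ring
    rw [map_add, map_smul, hGU, hgV, quart, e1]
    simp only [map_add, map_smul, smul_eq_mul, hl]
    rw [hS, hd, quart, quart]
    ring
  have hen : ∀ t : ℝ, energy (G + t • g) (G + t • g) = S + t ^ 2 * E := by
    intro t
    have e1 : energy G G = S := by
      rw [energy, hGU, hS, quart, hG]
      ring_nf
    have e2 : energy G g = 0 := by rw [energy, hgV, hl]
    rw [energy_add_left, energy_add_right, energy_add_right, energy_smul_left, energy_smul_left,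
      energy_smul_right, energy_smul_right, e1, energy_comm g G, e2]
    ring
  have key : ∀ t : ℝ, t ≠ 0 → 0 ≤ 2 * S * E + t ^ 2 * E ^ 2 - S * (6 * q + 4 * t * c + t ^ 2 * d) := by
    intro t ht
    have := hu.ground.quart_green_mul_le (G + t • g)
    rw [hexp, hen] at this
    have ht2 : 0 < t ^ 2 := by positivity
    refine nonneg_of_mul_nonneg_right (a := t ^ 2) ?_ ht2
    nlinarith
  have hlim : Tendsto (fun t : ℝ => 2 * S * E + t ^ 2 * E ^ 2 - S * (6 * q + 4 * t * c + t ^ 2 * d))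
      (𝓝[≠] 0) (𝓝 (2 * S * E + 0 ^ 2 * E ^ 2 - S * (6 * q + 4 * 0 * c + 0 ^ 2 * d))) := by
    refine (Continuous.tendsto ?_ 0).mono_left nhdsWithin_le_nhds
    fun_prop
  have h3 := ge_of_tendsto hlim (eventually_mem_nhdsWithin.mono key)
  have h4 : 0 ≤ 2 * S * (E - 3 * q) := by linarith
  exact nonneg_of_mul_nonneg_right h4 (by positivity)

theorem rank_le_one (hu : IsHenonSolution b U u)
    (V : Submodule ℝ (ℝ × ℝ → ℝ)) (hV : NegDefSubspace (weight b) u V) :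
    Module.rank ℝ V ≤ 1 := by
  have h_integrable : ∀ v ∈ V, IntegrableOn (fun p => weight b p * u p ^ 3 * v p) unitDisk := fun v hv =>
    ((((contDiff_weight b).continuous.mul (hu.smooth.continuous.pow 3)).mul
      (hV.1 v hv).1.continuous).integrable_of_hasCompactSupport
        (hV.1 v hv).2.1.mul_left).integrableOn
  let L : V →ₗ[ℝ] ℝ :=
    { toFun := fun v => ∫ p in unitDisk, weight b p * u p ^ 3 * v.1 p
      map_add' := fun v v' => by
        rw [← integral_add (h_integrable v v.2) (h_integrable v' v'.2)]
        simp [mul_add]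
      map_smul' := fun a v => by
        rw [RingHom.id_apply, smul_eq_mul, ← integral_const_mul]
        refine integral_congr_ae (ae_of_all _ fun p => ?_)
        change _ * (a * v.1 p) = _
        ring }
  have hL : Function.Injective L := by
    rw [injective_iff_map_eq_zero]
    intro v hv
    by_contra hne
    obtain ⟨h1, h2, h3⟩ := hV.1 v v.2
    have := hu.qform_nonneg h1 h2 h3 hv
    exact absurd (hV.2 v v.2 fun h => hne (Subtype.ext h)) (not_lt.2 this)
  simpa using LinearMap.rank_le_of_injective L hL

end IsHenonSolution

theorem exists_rank_eq_one {w u v : ℝ × ℝ → ℝ} (hv : ContDiff ℝ ∞ v)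
    (hc : HasCompactSupport v) (hs : tsupport v ⊆ unitDisk) (hq : qform w u v < 0) :
    ∃ V : Submodule ℝ (ℝ × ℝ → ℝ), NegDefSubspace w u V ∧ Module.rank ℝ V = 1 := by
  have hsm : ∀ a : ℝ, qform w u (a • v) = a ^ 2 * qform w u v := fun a => by
    rw [qform, qform, ← integral_const_mul]
    refine integral_congr_ae (ae_of_all _ fun p => ?_)
    simp only
    have hav : ContDiff ℝ ∞ (a • v) := hv.const_smul a
    rw [gradSq_eq hav, gradSq_eq hv, dir_const_smul, dir_const_smul]
    simp only [Pi.smul_apply, smul_eq_mul]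
    ring
  have hv0 : v ≠ 0 := by
    rintro rfl
    have := hsm 0
    rw [smul_zero] at this
    linarith
  refine ⟨Submodule.span ℝ {v}, ⟨fun v' hv' => ?_, fun v' hv' hne => ?_⟩, ?_⟩
  · obtain ⟨a, rfl⟩ := Submodule.mem_span_singleton.1 hv'
    exact ⟨hv.const_smul a, hc.smul_left (f := fun _ => a),
      (tsupport_smul_subset_right (fun _ => a) v).trans hs⟩
  · obtain ⟨a, rfl⟩ := Submodule.mem_span_singleton.1 hv'
    have ha : a ≠ 0 := fun h => hne (by rw [h, zero_smul])
    rw [hsm]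
    exact mul_neg_of_pos_of_neg (by positivity) hq
  · exact Module.rank_eq_one_iff_finrank_eq_one.2 (finrank_span_singleton hv0)

end Henon

namespace Henon

open Complex Metric Set Filter Topology

open scoped ContDiff

/-! ### Cut-off functions -/

/-- A smooth cut-off function on the unit disk. -/
noncomputable def cutoff (k : ℝ) (p : ℝ × ℝ) : ℝ :=
  Real.smoothTransition (k * (1 - (p.1 ^ 2 + p.2 ^ 2)) - 1)

theorem contDiff_cutoff (k : ℝ) : ContDiff ℝ ∞ (cutoff k) :=
  Real.smoothTransition.contDiff.comp (by fun_prop)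

theorem cutoff_nonneg (k : ℝ) (p : ℝ × ℝ) : 0 ≤ cutoff k p := Real.smoothTransition.nonneg _

theorem cutoff_le_one (k : ℝ) (p : ℝ × ℝ) : cutoff k p ≤ 1 := Real.smoothTransition.le_one _

theorem tsupport_cutoff_subset (k : ℝ) :
    tsupport (cutoff k) ⊆ {p | 1 ≤ k * (1 - (p.1 ^ 2 + p.2 ^ 2))} :=
  closure_minimal (fun p hp => by
    by_contra h
    rw [Set.mem_ofPred_eq, not_le] at h
    exact hp (Real.smoothTransition.zero_of_nonpos (by linarith)))
    (isClosed_le continuous_const (by fun_prop))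

theorem tsupport_cutoff_subset_unitDisk {k : ℝ} (hk : 0 < k) :
    tsupport (cutoff k) ⊆ unitDisk := fun p hp => by
  have h : 1 ≤ k * (1 - (p.1 ^ 2 + p.2 ^ 2)) := tsupport_cutoff_subset k hp
  change p.1 ^ 2 + p.2 ^ 2 < 1
  by_contra h'
  nlinarith

theorem unitDisk_subset_closedBall : unitDisk ⊆ closedBall (0 : ℝ × ℝ) 1 := fun p hp => by
  have hp : p.1 ^ 2 + p.2 ^ 2 < 1 := hp
  rw [mem_closedBall_zero_iff, Prod.norm_def, max_le_iff, Real.norm_eq_abs, Real.norm_eq_abs,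
    ← sq_le_one_iff_abs_le_one, ← sq_le_one_iff_abs_le_one]
  constructor <;> nlinarith [sq_nonneg p.1, sq_nonneg p.2]

theorem hasCompactSupport_cutoff {k : ℝ} (hk : 0 < k) : HasCompactSupport (cutoff k) :=
  (isCompact_closedBall (0 : ℝ × ℝ) 1).of_isClosed_subset (isClosed_tsupport _)
    ((tsupport_cutoff_subset_unitDisk hk).trans unitDisk_subset_closedBall)

theorem integrableOn_unitDisk {F : ℝ × ℝ → ℝ} (hF : Continuous F) : IntegrableOn F unitDisk :=
  (hF.continuousOn.integrableOn_compact (isCompact_closedBall (0 : ℝ × ℝ) 1)).mono_set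
    unitDisk_subset_closedBall

theorem dir_cutoff (k : ℝ) (e p : ℝ × ℝ) :
    dir e (cutoff k) p = deriv Real.smoothTransition (k * (1 - (p.1 ^ 2 + p.2 ^ 2)) - 1) *
      (k * -(2 * p.1 * e.1 + 2 * p.2 * e.2)) := by
  have h1 : HasFDerivAt (fun p : ℝ × ℝ => k * (1 - (p.1 ^ 2 + p.2 ^ 2)) - 1) _ p :=
    ((((hasFDerivAt_fst (𝕜 := ℝ) (p := p)).pow 2).add ((hasFDerivAt_snd (𝕜 := ℝ) (p := p)).pow 2)).const_sub 1).const_mul k |>.sub_const 1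
  have h2 := (Real.smoothTransition.contDiff (n := 1)).differentiable (by simp)
    (k * (1 - (p.1 ^ 2 + p.2 ^ 2)) - 1) |>.hasDerivAt
  have h3 : HasFDerivAt (cutoff k) _ p := h2.comp_hasFDerivAt p h1
  rw [dir, h3.fderiv]
  simp
  ring

theorem deriv_smoothTransition_of_one_lt {x : ℝ} (hx : 1 < x) :
    deriv Real.smoothTransition x = 0 := by
  have : Real.smoothTransition =ᶠ[𝓝 x] fun _ => 1 := by
    filter_upwards [lt_mem_nhds hx] with y hy
    exact Real.smoothTransition.one_of_one_le hy.le
  rw [this.deriv_eq, deriv_const]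

theorem exists_dir_cutoff_le : ∃ C, ∀ k : ℝ, 0 ≤ k → ∀ e : ℝ × ℝ, |e.1| ≤ 1 → |e.2| ≤ 1 →
    ∀ p ∈ unitDisk, (1 - (p.1 ^ 2 + p.2 ^ 2)) * |dir e (cutoff k) p| ≤ C := by
  have hc : Continuous fun t : ℝ => deriv Real.smoothTransition (t - 1) :=
    ((Real.smoothTransition.contDiff (n := 1)).continuous_deriv le_rfl).comp (by fun_prop)
  obtain ⟨M, hM⟩ := (isCompact_Icc (a := (0 : ℝ)) (b := 2)).exists_bound_of_continuousOn
    hc.continuousOn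
  have hM0 : 0 ≤ M := (norm_nonneg _).trans (hM 0 (by simp))
  refine ⟨8 * M, fun k hk e he1 he2 p hp => ?_⟩
  have hs : p.1 ^ 2 + p.2 ^ 2 < 1 := hp
  have hp1 : |p.1| ≤ 1 := by rw [← sq_le_one_iff_abs_le_one]; nlinarith [sq_nonneg p.2]
  have hp2 : |p.2| ≤ 1 := by rw [← sq_le_one_iff_abs_le_one]; nlinarith [sq_nonneg p.1]
  have h4 : |-(2 * p.1 * e.1 + 2 * p.2 * e.2)| ≤ 4 := by
    rw [abs_neg]
    refine (abs_add_le _ _).trans ?_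
    simp only [abs_mul, abs_two]
    nlinarith [mul_le_one₀ hp1 (abs_nonneg _) he1, mul_le_one₀ hp2 (abs_nonneg _) he2]
  rw [dir_cutoff, abs_mul, abs_mul, abs_of_nonneg hk]
  set t := k * (1 - (p.1 ^ 2 + p.2 ^ 2)) with ht
  have ht0 : 0 ≤ t := mul_nonneg hk (by linarith)
  have h5 : t * |deriv Real.smoothTransition (t - 1)| ≤ 2 * M := by
    rcases le_or_gt t 2 with h | h
    · exact mul_le_mul h (hM t ⟨ht0, h⟩) (abs_nonneg _) (by norm_num)
    · rw [deriv_smoothTransition_of_one_lt (by linarith), abs_zero, mul_zero]; positivity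
  calc _ = (t * |deriv Real.smoothTransition (t - 1)|) *
        |-(2 * p.1 * e.1 + 2 * p.2 * e.2)| := by rw [ht]; ring
    _ ≤ 2 * M * 4 := mul_le_mul h5 h4 (abs_nonneg _) (by positivity)
    _ = 8 * M := by ring

theorem eventually_cutoff {p : ℝ × ℝ} (hp : p ∈ unitDisk) :
    ∀ᶠ n : ℕ in atTop, cutoff (n + 1) p = 1 ∧ ∀ e, dir e (cutoff (n + 1)) p = 0 := by
  have hs : 0 < 1 - (p.1 ^ 2 + p.2 ^ 2) := sub_pos.2 hp
  obtain ⟨N, hN⟩ := exists_nat_gt (2 / (1 - (p.1 ^ 2 + p.2 ^ 2)))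
  filter_upwards [eventually_ge_atTop N] with n hn
  have h1 : 1 < ((n : ℝ) + 1) * (1 - (p.1 ^ 2 + p.2 ^ 2)) - 1 := by
    rw [div_lt_iff₀ hs] at hN
    have : (N : ℝ) ≤ n := by exact_mod_cast hn
    nlinarith
  exact ⟨Real.smoothTransition.one_of_one_le h1.le, fun e => by
    rw [dir_cutoff, deriv_smoothTransition_of_one_lt h1, zero_mul]⟩

namespace IsHenonSolution

variable {b : ℕ} {U : C(D, ℝ)} {u : ℝ × ℝ → ℝ}

/-- The quadratic form on products `ψ u`. -/
theorem qform_mul (hu : IsHenonSolution b U u) {ψ : ℝ × ℝ → ℝ} (hψ : ContDiff ℝ ∞ ψ)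
    (hc : HasCompactSupport ψ) (hs : tsupport ψ ⊆ unitDisk) :
    qform (weight b) u (ψ * u) = ∫ p in unitDisk,
      ((u p * dir (1, 0) ψ p) ^ 2 + (u p * dir (0, 1) ψ p) ^ 2 -
        2 * (weight b p * ψ p ^ 2 * u p ^ 4)) := by
  have hus := hu.smooth
  set g : ℝ × ℝ → ℝ := ψ * ψ * u with hg
  have hψψ : ContDiff ℝ ∞ (ψ * ψ) := hψ.mul hψ
  have hψu : ContDiff ℝ ∞ (ψ * u) := hψ.mul hus
  have hgs : ContDiff ℝ ∞ g := hψψ.mul hus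
  have hgc : HasCompactSupport g := (hc.mul_left (f' := ψ)).mul_right
  have hgt : tsupport g ⊆ unitDisk :=
    (tsupport_mul_subset_left.trans tsupport_mul_subset_left).trans hs
  have hd : ∀ e, dir e g = ψ * ψ * dir e u + (ψ * dir e ψ + dir e ψ * ψ) * u := fun e => by
    rw [hg, dir_mul hψψ hus, dir_mul hψ hψ]
  have hdc : ∀ (f : ℝ × ℝ → ℝ) e, ContDiff ℝ ∞ f → Continuous (dir e f) := fun f e hf =>
    (contDiff_dir hf e).continuous
  have c1 := hψ.continuous
  have c2 := hus.continuous
  have c3 := hdc ψ (1, 0) hψ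
  have c4 := hdc ψ (0, 1) hψ
  have c5 := hdc u (1, 0) hus
  have c6 := hdc u (0, 1) hus
  have c7 := hdc g (1, 0) hgs
  have c8 := hdc g (0, 1) hgs
  have c9 := (contDiff_weight b).continuous
  have h1 : ∫ p in unitDisk, (dir (1, 0) u p * dir (1, 0) g p + dir (0, 1) u p * dir (0, 1) g p) =
      ∫ p in unitDisk, weight b p * ψ p ^ 2 * u p ^ 4 := by
    rw [setIntegral_unitDisk_of_tsupport, integral_grad_mul_grad hus hgs hgc,
      ← setIntegral_unitDisk_of_tsupport (tsupport_mul_subset_right.trans hgt), ← integral_neg]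
    · refine setIntegral_congr_fun isOpen_unitDisk.measurableSet fun p hp => ?_
      simp only [hu.lapl_eq hp, hg, Pi.mul_apply]
      ring
    · exact (tsupport_add _ _).trans (union_subset
        (tsupport_mul_subset_right.trans ((tsupport_dir_subset _ _).trans hgt))
        (tsupport_mul_subset_right.trans ((tsupport_dir_subset _ _).trans hgt)))
  rw [← sub_eq_zero] at h1 ⊢
  rw [← integral_sub (integrableOn_unitDisk (by fun_prop)) (integrableOn_unitDisk (by fun_prop))]
    at h1
  refine Eq.trans ?_ h1
  rw [qform, ← integral_sub]
  · refine integral_congr_ae (ae_of_all _ fun p => ?_)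
    simp only [gradSq_eq hψu, hd, dir_mul hψ hus, Pi.mul_apply, Pi.add_apply]
    ring
  · refine integrableOn_unitDisk ?_
    have : gradSq (ψ * u) = fun p => dir (1, 0) (ψ * u) p ^ 2 + dir (0, 1) (ψ * u) p ^ 2 :=
      funext fun p => gradSq_eq hψu p
    rw [this]
    have c10 := hdc (ψ * u) (1, 0) (hψ.mul hus)
    have c11 := hdc (ψ * u) (0, 1) (hψ.mul hus)
    have c12 : Continuous (ψ * u) := c1.mul c2
    fun_prop
  · exact integrableOn_unitDisk (by fun_prop)

theorem exists_le_mul (hu : IsHenonSolution b U u) :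
    ∃ L, ∀ p ∈ unitDisk, u p ≤ L * (1 - (p.1 ^ 2 + p.2 ^ 2)) := by
  refine ⟨‖wt b * U ^ 3‖ * (1 / 4), fun p hp => ?_⟩
  obtain ⟨z, rfl⟩ := exists_mem_D (le_of_lt hp)
  have h1 : wt b * U ^ 3 ≤ ‖wt b * U ^ 3‖ • reMon 1 0 0 := fun x => by
    change (wt b * U ^ 3) x ≤ ‖wt b * U ^ 3‖ * reMon 1 0 0 x
    rw [reMon_apply]
    have h := (le_abs_self _).trans ((wt b * U ^ 3).norm_coe_le_norm x)
    simpa only [pow_zero, mul_one, one_re] using h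
  have h2 := green_mono h1 z
  rw [← hu.ground.eq_green, map_smul, green_reMon] at h2
  rw [hu.eq]
  refine h2.trans_eq ?_
  change ‖wt b * U ^ 3‖ * (_ * (reMon 1 (0 - 0) (0 - 0) z - reMon 1 (0 + 1) (0 + 1) z)) = _
  simp [reMon_apply, Complex.mul_conj, Complex.normSq_apply]
  ring

/-- The quadratic form on `φ u` is approximated by its values on test functions. -/
theorem tendsto_qform (hu : IsHenonSolution b U u) {φ : ℝ × ℝ → ℝ} (hφ : ContDiff ℝ ∞ φ) :
    Tendsto (fun n : ℕ => qform (weight b) u (cutoff (n + 1) * φ * u)) atTop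
      (𝓝 (∫ p in unitDisk, ((u p * dir (1, 0) φ p) ^ 2 + (u p * dir (0, 1) φ p) ^ 2 -
        2 * (weight b p * φ p ^ 2 * u p ^ 4)))) := by
  have hus := hu.smooth
  have hk : ∀ n : ℕ, (0 : ℝ) < n + 1 := fun n => by positivity
  have hψ : ∀ n : ℕ, ContDiff ℝ ∞ (cutoff (n + 1) * φ) := fun n => (contDiff_cutoff _).mul hφ
  have hq : ∀ n : ℕ, qform (weight b) u (cutoff (n + 1) * φ * u) = _ := fun n =>
    hu.qform_mul (hψ n) (hasCompactSupport_cutoff (hk n)).mul_right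
      (tsupport_mul_subset_left.trans (tsupport_cutoff_subset_unitDisk (hk n)))
  simp only [hq]
  have hdc : ∀ (f : ℝ × ℝ → ℝ) e, ContDiff ℝ ∞ f → Continuous (dir e f) := fun f e hf =>
    (contDiff_dir hf e).continuous
  obtain ⟨C, hC⟩ := exists_dir_cutoff_le
  obtain ⟨L, hL⟩ := hu.exists_le_mul
  have c2 := hus.continuous
  have c5 := hdc φ (1, 0) hφ
  have c6 := hdc φ (0, 1) hφ
  have c9 := (contDiff_weight b).continuous
  have c1 := hφ.continuous
  have key : ∀ (n : ℕ) (e : ℝ × ℝ), |e.1| ≤ 1 → |e.2| ≤ 1 → ∀ p ∈ unitDisk,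
      (u p * dir e (cutoff (n + 1) * φ) p) ^ 2 ≤ (|u p * dir e φ p| + |L| * C * |φ p|) ^ 2 := by
    intro n e he1 he2 p hp
    rw [sq_le_sq, abs_of_nonneg (a := |u p * dir e φ p| + _)]
    · rw [dir_mul (contDiff_cutoff _) hφ]
      simp only [Pi.add_apply, Pi.mul_apply, mul_add]
      refine (abs_add_le _ _).trans (add_le_add ?_ ?_)
      · rw [mul_left_comm, abs_mul]
        exact mul_le_of_le_one_left (abs_nonneg _) (by
          rw [abs_of_nonneg (cutoff_nonneg _ _)]; exact cutoff_le_one _ _)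
      · rw [← mul_assoc, abs_mul]
        refine mul_le_mul_of_nonneg_right ?_ (abs_nonneg _)
        rw [abs_mul, abs_of_pos (hu.pos hp)]
        have h1 : 0 ≤ 1 - (p.1 ^ 2 + p.2 ^ 2) := sub_nonneg.2 (le_of_lt hp)
        calc u p * |dir e (cutoff (n + 1)) p|
            ≤ |L| * (1 - (p.1 ^ 2 + p.2 ^ 2)) * |dir e (cutoff (n + 1)) p| :=
              mul_le_mul_of_nonneg_right ((hL p hp).trans
                (mul_le_mul_of_nonneg_right (le_abs_self _) h1)) (abs_nonneg _)
          _ = |L| * ((1 - (p.1 ^ 2 + p.2 ^ 2)) * |dir e (cutoff (n + 1)) p|) := by ring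
          _ ≤ |L| * C := mul_le_mul_of_nonneg_left (hC _ (hk n).le e he1 he2 p hp) (abs_nonneg _)
    · have := (mul_nonneg (sub_nonneg.2 (le_of_lt hp)) (abs_nonneg _)).trans
        (hC _ (hk n).le e he1 he2 p hp)
      positivity
  refine tendsto_integral_of_dominated_convergence
    (fun p => (|u p * dir (1, 0) φ p| + |L| * C * |φ p|) ^ 2 +
      (|u p * dir (0, 1) φ p| + |L| * C * |φ p|) ^ 2 + 2 * (weight b p * φ p ^ 2 * u p ^ 4))
    (fun n => ?_) (integrableOn_unitDisk (by fun_prop)) (fun n => ?_) ?_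
  · have d1 := hdc _ (1, 0) (hψ n)
    have d2 := hdc _ (0, 1) (hψ n)
    have d3 := (hψ n).continuous
    exact Continuous.aestronglyMeasurable (by fun_prop)
  · refine (ae_restrict_iff' isOpen_unitDisk.measurableSet).2 (ae_of_all _ fun p hp => ?_)
    have h3 := key n (1, 0) (by simp) (by simp) p hp
    have h4 := key n (0, 1) (by simp) (by simp) p hp
    have h5 : (cutoff (n + 1) * φ) p ^ 2 ≤ φ p ^ 2 := by
      rw [Pi.mul_apply, mul_pow]
      exact mul_le_of_le_one_left (sq_nonneg _)
        (pow_le_one₀ (cutoff_nonneg _ _) (cutoff_le_one _ _))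
    have h6 : weight b p * (cutoff (n + 1) * φ) p ^ 2 * u p ^ 4 ≤ weight b p * φ p ^ 2 * u p ^ 4 :=
      mul_le_mul_of_nonneg_right (mul_le_mul_of_nonneg_left h5 (weight_nonneg _ _)) (by positivity)
    have h7 : 0 ≤ weight b p * (cutoff (n + 1) * φ) p ^ 2 * u p ^ 4 := by
      have := weight_nonneg b p
      positivity
    rw [Real.norm_eq_abs, abs_le]
    constructor <;>
    nlinarith [sq_nonneg (u p * dir (1, 0) (cutoff (n + 1) * φ) p),
      sq_nonneg (u p * dir (0, 1) (cutoff (n + 1) * φ) p)]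
  · refine (ae_restrict_iff' isOpen_unitDisk.measurableSet).2 (ae_of_all _ fun p hp => ?_)
    refine tendsto_const_nhds.congr' ?_
    filter_upwards [eventually_cutoff hp] with n hn
    simp only [dir_mul (contDiff_cutoff _) hφ, Pi.add_apply, Pi.mul_apply, hn.1, hn.2]
    ring

theorem integral_pos' (hu : IsHenonSolution b U u) :
    0 < ∫ p in unitDisk, weight b p * u p ^ 4 := by
  have h := hu.ground.quart_pos
  rw [quart, integ_apply] at h
  rw [setIntegral_unitDisk]
  refine h.trans_eq (integral_congr_ae (ae_of_all _ fun z => ?_))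
  simp only [weight_eq_wt, hu.eq]
  rfl

theorem exists_negDefSubspace (hu : IsHenonSolution b U u) :
    ∃ V : Submodule ℝ (ℝ × ℝ → ℝ), NegDefSubspace (weight b) u V ∧ Module.rank ℝ V = 1 := by
  have h := hu.tendsto_qform (φ := fun _ => 1) contDiff_const
  have h0 : ∫ p in unitDisk, ((u p * dir (1, 0) (fun _ => 1) p) ^ 2 +
      (u p * dir (0, 1) (fun _ => 1) p) ^ 2 - 2 * (weight b p * 1 ^ 2 * u p ^ 4)) < 0 := by
    have : ∀ p : ℝ × ℝ, ((u p * dir (1, 0) (fun _ => (1 : ℝ)) p) ^ 2 +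
      (u p * dir (0, 1) (fun _ => (1 : ℝ)) p) ^ 2 - 2 * (weight b p * 1 ^ 2 * u p ^ 4)) =
      -2 * (weight b p * u p ^ 4) := fun p => by simp [dir]
    simp only [this]
    rw [integral_const_mul]
    linarith [hu.integral_pos']
  obtain ⟨n, hn⟩ := (h.eventually_lt_const h0).exists
  have hk : (0 : ℝ) < n + 1 := by positivity
  refine exists_rank_eq_one (((contDiff_cutoff _).mul contDiff_const).mul hu.smooth) ?_ ?_ hn
  · exact (hasCompactSupport_cutoff hk).mul_right.mul_right
  · exact (tsupport_mul_subset_left.trans tsupport_mul_subset_left).trans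
      (tsupport_cutoff_subset_unitDisk hk)

/-- For even solutions the second variation in the direction `x u` is nonnegative. -/
theorem integral_sq_le (hu : IsHenonSolution b U u) (hev : ∀ p ∈ unitDisk, u (-p) = u p) :
    0 ≤ ∫ p in unitDisk, (u p ^ 2 - 2 * (weight b p * p.1 ^ 2 * u p ^ 4)) := by
  have h := hu.tendsto_qform (φ := fun p => p.1) contDiff_fst
  have hd : ∀ p : ℝ × ℝ, ((u p * dir (1, 0) (fun p : ℝ × ℝ => p.1) p) ^ 2 +
      (u p * dir (0, 1) (fun p : ℝ × ℝ => p.1) p) ^ 2 - 2 * (weight b p * p.1 ^ 2 * u p ^ 4)) =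
      u p ^ 2 - 2 * (weight b p * p.1 ^ 2 * u p ^ 4) := fun p => by simp [dir, fderiv_fst]
  simp only [hd] at h
  refine ge_of_tendsto' h fun n => ?_
  have hk : (0 : ℝ) < n + 1 := by positivity
  have hs : tsupport (cutoff (n + 1) * (fun p : ℝ × ℝ => p.1) * u) ⊆ unitDisk :=
    (tsupport_mul_subset_left.trans tsupport_mul_subset_left).trans
      (tsupport_cutoff_subset_unitDisk hk)
  refine hu.qform_nonneg (((contDiff_cutoff _).mul contDiff_fst).mul hu.smooth)
    (hasCompactSupport_cutoff hk).mul_right.mul_right hs ?_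
  rw [setIntegral_unitDisk_of_tsupport (tsupport_mul_subset_right.trans hs)]
  set I := ∫ p, weight b p * u p ^ 3 * (cutoff (n + 1) * (fun p : ℝ × ℝ => p.1) * u) p with hI
  have h1 : I = -I := by
    conv_lhs => rw [hI, ← integral_neg_eq_self]
    rw [hI, ← integral_neg]
    refine integral_congr_ae (ae_of_all _ fun p => ?_)
    have hc : cutoff (n + 1) (-p) = cutoff (n + 1) p := by simp [cutoff]
    have hw : weight b (-p) = weight b p := by simp [weight]
    simp only [Pi.mul_apply, hc, hw, Prod.fst_neg]
    by_cases hp : p ∈ unitDisk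
    · rw [hev p hp]; ring
    · have : cutoff (n + 1) p = 0 := image_eq_zero_of_notMem_tsupport fun h =>
        hp (tsupport_cutoff_subset_unitDisk hk h)
      rw [this]; ring
  linarith

end IsHenonSolution

end Henon

namespace Henon

open Complex Metric Set Filter Topology

/-! ### Reflections -/

/-- Reflection of the plane in the line spanned by `e`. -/
noncomputable def reflLIE (e : Circle) : ℂ ≃ₗᵢ[ℝ] ℂ := conjLIE.trans (rotation (e ^ 2))

theorem reflLIE_apply (e : Circle) (z : ℂ) : reflLIE e z = (e : ℂ) ^ 2 * starRingEnd ℂ z := by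
  change ((e ^ 2 : Circle) : ℂ) * starRingEnd ℂ z = _
  rw [Circle.coe_pow]

/-- Signed distance to the line spanned by `e`. -/
noncomputable def side (e : Circle) (z : ℂ) : ℝ := (z * starRingEnd ℂ (e : ℂ)).im

theorem circle_mul_conj (e : Circle) : (e : ℂ) * starRingEnd ℂ (e : ℂ) = 1 := by
  rw [Complex.mul_conj, Complex.normSq_eq_norm_sq, Circle.norm_coe]; simp

theorem reflLIE_reflLIE (e : Circle) (z : ℂ) : reflLIE e (reflLIE e z) = z := by
  rw [reflLIE_apply, reflLIE_apply, map_mul, map_pow, Complex.conj_conj, ← mul_assoc, ← mul_pow,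
    circle_mul_conj, one_pow, one_mul]

theorem reflLIE_mul_conj (e : Circle) (z : ℂ) :
    reflLIE e z * starRingEnd ℂ (e : ℂ) = starRingEnd ℂ (z * starRingEnd ℂ (e : ℂ)) := by
  rw [reflLIE_apply, map_mul, Complex.conj_conj]
  linear_combination (e : ℂ) * starRingEnd ℂ z * circle_mul_conj e

theorem side_reflLIE (e : Circle) (z : ℂ) : side e (reflLIE e z) = -side e z := by
  rw [side, reflLIE_mul_conj, Complex.conj_im, side]

theorem norm_mul_conj_circle (e : Circle) (z : ℂ) : ‖z * starRingEnd ℂ (e : ℂ)‖ = ‖z‖ := by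
  rw [norm_mul, RCLike.norm_conj, Circle.norm_coe, mul_one]

theorem reflLIE_of_side_eq_zero {e : Circle} {z : ℂ} (h : side e z = 0) : reflLIE e z = z := by
  have h1 : reflLIE e z * starRingEnd ℂ (e : ℂ) = z * starRingEnd ℂ (e : ℂ) := by
    rw [reflLIE_mul_conj]; exact Complex.conj_eq_iff_im.2 h
  refine mul_right_cancel₀ ?_ h1
  intro h0
  have := circle_mul_conj e
  rw [h0, mul_zero] at this
  exact zero_ne_one this

theorem norm_reflLIE_sub_sq (e : Circle) (x y : ℂ) :
    ‖reflLIE e x - y‖ ^ 2 = ‖x - y‖ ^ 2 + 4 * (side e x * side e y) := by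
  rw [← norm_mul_conj_circle e (x - y), ← norm_mul_conj_circle e (reflLIE e x - y), sub_mul, sub_mul,
    reflLIE_mul_conj, side, side, ← Complex.normSq_eq_norm_sq, ← Complex.normSq_eq_norm_sq,
    Complex.normSq_apply, Complex.normSq_apply]
  simp only [sub_re, sub_im, conj_re, conj_im]
  ring

/-- The reflection as a self-map of the closed disk. -/
noncomputable def refl (e : Circle) : C(D, D) where
  toFun z := ⟨reflLIE e z, by
    rw [mem_closedBall_zero_iff, LinearIsometryEquiv.norm_map]; exact z.norm_le⟩
  continuous_toFun := by fun_prop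

@[simp] theorem coe_refl (e : Circle) (z : D) : ((refl e z : D) : ℂ) = reflLIE e z := rfl

theorem refl_refl (e : Circle) (z : D) : refl e (refl e z) = z :=
  Subtype.ext (reflLIE_reflLIE e z)

theorem integral_refl (e : Circle) (F : D → ℝ) : ∫ z, F (refl e z) = ∫ z, F z := by
  classical
  set G : ℂ → ℝ := fun z => if h : z ∈ closedBall (0 : ℂ) 1 then F ⟨z, h⟩ else 0 with hG
  have h1 : ∀ z : D, F z = G z := fun z => by simp only [hG, dif_pos z.2]
  simp only [h1, coe_refl]
  rw [integral_D fun z => G (reflLIE e z), integral_D G]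
  have h2 := (reflLIE e).measurePreserving.setIntegral_preimage_emb
    (reflLIE e).toHomeomorph.measurableEmbedding G (closedBall 0 1)
  rwa [(reflLIE e).preimage_closedBall, map_zero] at h2

theorem ker_reflLIE (e : Circle) (x y : ℂ) : ker 0 (reflLIE e x) (reflLIE e y) = ker 0 x y := by
  rw [ker, ker, ← map_sub, LinearIsometryEquiv.norm_map, LinearIsometryEquiv.norm_map,
    LinearIsometryEquiv.norm_map]

theorem green_comp_refl (e : Circle) (f : C(D, ℝ)) :
    green (f.comp (refl e)) = (green f).comp (refl e) := by
  ext x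
  rw [green_apply, ContinuousMap.comp_apply, green_apply,
    ← integral_refl e fun y => ker 0 (refl e x) y * f y]
  simp only [coe_refl, ker_reflLIE]
  rfl

theorem integ_comp_refl (e : Circle) (f : C(D, ℝ)) : integ (f.comp (refl e)) = integ f :=
  integral_refl e f

theorem wt_refl (b : ℕ) (e : Circle) (z : D) : wt b (refl e z) = wt b z := by
  rw [wt_apply, wt_apply, coe_refl, LinearIsometryEquiv.norm_map]

/-! ### Potentials of odd functions -/

theorem ker_sub_ker_nonneg {e : Circle} {x y : D} (h : 0 ≤ side e x * side e y) (hxy : x ≠ y) :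
    0 ≤ ker 0 x y - ker 0 (refl e x) y := by
  rw [sub_nonneg, ker, ker, coe_refl, LinearIsometryEquiv.norm_map, norm_reflLIE_sub_sq]
  have h1 := one_sub_sq_nonneg x
  have h2 := one_sub_sq_nonneg y
  have h3 : 0 < ‖(x : ℂ) - y‖ := norm_pos_iff.2 (sub_ne_zero.2 fun h' => hxy (Subtype.ext h'))
  gcongr
  linarith

theorem ker_sub_ker_pos {e : Circle} {x y : D} (h : 0 < side e x * side e y) (hx : ‖(x : ℂ)‖ < 1)
    (hy : ‖(y : ℂ)‖ < 1) (hxy : x ≠ y) : 0 < ker 0 x y - ker 0 (refl e x) y := by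
  rw [sub_pos, ker, ker, coe_refl, LinearIsometryEquiv.norm_map, norm_reflLIE_sub_sq]
  have h1 : 0 < 1 - ‖(x : ℂ)‖ ^ 2 := by nlinarith [norm_nonneg (x : ℂ)]
  have h2 : 0 < 1 - ‖(y : ℂ)‖ ^ 2 := by nlinarith [norm_nonneg (y : ℂ)]
  have h3 : 0 < ‖(x : ℂ) - y‖ := norm_pos_iff.2 (sub_ne_zero.2 fun h' => hxy (Subtype.ext h'))
  refine mul_lt_mul_of_pos_left (Real.log_lt_log (by positivity) ?_) (by positivity)
  gcongr
  linarith

theorem ker_sub_refl (e : Circle) (x y : D) :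
    ker 0 (refl e x) y - ker 0 x y = ker 0 x (refl e y) - ker 0 (refl e x) (refl e y) := by
  have h1 := ker_reflLIE e x y
  have h2 := ker_reflLIE e (reflLIE e x) y
  rw [reflLIE_reflLIE] at h2
  simp only [coe_refl, h1, h2]

variable {e : Circle} {B : C(D, ℝ)}

theorem two_mul_green_of_odd (hodd : ∀ z, B (refl e z) = -B z) (x : D) :
    2 * green B x = ∫ y : D, (ker 0 x y - ker 0 (refl e x) y) * B y := by
  have h1 : B.comp (refl e) = -B := ContinuousMap.ext hodd
  have h2 := DFunLike.congr_fun (green_comp_refl e B) x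
  rw [h1, map_neg, ContinuousMap.comp_apply] at h2
  change -green B x = _ at h2
  rw [two_mul]
  nth_rewrite 2 [← neg_neg (green B x)]
  rw [h2, ← sub_eq_add_neg, green_apply, green_apply,
    ← integral_sub (integrable_ker_mul x B) (integrable_ker_mul _ B)]
  simp only [sub_mul]

theorem ker_sub_ker_mul_nonneg (hodd : ∀ z, B (refl e z) = -B z) (hB : ∀ z : D, 0 < side e z → 0 ≤ B z)
    {x y : D} (hx : 0 < side e x) (hxy : x ≠ y) (hxy' : refl e x ≠ y) :
    0 ≤ (ker 0 x y - ker 0 (refl e x) y) * B y := by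
  rcases lt_or_ge (side e y) 0 with hy | hy
  · have hy' : 0 < side e (refl e y) := by rw [coe_refl, side_reflLIE]; linarith
    have h1 : B y = -B (refl e y) := by rw [hodd, neg_neg]
    have h2 := ker_sub_refl e x y
    rw [h1]
    have h3 := ker_sub_ker_nonneg (e := e) (x := x) (y := refl e y) (by positivity)
      fun h => hxy' (by rw [h, refl_refl])
    nlinarith [hB _ hy']
  · rcases hy.eq_or_lt with hy | hy
    · have h1 : refl e y = y := Subtype.ext (reflLIE_of_side_eq_zero hy.symm)
      have h2 := hodd y
      rw [h1] at h2
      rw [show B y = 0 by linarith, mul_zero]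
    · exact mul_nonneg (ker_sub_ker_nonneg (by positivity) hxy) (hB y hy)

theorem ae_ker_sub_ker_mul_nonneg (hodd : ∀ z, B (refl e z) = -B z)
    (hB : ∀ z : D, 0 < side e z → 0 ≤ B z) {x : D} (hx : 0 < side e x) :
    ∀ᵐ y : D, 0 ≤ (ker 0 x y - ker 0 (refl e x) y) * B y := by
  filter_upwards [ae_ne_D x, ae_ne_D (refl e x)] with y h1 h2
  exact ker_sub_ker_mul_nonneg hodd hB hx h1 h2

theorem green_nonneg_of_odd (hodd : ∀ z, B (refl e z) = -B z)
    (hB : ∀ z : D, 0 < side e z → 0 ≤ B z) {x : D} (hx : 0 < side e x) : 0 ≤ green B x := by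
  have := integral_nonneg_of_ae (ae_ker_sub_ker_mul_nonneg hodd hB hx)
  rw [← two_mul_green_of_odd hodd] at this
  linarith

theorem continuous_side (e : Circle) : Continuous (side e) := by unfold side; fun_prop

theorem green_pos_of_odd (hodd : ∀ z, B (refl e z) = -B z)
    (hB : ∀ z : D, 0 < side e z → 0 ≤ B z) {x y : D} (hx : 0 < side e x) (hx1 : ‖(x : ℂ)‖ < 1)
    (hy : 0 < side e y) (hy1 : ‖(y : ℂ)‖ < 1) (hyB : 0 < B y) : 0 < green B x := by
  refine lt_of_le_of_ne (green_nonneg_of_odd hodd hB hx) fun h0 => ?_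
  have h1 := two_mul_green_of_odd hodd x
  rw [← h0, mul_zero] at h1
  have h_integrable : Integrable fun y : D => (ker 0 x y - ker 0 (refl e x) y) * B y := by
    simp only [sub_mul]
    exact (integrable_ker_mul x B).sub (integrable_ker_mul _ B)
  have h2 := (integral_eq_zero_iff_of_nonneg_ae (ae_ker_sub_ker_mul_nonneg hodd hB hx) h_integrable).1
    h1.symm
  set V : Set D := {z | 0 < side e z ∧ ‖(z : ℂ)‖ < 1 ∧ 0 < B z} with hV
  have hVo : IsOpen V :=
    (isOpen_lt continuous_const ((continuous_side e).comp continuous_subtype_val)).inter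
      ((isOpen_lt (f := fun z : D => ‖(z : ℂ)‖) (by fun_prop) continuous_const).inter
        (isOpen_lt continuous_const (map_continuous B)))
  have h3 : Dense {z : D | (ker 0 x z - ker 0 (refl e x) z) * B z = 0 ∧ x ≠ z} :=
    Measure.dense_of_ae (h2.and (ae_ne_D x))
  obtain ⟨z, hz, hz0, hxz⟩ := h3.inter_open_nonempty V hVo ⟨y, hy, hy1, hyB⟩
  have := ker_sub_ker_pos (mul_pos hx hz.1) hx1 hz.2.1 hxz
  exact (mul_pos this hz.2.2).ne' hz0

/-- The energy of two odd functions which are nonnegative on a half disk. -/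
theorem eq_zero_of_energy_nonpos {A : C(D, ℝ)} (hA : ∀ z, A (refl e z) = -A z)
    (hodd : ∀ z, B (refl e z) = -B z) (hA0 : ∀ z : D, 0 < side e z → 0 ≤ A z)
    (hB : ∀ z : D, 0 < side e z → 0 ≤ B z) (h : energy A B ≤ 0) :
    (∀ z : D, 0 < side e z → ‖(z : ℂ)‖ < 1 → A z = 0) ∨
      ∀ z : D, 0 < side e z → ‖(z : ℂ)‖ < 1 → B z = 0 := by
  have hG : ∀ z, green B (refl e z) = -green B z := fun z => by
    have h2 := DFunLike.congr_fun (green_comp_refl e B) z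
    have h1 : B.comp (refl e) = -B := ContinuousMap.ext hodd
    rw [h1, map_neg] at h2
    exact h2.symm
  have hnn : 0 ≤ A * green B := fun z => by
    change 0 ≤ A z * green B z
    rcases lt_trichotomy (side e z) 0 with hz | hz | hz
    · have hz' : 0 < side e (refl e z) := by rw [coe_refl, side_reflLIE]; linarith
      have := mul_nonneg (hA0 _ hz') (green_nonneg_of_odd hodd hB hz')
      rwa [hA, hG, neg_mul_neg] at this
    · have h1 : refl e z = z := Subtype.ext (reflLIE_of_side_eq_zero hz)
      have h2 := hA z
      rw [h1] at h2
      rw [show A z = 0 by linarith, zero_mul]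
    · exact mul_nonneg (hA0 z hz) (green_nonneg_of_odd hodd hB hz)
  have h0 := eq_zero_of_integ_eq_zero hnn (le_antisymm h (integ_nonneg hnn))
  by_contra! hcon
  obtain ⟨⟨x, hx, hx1, hxA⟩, y, hy, hy1, hyB⟩ := hcon
  have hp := green_pos_of_odd hodd hB hx hx1 hy hy1 (lt_of_le_of_ne (hB y hy) (Ne.symm hyB))
  have := DFunLike.congr_fun h0 x
  exact (mul_ne_zero hxA hp.ne') this

/-! ### Polarization -/

/-- The polarization of `u` with respect to the line spanned by `e`. -/
noncomputable def polarize (e : Circle) (u : C(D, ℝ)) : C(D, ℝ) where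
  toFun z := by
    classical exact if 0 ≤ side e z then max (u z) (u (refl e z)) else min (u z) (u (refl e z))
  continuous_toFun := by
    classical
    refine Continuous.if_le (by fun_prop) (by fun_prop) continuous_const
      ((continuous_side e).comp continuous_subtype_val) fun z hz => ?_
    have h1 : refl e z = z := Subtype.ext (reflLIE_of_side_eq_zero hz.symm)
    rw [h1, max_self, min_self]

theorem polarize_of_nonneg {u : C(D, ℝ)} {z : D} (h : 0 ≤ side e z) :
    polarize e u z = max (u z) (u (refl e z)) := if_pos h

theorem polarize_of_neg {u : C(D, ℝ)} {z : D} (h : side e z < 0) :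
    polarize e u z = min (u z) (u (refl e z)) := if_neg (not_le.2 h)

theorem polarize_cases (e : Circle) (u : C(D, ℝ)) (z : D) :
    (polarize e u z = u z ∧ polarize e u (refl e z) = u (refl e z)) ∨
      (polarize e u z = u (refl e z) ∧ polarize e u (refl e z) = u z) := by
  have hs : side e (refl e z) = -side e z := side_reflLIE e z
  rcases lt_trichotomy (side e z) 0 with hz | hz | hz
  · rw [polarize_of_neg hz, polarize_of_nonneg (z := refl e z) (by linarith), refl_refl]
    rcases le_total (u z) (u (refl e z)) with h | h <;> simp [h]
  · have h1 : refl e z = z := Subtype.ext (reflLIE_of_side_eq_zero hz)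
    rw [h1, polarize_of_nonneg hz.ge, h1, max_self]
    simp
  · rw [polarize_of_nonneg hz.le, polarize_of_neg (z := refl e z) (by linarith), refl_refl]
    rcases le_total (u z) (u (refl e z)) with h | h <;> simp [h]

theorem quart_polarize (b : ℕ) (e : Circle) (u : C(D, ℝ)) :
    quart b (polarize e u) = quart b u := by
  have h : ∀ v : C(D, ℝ), 2 * quart b v =
      integ (wt b * v ^ 4 + (wt b * v ^ 4).comp (refl e)) := fun v => by
    rw [map_add, integ_comp_refl, quart]; ring
  have h2 : wt b * polarize e u ^ 4 + (wt b * polarize e u ^ 4).comp (refl e) =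
      wt b * u ^ 4 + (wt b * u ^ 4).comp (refl e) := by
    ext z
    change wt b z * polarize e u z ^ 4 + wt b (refl e z) * polarize e u (refl e z) ^ 4 =
      wt b z * u z ^ 4 + wt b (refl e z) * u (refl e z) ^ 4
    rw [wt_refl]
    rcases polarize_cases e u z with ⟨h1, h2⟩ | ⟨h1, h2⟩ <;> rw [h1, h2]
    ring
  have h3 := h (polarize e u)
  rw [h2, ← h] at h3
  linarith

theorem energy_comp_refl (e : Circle) (f g : C(D, ℝ)) :
    energy (f.comp (refl e)) (g.comp (refl e)) = energy f g := by
  rw [energy, green_comp_refl, energy, ← integ_comp_refl e (f * green g)]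
  rfl

/-- Foliated comparison of a ground state with its reflections. -/
theorem IsGroundState.le_or_ge_refl {b : ℕ} {u : C(D, ℝ)} (hu : IsGroundState b u) (e : Circle) :
    (∀ z : D, 0 < side e z → ‖(z : ℂ)‖ < 1 → u (refl e z) ≤ u z) ∨
      ∀ z : D, 0 < side e z → ‖(z : ℂ)‖ < 1 → u z ≤ u (refl e z) := by
  set f := wt b * u ^ 3 with hf
  set p := wt b * polarize e u ^ 3 with hp
  have hdual : energy p p ≤ energy f f := hu.dual_le _ (quart_polarize b e u)
  have hfa : ∀ z, f z = wt b z * u z ^ 3 := fun z => rfl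
  have hpa : ∀ z, p z = wt b z * polarize e u z ^ 3 := fun z => rfl
  have hsum : p.comp (refl e) = f + f.comp (refl e) - p := by
    ext z
    change p (refl e z) = f z + f (refl e z) - p z
    rw [hpa, hpa, hfa, hfa, wt_refl]
    rcases polarize_cases e u z with ⟨h1, h2⟩ | ⟨h1, h2⟩ <;> rw [h1, h2] <;> ring
  have hsum' : ∀ z, p (refl e z) = f z + f (refl e z) - p z := fun z => DFunLike.congr_fun hsum z
  have hw : ∀ z, 0 ≤ wt b z := fun z => wt_nonneg b z
  have hE : energy (p - f) (p - f.comp (refl e)) = energy p p - energy f f := by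
    have e1 := energy_comp_refl e p p
    have e2 := energy_comp_refl e f f
    have e3 := energy_comp_refl e f p
    rw [hsum] at e1 e3
    simp only [energy_add_left, energy_add_right, energy_sub_left, energy_sub_right] at e1 e3 ⊢
    have c1 := energy_comm f p
    have c2 := energy_comm (f.comp (refl e)) p
    have c3 := energy_comm (f.comp (refl e)) f
    linarith
  have hpos : ∀ z : D, 0 < side e z → 0 ≤ p z - f z ∧ 0 ≤ p z - f (refl e z) := fun z hz => by
    have hmax := polarize_of_nonneg (u := u) hz.le
    rw [hpa, hfa, hfa, wt_refl, ← mul_sub, ← mul_sub]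
    have h0 : ∀ z, 0 ≤ u z := fun z => hu.nonneg z
    exact ⟨_root_.mul_nonneg (hw z) (sub_nonneg.2 (pow_le_pow_left₀ (h0 _)
      ((le_max_left _ _).trans_eq hmax.symm) 3)),
      _root_.mul_nonneg (hw z) (sub_nonneg.2 (pow_le_pow_left₀ (h0 _)
      ((le_max_right _ _).trans_eq hmax.symm) 3))⟩
  have hne : ∀ z : D, 0 < side e z → 0 < wt b z := fun z hz => wt_pos b fun h => by
    rw [h] at hz
    simp [side] at hz
  have hcancel : ∀ z y : D, 0 < side e z → wt b z * polarize e u z ^ 3 - wt b z * u y ^ 3 = 0 →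
      polarize e u z = u y := fun z y hz h => by
    rw [← mul_sub] at h
    exact (Odd.strictMono_pow (n := 3) ⟨1, rfl⟩).injective
      (sub_eq_zero.1 ((mul_eq_zero.1 h).resolve_left (hne z hz).ne'))
  refine (eq_zero_of_energy_nonpos (e := e) (A := p - f) (B := p - f.comp (refl e)) (fun z => ?_)
    (fun z => ?_) (fun z hz => (hpos z hz).1) (fun z hz => (hpos z hz).2) (by linarith)).imp
    (fun h z hz hz1 => ?_) (fun h z hz hz1 => ?_)
  · change p (refl e z) - f (refl e z) = -(p z - f z)
    rw [hsum']; ring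
  · change p (refl e z) - f (refl e (refl e z)) = -(p z - f (refl e z))
    rw [hsum', refl_refl]; ring
  · have h1 : p z - f z = 0 := h z hz hz1
    rw [← hcancel z z hz h1, polarize_of_nonneg hz.le]
    exact le_max_right _ _
  · have h1 : p z - f (refl e z) = 0 := h z hz hz1
    rw [hfa, wt_refl] at h1
    rw [← hcancel z _ hz h1, polarize_of_nonneg hz.le]
    exact le_max_left _ _

end Henon

namespace Henon

open Complex Metric Set Filter Topology

theorem const_of_local_const {h : ℝ → ℝ} {d : ℝ} (hd : 0 < d)
    (hloc : ∀ a b, a < b → b - a < d → h a = h b) (a b : ℝ) : h a = h b := by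
  wlog hab : a < b generalizing a b
  · rcases (not_lt.1 hab).eq_or_lt with h1 | h1
    · rw [h1]
    · exact (this b a h1).symm
  obtain ⟨n, hn⟩ := exists_nat_gt ((b - a) / d)
  have hn0 : (0 : ℝ) < n := (div_pos (sub_pos.2 hab) hd).trans hn
  set δ := (b - a) / n with hδ
  have hδ0 : 0 < δ := div_pos (sub_pos.2 hab) hn0
  have hδd : δ < d := by
    rw [hδ, div_lt_iff₀ hn0]; rw [div_lt_iff₀ hd] at hn; linarith
  have key : ∀ k : ℕ, h a = h (a + k * δ) := fun k => by
    induction k with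
    | zero => simp
    | succ k ih =>
      rw [ih]
      refine hloc _ _ ?_ ?_ <;> push_cast <;> linarith
  rw [key n, hδ, mul_div_cancel₀ _ hn0.ne']
  congr 1; ring

/-- The point with polar coordinates `(r, θ)`. -/
noncomputable def polarPt {r : ℝ} (hr : r ∈ Ioo (0 : ℝ) 1) (θ : ℝ) : D :=
  ⟨r * Circle.exp θ, by
    rw [mem_closedBall_zero_iff, norm_mul, Circle.norm_coe, mul_one, Complex.norm_real,
      Real.norm_of_nonneg hr.1.le]
    exact hr.2.le⟩

theorem coe_polarPt {r : ℝ} (hr : r ∈ Ioo (0 : ℝ) 1) (θ : ℝ) :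
    (polarPt hr θ : ℂ) = r * Circle.exp θ := rfl

theorem norm_polarPt {r : ℝ} (hr : r ∈ Ioo (0 : ℝ) 1) (θ : ℝ) : ‖(polarPt hr θ : ℂ)‖ = r := by
  rw [coe_polarPt, norm_mul, Circle.norm_coe, mul_one, Complex.norm_real,
      Real.norm_of_nonneg hr.1.le]

theorem conj_circle_exp (θ : ℝ) :
    starRingEnd ℂ (Circle.exp θ : ℂ) = (Circle.exp (-θ) : ℂ) := by
  rw [Circle.exp_neg, Circle.coe_inv_eq_conj]

theorem refl_polarPt {r : ℝ} (hr : r ∈ Ioo (0 : ℝ) 1) (φ θ : ℝ) :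
    refl (Circle.exp φ) (polarPt hr θ) = polarPt hr (2 * φ - θ) := by
  apply Subtype.ext
  rw [coe_refl, reflLIE_apply, coe_polarPt, coe_polarPt, map_mul, Complex.conj_ofReal,
    conj_circle_exp, two_mul, sub_eq_add_neg, Circle.exp_add, Circle.exp_add]
  push_cast
  ring

theorem side_polarPt {r : ℝ} (hr : r ∈ Ioo (0 : ℝ) 1) (φ θ : ℝ) :
    side (Circle.exp φ) (polarPt hr θ) = r * Real.sin (θ - φ) := by
  rw [side, coe_polarPt, conj_circle_exp, mul_assoc, ← Circle.coe_mul, ← Circle.exp_add,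
    Circle.coe_exp, Complex.im_ofReal_mul, Complex.exp_ofReal_mul_I_im, sub_eq_add_neg]

/-- A ground state which is invariant under a nontrivial rotation is radial. -/
theorem IsGroundState.radial {b : ℕ} {u : C(D, ℝ)} (hu : IsGroundState b u) {γ : ℝ}
    (h0 : 0 < γ) (hπ : γ ≤ Real.pi)
    (hinv : ∀ z w : D, ‖(z : ℂ)‖ < 1 → (w : ℂ) = Circle.exp γ * z → u w = u z)
    {z w : D} (hz : ‖(z : ℂ)‖ < 1) (hzw : ‖(z : ℂ)‖ = ‖(w : ℂ)‖) : u z = u w := by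
  rcases (norm_nonneg (z : ℂ)).eq_or_lt with hz0 | hz0
  · have h1 : (z : ℂ) = 0 := norm_eq_zero.1 hz0.symm
    have h2 : (w : ℂ) = 0 := norm_eq_zero.1 (hzw ▸ hz0.symm)
    rw [Subtype.ext (h1.trans h2.symm)]
  set r := ‖(z : ℂ)‖ with hrz
  have hr : r ∈ Ioo (0 : ℝ) 1 := ⟨hz0, hz⟩
  have hper : ∀ θ, u (polarPt hr (θ + γ)) = u (polarPt hr θ) := fun θ => by
    refine hinv _ _ (by rw [norm_polarPt]; exact hz) ?_
    rw [coe_polarPt, coe_polarPt, Circle.exp_add, Circle.coe_mul]; ring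
  have hloc : ∀ θ t, 0 < t → t < γ → u (polarPt hr (θ - t)) = u (polarPt hr (θ + t)) := by
    intro θ t ht htγ
    have e1 : 0 < side (Circle.exp θ) (polarPt hr (θ + t)) := by
      rw [side_polarPt, add_sub_cancel_left]
      exact mul_pos hr.1 (Real.sin_pos_of_pos_of_lt_pi ht (by linarith))
    have e2 : 0 < side (Circle.exp θ) (polarPt hr (θ - t + γ)) := by
      rw [side_polarPt]
      exact mul_pos hr.1 (Real.sin_pos_of_pos_of_lt_pi (by linarith) (by linarith))
    have n1 : ∀ θ, ‖(polarPt hr θ : ℂ)‖ < 1 := fun θ => by rw [norm_polarPt]; exact hz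
    have e3 : 2 * θ - (θ + t) = θ - t := by ring
    have e4 : u (polarPt hr (2 * θ - (θ - t + γ))) = u (polarPt hr (θ + t)) := by
      rw [← hper]; congr 2; ring
    rcases hu.le_or_ge_refl (Circle.exp θ) with H | H
    · have H1 := H _ e1 (n1 _)
      have H2 := H _ e2 (n1 _)
      rw [refl_polarPt, e3] at H1
      rw [refl_polarPt, e4, hper] at H2
      exact le_antisymm H1 H2
    · have H1 := H _ e1 (n1 _)
      have H2 := H _ e2 (n1 _)
      rw [refl_polarPt, e3] at H1
      rw [refl_polarPt, e4, hper] at H2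
      exact le_antisymm H2 H1
  have hconst := const_of_local_const (h := fun θ => u (polarPt hr θ)) (d := 2 * γ) (by linarith)
    fun a b hab hd => by
      have := hloc ((a + b) / 2) ((b - a) / 2) (by linarith) (by linarith)
      rwa [show (a + b) / 2 - (b - a) / 2 = a by ring,
        show (a + b) / 2 + (b - a) / 2 = b by ring] at this
  have hpt : ∀ x : D, ‖(x : ℂ)‖ = r → polarPt hr (arg x) = x := fun x hx => Subtype.ext <| by
    rw [coe_polarPt, ← hx, Circle.coe_exp, Complex.norm_mul_exp_arg_mul_I]
  rw [← hpt z rfl, ← hpt w hzw.symm]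
  exact hconst _ _

namespace IsHenonSolution

variable {b : ℕ} {U : C(D, ℝ)} {u : ℝ × ℝ → ℝ}

theorem radial (hu : IsHenonSolution b U u) {β : ℝ} (hβ : Complex.exp (β * I) ≠ 1)
    (hinv : ∀ q ∈ unitDisk, u (rot β q) = u q) {p q : ℝ × ℝ} (hp : p ∈ unitDisk)
    (hpq : p.1 ^ 2 + p.2 ^ 2 = q.1 ^ 2 + q.2 ^ 2) : u p = u q := by
  have hrot : ∀ z : ℂ, rot β (z.re, z.im) = ((Circle.exp β * z : ℂ).re, (Circle.exp β * z : ℂ).im) :=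
    fun z => by
      rw [rot, Circle.coe_exp, Complex.mul_re, Complex.mul_im, Complex.exp_ofReal_mul_I_re,
        Complex.exp_ofReal_mul_I_im]
      refine Prod.ext ?_ ?_ <;> ring
  have hU : ∀ z w : D, ‖(z : ℂ)‖ < 1 → (w : ℂ) = Circle.exp β * z → U w = U z := by
    intro z w hz hw
    rw [← hu.eq, ← hu.eq, ← hinv _ ((mem_unitDisk_iff z).2 hz), hrot, ← hw]
  have hq : q.1 ^ 2 + q.2 ^ 2 ≤ 1 := hpq ▸ le_of_lt hp
  obtain ⟨z, rfl⟩ := exists_mem_D (le_of_lt hp)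
  obtain ⟨w, rfl⟩ := exists_mem_D hq
  have hz := (mem_unitDisk_iff _).1 hp
  have hzw : ‖(z : ℂ)‖ = ‖(w : ℂ)‖ := by
    rw [← sq_eq_sq₀ (norm_nonneg _) (norm_nonneg _), ← Complex.normSq_eq_norm_sq,
      ← Complex.normSq_eq_norm_sq, Complex.normSq_apply, Complex.normSq_apply]
    simpa only [sq] using hpq
  rw [hu.eq, hu.eq]
  set γ := arg (Circle.exp β : ℂ) with hγ
  have hexp : Circle.exp γ = Circle.exp β := Circle.exp_arg _
  have hne : γ ≠ 0 := fun h => hβ <| by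
    rw [h, Circle.exp_zero] at hexp
    rw [← Circle.coe_exp, ← hexp, Circle.coe_one]
  rw [← hexp] at hU
  rcases hne.lt_or_gt with hneg | hpos
  · refine hu.ground.radial (γ := -γ) (by linarith) (by linarith [neg_pi_lt_arg (Circle.exp β : ℂ)])
      (fun z w hz hw => ?_) hz hzw
    have h1 : (z : ℂ) = Circle.exp γ * w := by
      rw [hw, ← mul_assoc, ← Circle.coe_mul, ← Circle.exp_add]; simp
    refine (hU w z ?_ h1).symm
    rwa [hw, norm_mul, Circle.norm_coe, one_mul]
  · exact hu.ground.radial hpos (arg_le_pi _) hU hz hzw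

end IsHenonSolution

end Henon

namespace Henon

open Complex Metric Set Filter Topology

/-! ### The radial Emden–Fowler equation -/

theorem multiplier_pos_four {p q : ℝ} (hq : 0 < q) (hqa : q ≤ 4)
    (h1 : 4 ≤ q + 3 / 2 * p) (h2 : q * (p + 8 / 3) ≤ 32 / 3) :
    0 < -4 + 2 * p + 2 * (p * q) + 3 / 5 * (6 * q - 5 * (p * q) - q ^ 2) := by
  rcases le_total q 2 with h | h
  · nlinarith [mul_nonneg (sub_nonneg.2 h1) (sub_nonneg.2 h)]
  · have h3 : 0 ≤ (q - 5 / 2) ^ 2 * (49 / 15 - 3 / 5 * q) :=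
      mul_nonneg (sq_nonneg _) (by linarith)
    have h4 := mul_nonneg (sub_nonneg.2 h2) (sub_nonneg.2 h)
    have h5 : 0 < q * (-4 + 2 * p + 2 * (p * q) + 3 / 5 * (6 * q - 5 * (p * q) - q ^ 2)) := by
      nlinarith
    exact pos_of_mul_pos_right h5 hq.le |> fun h => by simpa using h

theorem multiplier_pos_six_eight {a p q : ℝ} (ha : a = 6 ∨ a = 8) (hq : 0 < q) (hqa : q ≤ a)
    (h1 : a ≤ q + 3 / 2 * p) :
    0 < -4 + 2 * p + 2 * (p * q) + 2 / 5 * ((a + 2) * q - 5 * (p * q) - q ^ 2) := by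
  rcases ha with rfl | rfl <;> nlinarith [mul_nonneg hq.le (sub_nonneg.2 hqa)]

theorem exists_multiplier {a : ℕ} (ha : a = 4 ∨ a = 6 ∨ a = 8) :
    ∃ β : ℝ, 0 ≤ β ∧ ∀ p q : ℝ, 0 < p → 0 < q → q ≤ a → a ≤ q + 3 / 2 * p →
      q * (p + 2 * a / 3) ≤ 2 * (a : ℝ) ^ 2 / 3 →
      0 < -4 + 2 * p + 2 * (p * q) + β * ((a + 2) * q - 5 * (p * q) - q ^ 2) := by
  rcases ha with rfl | ha
  · refine ⟨3 / 5, by norm_num, fun p q _ hq hqa h1 h2 => ?_⟩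
    push_cast at *
    have := multiplier_pos_four hq hqa h1 (by linarith)
    linarith
  · refine ⟨2 / 5, by norm_num, fun p q _ hq hqa h1 _ => ?_⟩
    refine multiplier_pos_six_eight ?_ hq hqa h1
    rcases ha with rfl | rfl <;> norm_num

/-- Positive solutions of the radial equation, written as a first order system. -/
structure IsRadialSolution (a : ℕ) (f m : ℝ → ℝ) : Prop where
  cont : Continuous f
  cont' : Continuous m
  pos : ∀ r ∈ Ico (0 : ℝ) 1, 0 < f r
  one : f 1 = 0
  zero : m 0 = 0
  deriv : ∀ r ∈ Ioo (0 : ℝ) 1, HasDerivAt f (-m r / r) r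
  deriv' : ∀ r ∈ Ioo (0 : ℝ) 1, HasDerivAt m (r ^ a * f r ^ 3 / r) r

namespace IsRadialSolution

variable {a : ℕ} {f m : ℝ → ℝ}

theorem flux_pos (h : IsRadialSolution a f m) {r : ℝ} (hr : r ∈ Ioc (0 : ℝ) 1) : 0 < m r := by
  have hmono : StrictMonoOn m (Icc 0 1) :=
    strictMonoOn_of_hasDerivWithinAt_pos (convex_Icc 0 1) h.cont'.continuousOn
      (fun r hr => (h.deriv' r (by simpa using hr)).hasDerivWithinAt) fun r hr => by
        rw [interior_Icc] at hr
        have := h.pos r ⟨hr.1.le, hr.2⟩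
        have := hr.1
        positivity
  have := hmono (by simp) ⟨hr.1.le, hr.2⟩ hr.1
  rwa [h.zero] at this

theorem deriv_source (h : IsRadialSolution a f m) (ha : a ≠ 0) {r : ℝ} (hr : r ∈ Ioo (0 : ℝ) 1) :
    HasDerivAt (fun r => r ^ a * f r ^ 3)
      ((a * (r ^ a * f r ^ 3) - 3 * (r ^ a * f r ^ 3) * (m r / f r)) / r) r := by
  have h0 := hr.1
  have hf := h.pos r ⟨hr.1.le, hr.2⟩
  refine ((hasDerivAt_pow a r).mul ((h.deriv r hr).pow 3)).congr_deriv ?_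
  obtain ⟨n, rfl⟩ := Nat.exists_eq_succ_of_ne_zero ha
  simp only [Nat.succ_eq_add_one, Nat.add_sub_cancel, Pi.pow_apply, pow_succ]
  field_simp
  push_cast
  ring

theorem source_le (h : IsRadialSolution a f m) (ha : a ≠ 0) {r : ℝ} (hr : r ∈ Icc (0 : ℝ) 1) :
    r ^ a * f r ^ 3 ≤ a * m r := by
  have c1 := h.cont
  have c2 := h.cont'
  have hmono : MonotoneOn (fun r => a * m r - r ^ a * f r ^ 3) (Icc 0 1) :=
    monotoneOn_of_hasDerivWithinAt_nonneg (convex_Icc 0 1) (by fun_prop)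
      (fun r hr => (((h.deriv' r (by simpa using hr)).const_mul (a : ℝ)).sub
        (h.deriv_source ha (by simpa using hr))).hasDerivWithinAt) fun r hr => by
        rw [interior_Icc] at hr
        have h0 := hr.1
        have hf := h.pos r ⟨hr.1.le, hr.2⟩
        have hm := h.flux_pos ⟨hr.1, hr.2.le⟩
        have : 0 ≤ 3 * (r ^ a * f r ^ 3) * (m r / f r) / r := by positivity
        refine this.trans_eq ?_
        ring
  have := hmono (by simp) hr hr.1
  simp only [h.zero, zero_pow ha] at this
  linarith

theorem flux_mul_le (h : IsRadialSolution a f m) (ha : a ≠ 0) {r : ℝ} (hr : r ∈ Icc (0 : ℝ) 1) :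
    a * (m r * f r) ≤ r ^ a * f r ^ 3 * f r + 3 / 2 * m r ^ 2 := by
  have c1 := h.cont
  have c2 := h.cont'
  have hmono : MonotoneOn (fun r => r ^ a * f r ^ 3 * f r + 3 / 2 * m r ^ 2 - a * (m r * f r))
      (Icc 0 1) :=
    monotoneOn_of_hasDerivWithinAt_nonneg (convex_Icc 0 1) (by fun_prop)
      (fun r hr => ((((h.deriv_source ha (by simpa using hr)).mul
        (h.deriv r (by simpa using hr))).add
        (((h.deriv' r (by simpa using hr)).pow 2).const_mul (3 / 2 : ℝ))).sub
        (((h.deriv' r (by simpa using hr)).mul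
        (h.deriv r (by simpa using hr))).const_mul (a : ℝ))).hasDerivWithinAt) fun r hr => by
        rw [interior_Icc] at hr
        have h0 := hr.1
        have hf := h.pos r ⟨hr.1.le, hr.2⟩
        have hm := h.flux_pos ⟨hr.1, hr.2.le⟩
        have h1 := h.source_le ha ⟨hr.1.le, hr.2.le⟩
        have : 0 ≤ m r * (a * m r - r ^ a * f r ^ 3) / r :=
          div_nonneg (mul_nonneg hm.le (by linarith)) h0.le
        refine this.trans_eq ?_
        field_simp
        ring
  have := hmono (by simp) hr hr.1
  simp only [h.zero, zero_pow ha] at this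
  linarith

variable (a f m) in
/-- The logarithmic derivative of `-m`. -/
noncomputable def quot (r : ℝ) : ℝ := r ^ a * f r ^ 3 / m r

theorem hasDerivAt_quot (h : IsRadialSolution a f m) (ha : a ≠ 0) {r : ℝ}
    (hr : r ∈ Ioo (0 : ℝ) 1) :
    HasDerivAt (quot a f m) (quot a f m r * (a - 3 * (m r / f r) - quot a f m r) / r) r := by
  have h0 := hr.1
  have hf := h.pos r ⟨hr.1.le, hr.2⟩
  have hm := h.flux_pos ⟨hr.1, hr.2.le⟩
  refine ((h.deriv_source ha hr).div (h.deriv' r hr) hm.ne').congr_deriv ?_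
  rw [quot]
  field_simp

theorem quot_pos (h : IsRadialSolution a f m) {r : ℝ} (hr : r ∈ Ioo (0 : ℝ) 1) :
    0 < quot a f m r := by
  have h0 := hr.1
  have hf := h.pos r ⟨hr.1.le, hr.2⟩
  have hm := h.flux_pos ⟨hr.1, hr.2.le⟩
  unfold quot
  positivity

theorem quot_le (h : IsRadialSolution a f m) (ha : a ≠ 0) {r : ℝ} (hr : r ∈ Ioc (0 : ℝ) 1) :
    quot a f m r ≤ a := by
  rw [quot, div_le_iff₀ (h.flux_pos hr)]
  exact h.source_le ha ⟨hr.1.le, hr.2⟩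

theorem le_quot_add (h : IsRadialSolution a f m) (ha : a ≠ 0) {r : ℝ} (hr : r ∈ Ioo (0 : ℝ) 1) :
    a ≤ quot a f m r + 3 / 2 * (m r / f r) := by
  have hf := h.pos r ⟨hr.1.le, hr.2⟩
  have hm := h.flux_pos ⟨hr.1, hr.2.le⟩
  have h1 := h.flux_mul_le ha ⟨hr.1.le, hr.2.le⟩
  have h2 : quot a f m r + 3 / 2 * (m r / f r) =
      (r ^ a * f r ^ 3 * f r + 3 / 2 * m r ^ 2) / (m r * f r) := by
    rw [quot]
    field_simp
  rw [h2, le_div_iff₀ (mul_pos hm hf)]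
  exact h1

theorem quot_mul_le (h : IsRadialSolution a f m) (ha : a ≠ 0) {r : ℝ} (hr : r ∈ Ioo (0 : ℝ) 1) :
    quot a f m r * (m r / f r + 2 * a / 3) ≤ 2 * (a : ℝ) ^ 2 / 3 := by
  have hanti : AntitoneOn (fun r => quot a f m r * (m r / f r + 2 * a / 3)) (Ioo 0 1) := by
    have hd : ∀ r ∈ Ioo (0 : ℝ) 1, HasDerivAt (fun r => quot a f m r * (m r / f r + 2 * a / 3))
        (-(quot a f m r * (2 * (m r / f r) ^ 2 +
          2 * a / 3 * (quot a f m r + 3 / 2 * (m r / f r) - a)) / r)) r := by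
      intro r hr
      have h0 := hr.1
      have hf := h.pos r ⟨hr.1.le, hr.2⟩
      have hm := h.flux_pos ⟨hr.1, hr.2.le⟩
      refine ((h.hasDerivAt_quot ha hr).mul (((h.deriv' r hr).div (h.deriv r hr) hf.ne').add_const
        (2 * a / 3 : ℝ))).congr_deriv ?_
      have e1 : r ^ a * f r ^ 3 = quot a f m r * m r := by rw [quot, div_mul_cancel₀ _ hm.ne']
      simp only [e1, Pi.div_apply]
      field_simp
      ring
    refine antitoneOn_of_hasDerivWithinAt_nonpos (convex_Ioo 0 1)
      (fun r hr => (hd r hr).continuousAt.continuousWithinAt)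
      (fun r hr => (hd r (by simpa using hr)).hasDerivWithinAt) fun r hr => ?_
    rw [interior_Ioo] at hr
    have h0 := hr.1
    have hf := h.pos r ⟨hr.1.le, hr.2⟩
    have hm := h.flux_pos ⟨hr.1, hr.2.le⟩
    have hq := h.quot_pos hr
    have h3 : 0 ≤ quot a f m r + 3 / 2 * (m r / f r) - a := sub_nonneg.2 (h.le_quot_add ha hr)
    rw [neg_nonpos]
    positivity
  have ht : Tendsto (fun r => (a : ℝ) * (m r / f r + 2 * a / 3)) (𝓝[>] 0)
      (𝓝 (a * (m 0 / f 0 + 2 * a / 3))) := by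
    have : ContinuousAt (fun r => (a : ℝ) * (m r / f r + 2 * a / 3)) 0 :=
      ((h.cont'.continuousAt.div h.cont.continuousAt (h.pos 0 (by simp)).ne').add
        continuousAt_const).const_mul _
    exact this.tendsto.mono_left nhdsWithin_le_nhds
  rw [h.zero, zero_div, zero_add, show (a : ℝ) * (2 * a / 3) = 2 * (a : ℝ) ^ 2 / 3 by ring] at ht
  refine ge_of_tendsto ht ?_
  filter_upwards [Ioo_mem_nhdsGT hr.1] with s hs
  have hs1 : s ∈ Ioo (0 : ℝ) 1 := ⟨hs.1, hs.2.trans hr.2⟩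
  refine (hanti hs1 hr hs.2.le).trans ?_
  have hf := h.pos s ⟨hs1.1.le, hs1.2⟩
  have hm := h.flux_pos ⟨hs1.1, hs1.2.le⟩
  exact mul_le_mul_of_nonneg_right (h.quot_le ha ⟨hs1.1, hs1.2.le⟩) (by positivity)

theorem integral_pos (h : IsRadialSolution a f m) (ha : a = 4 ∨ a = 6 ∨ a = 8) :
    0 < ∫ r in (0 : ℝ)..1, (r ^ a * f r ^ 4 - f r ^ 2) * r := by
  have ha0 : a ≠ 0 := by omega
  have c1 := h.cont
  have c2 := h.cont'
  obtain ⟨β, hβ, hF⟩ := exists_multiplier ha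
  set T : ℝ → ℝ := fun r => (1 - β * quot a f m r) * (f r * r) ^ 2 with hT
  set S : ℝ → ℝ := fun r => ∫ s in (0 : ℝ)..r, (s ^ a * f s ^ 4 - f s ^ 2) * s with hS
  have hSd : ∀ r, HasDerivAt S ((r ^ a * f r ^ 4 - f r ^ 2) * r) r := fun r =>
    intervalIntegral.integral_hasDerivAt_right
      (Continuous.intervalIntegrable (by fun_prop) _ _)
      (Continuous.stronglyMeasurableAtFilter (by fun_prop) _ _)
      (Continuous.continuousAt (by fun_prop))
  have hT0 : T 0 = 0 := by simp [hT]
  have hT1 : T 1 = 0 := by simp [hT, h.one]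
  have hTd : ∀ r ∈ Ioo (0 : ℝ) 1, HasDerivAt T ((f r * r) ^ 2 * (2 - 2 * (m r / f r) -
      β * ((a + 2) * quot a f m r - 5 * (m r / f r * quot a f m r) - quot a f m r ^ 2)) / r) r := by
    intro r hr
    have h0 := hr.1
    have hf := h.pos r ⟨hr.1.le, hr.2⟩
    refine ((((h.hasDerivAt_quot ha0 hr).const_mul β).const_sub 1).mul
      (((h.deriv r hr).mul (hasDerivAt_id r)).pow 2)).congr_deriv ?_
    simp only [id, Pi.mul_apply, Pi.pow_apply]
    field_simp
    push_cast
    ring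
  have hTc : ContinuousOn T (Icc 0 1) := by
    intro r hr
    rcases hr.1.eq_or_lt with rfl | h0
    · have hlim : Tendsto (fun r => (1 + β * a) * (f r * r) ^ 2) (𝓝[Icc 0 1] 0) (𝓝 0) := by
        have : Continuous fun r => (1 + β * a) * (f r * r) ^ 2 := by fun_prop
        have h1 := this.tendsto 0
        simp only [mul_zero, zero_pow two_ne_zero] at h1
        exact h1.mono_left nhdsWithin_le_nhds
      rw [ContinuousWithinAt, hT0]
      refine squeeze_zero_norm' ?_ hlim
      filter_upwards [self_mem_nhdsWithin] with s hs
      rw [Real.norm_eq_abs, hT, abs_mul, abs_of_nonneg (sq_nonneg (f s * s))]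
      refine mul_le_mul_of_nonneg_right ?_ (sq_nonneg _)
      have hq0 : 0 ≤ quot a f m s ∧ quot a f m s ≤ a := by
        rcases hs.1.eq_or_lt with rfl | hs0
        · simp [quot, h.zero]
        · refine ⟨?_, h.quot_le ha0 ⟨hs0, hs.2⟩⟩
          rcases hs.2.eq_or_lt with rfl | hs1
          · simp [quot, h.one]
          · exact (h.quot_pos ⟨hs0, hs1⟩).le
      have h1 := mul_nonneg hβ hq0.1
      have h2 := mul_le_mul_of_nonneg_left hq0.2 hβ
      rw [abs_le]
      constructor <;> linarith
    · have hm := h.flux_pos ⟨h0, hr.2⟩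
      refine ContinuousAt.continuousWithinAt ?_
      refine ContinuousAt.mul (continuousAt_const.sub (continuousAt_const.mul ?_))
        (Continuous.continuousAt (by fun_prop))
      exact ContinuousAt.div (Continuous.continuousAt (by fun_prop)) c2.continuousAt hm.ne'
  have hmono : StrictMonoOn (fun r => 2 * S r - T r) (Icc 0 1) := by
    refine strictMonoOn_of_hasDerivWithinAt_pos (convex_Icc 0 1)
      ((Continuous.continuousOn (continuous_const.mul
        (continuous_iff_continuousAt.2 fun r => (hSd r).continuousAt))).sub hTc)
      (fun r hr => (((hSd r).const_mul 2).sub (hTd r (by simpa using hr))).hasDerivWithinAt)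
      fun r hr => ?_
    rw [interior_Icc] at hr
    have h0 := hr.1
    have hf := h.pos r ⟨hr.1.le, hr.2⟩
    have hm := h.flux_pos ⟨hr.1, hr.2.le⟩
    have key := hF (m r / f r) (quot a f m r) (by positivity) (h.quot_pos hr)
      (h.quot_le ha0 ⟨hr.1, hr.2.le⟩) (h.le_quot_add ha0 hr) (h.quot_mul_le ha0 hr)
    have h1 : 0 < f r ^ 2 * r * (-4 + 2 * (m r / f r) + 2 * (m r / f r * quot a f m r) +
      β * ((a + 2) * quot a f m r - 5 * (m r / f r * quot a f m r) - quot a f m r ^ 2)) := by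
      positivity
    refine h1.trans_eq ?_
    have e1 : r ^ a * f r ^ 3 = quot a f m r * m r := by rw [quot, div_mul_cancel₀ _ hm.ne']
    have e2 : r ^ a * f r ^ 4 = quot a f m r * m r * f r := by rw [← e1]; ring
    rw [e2]
    field_simp
    ring
  have := hmono (by simp : (0 : ℝ) ∈ Icc (0 : ℝ) 1) (by simp : (1 : ℝ) ∈ Icc (0 : ℝ) 1) one_pos
  simp only [hT0, hT1, hS, intervalIntegral.integral_same] at this
  linarith

end IsRadialSolution

end Henon

namespace Henon

open Complex Metric Set Filter Topology

/-! ### The solution is not radial -/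

namespace IsHenonSolution

variable {b : ℕ} {U : C(D, ℝ)} {u : ℝ × ℝ → ℝ}

theorem fst_mul_dir_eq (hu : IsHenonSolution b U u)
    (hrad : ∀ p ∈ unitDisk, ∀ q : ℝ × ℝ, p.1 ^ 2 + p.2 ^ 2 = q.1 ^ 2 + q.2 ^ 2 → u p = u q)
    {p : ℝ × ℝ} (hp : p ∈ unitDisk) : p.1 * dir (0, 1) u p = p.2 * dir (1, 0) u p := by
  have h1 : HasDerivAt (fun θ : ℝ => rot θ p) (-p.2, p.1) 0 := by
    refine ((((Real.hasDerivAt_cos 0).const_mul p.1).sub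
      ((Real.hasDerivAt_sin 0).const_mul p.2)).prodMk
      (((Real.hasDerivAt_sin 0).const_mul p.1).add
      ((Real.hasDerivAt_cos 0).const_mul p.2))).congr_deriv ?_
    simp
  have h0 : rot 0 p = p := by simp [rot]
  have h2 : HasFDerivAt u (fderiv ℝ u p) (rot 0 p) := by
    rw [h0]
    exact (hu.smooth.differentiable (by simp) p).hasFDerivAt
  have h3 := h2.comp_hasDerivAt (0 : ℝ) h1
  have h4 : u ∘ (fun θ : ℝ => rot θ p) = fun _ => u p := by
    ext θ
    refine (hrad p hp _ ?_).symm
    have := Real.sin_sq_add_cos_sq θ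
    simp only [rot]
    linear_combination (-(p.1 ^ 2 + p.2 ^ 2)) * this
  rw [h4] at h3
  have h5 := h3.unique (hasDerivAt_const (0 : ℝ) (u p))
  have h6 : ((-p.2, p.1) : ℝ × ℝ) = (-p.2) • ((1 : ℝ), (0 : ℝ)) + p.1 • ((0 : ℝ), (1 : ℝ)) := by
    simp
  rw [h6, map_add, map_smul, map_smul, smul_eq_mul, smul_eq_mul] at h5
  simp only [dir]
  linarith

theorem mul_dir_dir_eq (hu : IsHenonSolution b U u)
    (hrad : ∀ p ∈ unitDisk, ∀ q : ℝ × ℝ, p.1 ^ 2 + p.2 ^ 2 = q.1 ^ 2 + q.2 ^ 2 → u p = u q)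
    {r : ℝ} (hr : (r, (0 : ℝ)) ∈ unitDisk) :
    r * dir (0, 1) (dir (0, 1) u) (r, 0) = dir (1, 0) u (r, 0) := by
  have h1 : EqOn (Prod.fst * dir (0, 1) u) (Prod.snd * dir (1, 0) u) unitDisk :=
    fun p hp => hu.fst_mul_dir_eq hrad hp
  have h2 := dir_congr_of_eqOn isOpen_unitDisk h1 (0, 1) hr
  rw [dir_mul contDiff_fst (contDiff_dir hu.smooth _),
    dir_mul contDiff_snd (contDiff_dir hu.smooth _)] at h2
  simpa [dir, fderiv_fst, fderiv_snd] using h2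

theorem hasDerivAt_dir {g : ℝ × ℝ → ℝ} (hg : Differentiable ℝ g) (r : ℝ) :
    HasDerivAt (fun r => g (r, 0)) (dir (1, 0) g (r, 0)) r :=
  (hg (r, 0)).hasFDerivAt.comp_hasDerivAt r ((hasDerivAt_id r).prodMk (hasDerivAt_const r (0 : ℝ)))

theorem isRadialSolution (hu : IsHenonSolution b U u)
    (hrad : ∀ p ∈ unitDisk, ∀ q : ℝ × ℝ, p.1 ^ 2 + p.2 ^ 2 = q.1 ^ 2 + q.2 ^ 2 → u p = u q) :
    IsRadialSolution (2 * b + 2) (fun r => u (r, 0)) (fun r => -(r * dir (1, 0) u (r, 0))) where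
  cont := hu.smooth.continuous.comp (by fun_prop)
  cont' := (continuous_id.mul
    ((contDiff_dir hu.smooth (1, 0)).continuous.comp (by fun_prop : Continuous fun r : ℝ =>
      (r, (0 : ℝ))))).neg
  pos r hr := hu.pos (by
    change r ^ 2 + 0 ^ 2 < 1
    nlinarith [hr.1, hr.2])
  one := hu.boundary (by norm_num)
  zero := by simp
  deriv r hr := by
    have h0 := hr.1
    refine (hasDerivAt_dir (hu.smooth.differentiable (by simp)) r).congr_deriv ?_
    field_simp
  deriv' r hr := by
    have h0 := hr.1
    have hmem : (r, (0 : ℝ)) ∈ unitDisk := by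
      change r ^ 2 + 0 ^ 2 < 1
      nlinarith [hr.1, hr.2]
    refine ((hasDerivAt_id r).mul (hasDerivAt_dir
      ((contDiff_dir hu.smooth (1, 0)).differentiable (by simp)) r)).neg.congr_deriv ?_
    have h1 := hu.lapl_eq hmem
    have h2 := hu.mul_dir_dir_eq hrad hmem
    rw [lapl] at h1
    simp only [weight] at h1
    rw [zero_pow two_ne_zero, add_zero, ← pow_mul] at h1
    rw [eq_div_iff h0.ne', pow_add]
    simp only [id]
    linear_combination (-r ^ 2) * h1 + r * h2

theorem not_radial (hu : IsHenonSolution b U u) (hb : b = 1 ∨ b = 2 ∨ b = 3)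
    (hrad : ∀ p ∈ unitDisk, ∀ q : ℝ × ℝ, p.1 ^ 2 + p.2 ^ 2 = q.1 ^ 2 + q.2 ^ 2 → u p = u q) :
    False := by
  have hpos := (hu.isRadialSolution hrad).integral_pos (by omega)
  have hle := hu.integral_sq_le fun p hp => (hrad p hp _ (by simp)).symm
  have hc := hu.smooth.continuous
  have hw := (contDiff_weight b).continuous
  rw [setIntegral_unitDisk, integral_D (fun z : ℂ => u (z.re, z.im) ^ 2 -
    2 * (weight b (z.re, z.im) * z.re ^ 2 * u (z.re, z.im) ^ 4)),
    integral_closedBall_polar (ContinuousOn.integrableOn_compact (isCompact_closedBall _ _)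
      (Continuous.continuousOn (by fun_prop)))] at hle
  have hval : ∀ r ∈ uIcc (0 : ℝ) 1, (r • ∫ θ in (-Real.pi)..Real.pi,
      (u ((r * Complex.exp (θ * I)).re, (r * Complex.exp (θ * I)).im) ^ 2 -
        2 * (weight b ((r * Complex.exp (θ * I)).re, (r * Complex.exp (θ * I)).im) *
          (r * Complex.exp (θ * I)).re ^ 2 *
          u ((r * Complex.exp (θ * I)).re, (r * Complex.exp (θ * I)).im) ^ 4))) =
      -(2 * Real.pi) * ((r ^ (2 * b + 2) * u (r, 0) ^ 4 - u (r, 0) ^ 2) * r) := by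
    intro r hr
    rw [uIcc_of_le zero_le_one] at hr
    have hin : ∀ θ : ℝ, (u ((r * Complex.exp (θ * I)).re, (r * Complex.exp (θ * I)).im) ^ 2 -
        2 * (weight b ((r * Complex.exp (θ * I)).re, (r * Complex.exp (θ * I)).im) *
          (r * Complex.exp (θ * I)).re ^ 2 *
          u ((r * Complex.exp (θ * I)).re, (r * Complex.exp (θ * I)).im) ^ 4)) =
        u (r, 0) ^ 2 - 2 * (r ^ (2 * b + 2) * u (r, 0) ^ 4) * Real.cos θ ^ 2 := by
      intro θ
      rw [Complex.re_ofReal_mul, Complex.im_ofReal_mul, Complex.exp_ofReal_mul_I_re,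
        Complex.exp_ofReal_mul_I_im]
      have hsq : (r * Real.cos θ) ^ 2 + (r * Real.sin θ) ^ 2 = r ^ 2 := by
        linear_combination r ^ 2 * Real.sin_sq_add_cos_sq θ
      have hue : u (r * Real.cos θ, r * Real.sin θ) = u (r, 0) := by
        rcases hr.2.lt_or_eq with h | rfl
        · refine (hrad (r, 0) ?_ _ ?_).symm
          · change r ^ 2 + 0 ^ 2 < 1
            nlinarith [hr.1]
          · simp [hsq]
        · rw [hu.boundary (by simp), hu.boundary (by norm_num)]
      rw [hue, weight, hsq, ← pow_mul]
      ring
    simp_rw [hin]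
    rw [intervalIntegral.integral_sub (Continuous.intervalIntegrable (by fun_prop) _ _)
      (Continuous.intervalIntegrable (by fun_prop) _ _), intervalIntegral.integral_const,
      intervalIntegral.integral_const_mul, integral_cos_sq]
    simp only [Real.sin_neg, Real.sin_pi, smul_eq_mul]
    ring
  rw [intervalIntegral.integral_congr hval, intervalIntegral.integral_const_mul] at hle
  nlinarith [Real.pi_pos]

theorem exists_rot_ne (hu : IsHenonSolution b U u) (hb : b = 1 ∨ b = 2 ∨ b = 3) {β : ℝ}
    (hβ : Complex.exp (β * I) ≠ 1) : ∃ q ∈ unitDisk, u (rot β q) ≠ u q := by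
  by_contra! h
  exact hu.not_radial hb fun p hp q hpq => hu.radial hβ h hp hpq

end IsHenonSolution

end Henon

/-- For `α ∈ {2,4,6}`, the Hénon equation `−Δu = (x²+y²)^{α/2} u³` on the unit
disk with zero boundary conditions admits a positive real analytic solution of
Morse index `1` that is not invariant under any nontrivial rotation. -/
theorem henon_index_one_minimally_symmetric_solution :
    ∀ a : ℕ, (a = 2 ∨ a = 4 ∨ a = 6) →
    ∃ u : ℝ × ℝ → ℝ,
      (∃ U : Set (ℝ × ℝ), IsOpen U ∧ closure unitDisk ⊆ U ∧ AnalyticOnNhd ℝ u U) ∧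
      (∀ q ∈ unitDisk, -lap u q = (q.1 ^ 2 + q.2 ^ 2) ^ (a / 2) * (u q) ^ 3) ∧
      (∀ q : ℝ × ℝ, q.1 ^ 2 + q.2 ^ 2 = 1 → u q = 0) ∧
      (∀ q ∈ unitDisk, 0 < u q) ∧
      MorseIndexEq (fun q => (q.1 ^ 2 + q.2 ^ 2) ^ (a / 2)) u 1 ∧
      (∀ β : ℝ, Complex.exp (β * Complex.I) ≠ 1 →
        ∃ q ∈ unitDisk, u (rot β q) ≠ u q) := by
  intro a ha
  obtain ⟨U, u, hu⟩ := Henon.exists_isHenonSolution (a / 2)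
  refine ⟨u, hu.analytic, fun q hq => ?_, fun q hq => hu.boundary hq, fun q hq => hu.pos hq,
    ⟨?_, fun V hV => ?_⟩, fun β hβ => hu.exists_rot_ne (by omega) hβ⟩
  · rw [Henon.lap_eq_lapl hu.smooth, hu.lapl_eq hq, neg_neg, Henon.weight]
  · rw [Nat.cast_one]
    exact hu.exists_negDefSubspace
  · rw [Nat.cast_one]
    exact hu.rank_le_one V hV
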